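/- Let G be a connected finite simple graph of order n ≥ 3, size m, total domination number γt, and maximum degree Δ(G). Set Δ = 3 if Δ(G) = 2 and Δ = Δ(G) if Δ(G) ≥ 3. Then m ≤ Δ(n − γt), and equality m = Δ(n − γt) holds if and only if G is isomorphic to one of the following graphs: C_k ∘ P_2 for some k ≥ 3; F_k for some k ≥ 0; L_k for some k ≥ 0; G_k for some k ≥ 1; H_k for some k ≥ 2; or GP_16. -/

import Mathlib

open SimpleGraph

/-- The total domination number of a finite simple graph `G`: the minimum size of a set `S`
of vertices such that every vertex of `G` has a neighbor in `S`. -/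
noncomputable def totalDominationNumber {V : Type*} [Fintype V] (G : SimpleGraph V) : ℕ :=
  sInf {n | ∃ S : Finset V, S.card = n ∧ ∀ v : V, ∃ u ∈ S, G.Adj v u}

/-- The almost total domination number of `G` with respect to `v`: the minimum size of a set
`S` with `v ∈ S`, `v` having no neighbor in `S`, and every vertex other than `v` having a
neighbor in `S`. -/
noncomputable def almostTotalDominationNumber {V : Type*} [Fintype V] (G : SimpleGraph V)
    (v : V) : ℕ :=
  sInf {n | ∃ S : Finset V, S.card = n ∧ v ∈ S ∧ (∀ u ∈ S, ¬ G.Adj v u) ∧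
    ∀ w : V, w ≠ v → ∃ u ∈ S, G.Adj w u}

/-- The graph obtained from `G` by deleting the vertex `v` and all incident edges. -/
def deleteVert {V : Type*} (G : SimpleGraph V) (v : V) : SimpleGraph {w : V // w ≠ v} :=
  G.induce {w : V | w ≠ v}

/-- The cycle `C_n` on vertex set `Fin n`. -/
def cycleG (n : ℕ) : SimpleGraph (Fin n) :=
  SimpleGraph.fromRel (fun p q => (q : ℕ) = ((p : ℕ) + 1) % n)

/-- The 2-corona `C_k ∘ P_2` of the cycle `C_k`.  Vertex `(0, i)` is the cycle vertex `x_i`,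
`(1, i)` is `x_i'` and `(2, i)` is `x_i''`, with pendant path `x_i x_i' x_i''`. -/
def coronaRel (k : ℕ) (p q : Fin 3 × Fin k) : Prop :=
  (p.1 = 0 ∧ q.1 = 0 ∧ (q.2 : ℕ) = ((p.2 : ℕ) + 1) % k) ∨
  (p.1 = 0 ∧ q.1 = 1 ∧ p.2 = q.2) ∨
  (p.1 = 1 ∧ q.1 = 2 ∧ p.2 = q.2)

def coronaGraph (k : ℕ) : SimpleGraph (Fin 3 × Fin k) :=
  SimpleGraph.fromRel (coronaRel k)

/-- The edges of `G_k` common to `G_k`, `H_k`, `F_k`, `L_k` (0-indexed: `(0,i) = a_{i+1}`,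
`(1,i) = b_{i+1}`, `(2,i) = c_{i+1}`, `(3,i) = d_{i+1}`): the two paths
`a_1 b_1 a_2 b_2 … a_k b_k` and `c_1 d_1 c_2 d_2 … c_k d_k`, and the edges `a_i d_i`,
`b_i c_i`. -/
def gkBase (k : ℕ) (p q : Fin 4 × Fin k) : Prop :=
  (p.1 = 0 ∧ q.1 = 1 ∧ p.2 = q.2) ∨
  (p.1 = 1 ∧ q.1 = 0 ∧ (p.2 : ℕ) + 1 = (q.2 : ℕ)) ∨
  (p.1 = 2 ∧ q.1 = 3 ∧ p.2 = q.2) ∨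
  (p.1 = 3 ∧ q.1 = 2 ∧ (p.2 : ℕ) + 1 = (q.2 : ℕ)) ∨
  (p.1 = 0 ∧ q.1 = 3 ∧ p.2 = q.2) ∨
  (p.1 = 1 ∧ q.1 = 2 ∧ p.2 = q.2)

/-- The cubic graph `G_k`: the base edges together with `a_1 c_1` and `b_k d_k`. -/
def gkRel (k : ℕ) (p q : Fin 4 × Fin k) : Prop :=
  gkBase k p q ∨
  (p.1 = 0 ∧ q.1 = 2 ∧ (p.2 : ℕ) = 0 ∧ (q.2 : ℕ) = 0) ∨
  (p.1 = 1 ∧ q.1 = 3 ∧ (p.2 : ℕ) = k - 1 ∧ (q.2 : ℕ) = k - 1)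

def GkGraph (k : ℕ) : SimpleGraph (Fin 4 × Fin k) :=
  SimpleGraph.fromRel (gkRel k)

/-- The cubic graph `H_k`: the base edges together with `a_1 b_k` and `c_1 d_k`. -/
def hkRel (k : ℕ) (p q : Fin 4 × Fin k) : Prop :=
  gkBase k p q ∨
  (p.1 = 0 ∧ q.1 = 1 ∧ (p.2 : ℕ) = 0 ∧ (q.2 : ℕ) = k - 1) ∨
  (p.1 = 2 ∧ q.1 = 3 ∧ (p.2 : ℕ) = 0 ∧ (q.2 : ℕ) = k - 1)

def HkGraph (k : ℕ) : SimpleGraph (Fin 4 × Fin k) :=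
  SimpleGraph.fromRel (hkRel k)

/-- Vertices of `F_k`: the vertices of `G_k` together with `v_1, v_2, v_3`
(encoded `Sum.inr 0`, `Sum.inr 1`, `Sum.inr 2`). -/
abbrev FkVert (k : ℕ) := (Fin 4 × Fin k) ⊕ Fin 3

/-- `F_k` is obtained from `G_k` by subdividing the edge `a_1 c_1` three times,
giving the path `a_1 v_1 v_2 v_3 c_1`. -/
def fkRel (k : ℕ) (p q : FkVert k) : Prop :=
  match p, q with
  | Sum.inl p, Sum.inl q =>
      gkBase k p q ∨
      (p.1 = 1 ∧ q.1 = 3 ∧ (p.2 : ℕ) = k - 1 ∧ (q.2 : ℕ) = k - 1)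
  | Sum.inl p, Sum.inr j =>
      (p.1 = 0 ∧ (p.2 : ℕ) = 0 ∧ j = 0) ∨ (p.1 = 2 ∧ (p.2 : ℕ) = 0 ∧ j = 2)
  | Sum.inr i, Sum.inr j => (j : ℕ) = (i : ℕ) + 1
  | Sum.inr _, Sum.inl _ => False

def FkGraph (k : ℕ) : SimpleGraph (FkVert k) :=
  SimpleGraph.fromRel (fkRel k)

/-- Vertices of `L_k`: the vertices of `G_k` together with `v_1, v_2, v_3`
(encoded `Sum.inr (0, j)`) and `u_1, u_2, u_3` (encoded `Sum.inr (1, j)`). -/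
abbrev LkVert (k : ℕ) := (Fin 4 × Fin k) ⊕ (Fin 2 × Fin 3)

/-- `L_k` is obtained from `G_k` by subdividing the edge `a_1 c_1` three times (path
`a_1 v_1 v_2 v_3 c_1`) and the edge `b_k d_k` three times (path `b_k u_1 u_2 u_3 d_k`). -/
def lkRel (k : ℕ) (p q : LkVert k) : Prop :=
  match p, q with
  | Sum.inl p, Sum.inl q => gkBase k p q
  | Sum.inl p, Sum.inr j =>
      (p.1 = 0 ∧ (p.2 : ℕ) = 0 ∧ j = ((0 : Fin 2), (0 : Fin 3))) ∨
      (p.1 = 2 ∧ (p.2 : ℕ) = 0 ∧ j = ((0 : Fin 2), (2 : Fin 3))) ∨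
      (p.1 = 1 ∧ (p.2 : ℕ) = k - 1 ∧ j = ((1 : Fin 2), (0 : Fin 3))) ∨
      (p.1 = 3 ∧ (p.2 : ℕ) = k - 1 ∧ j = ((1 : Fin 2), (2 : Fin 3)))
  | Sum.inr i, Sum.inr j => i.1 = j.1 ∧ (j.2 : ℕ) = (i.2 : ℕ) + 1
  | Sum.inr _, Sum.inl _ => False

def LkGraph (k : ℕ) : SimpleGraph (LkVert k) :=
  SimpleGraph.fromRel (lkRel k)

/-- The generalized Petersen graph `GP(8,3)` of order 16: `(0, i) = u_i`, `(1, i) = w_i`. -/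
def gpRel (p q : Fin 2 × Fin 8) : Prop :=
  (p.1 = 0 ∧ q.1 = 0 ∧ (q.2 : ℕ) = ((p.2 : ℕ) + 1) % 8) ∨
  (p.1 = 0 ∧ q.1 = 1 ∧ p.2 = q.2) ∨
  (p.1 = 1 ∧ q.1 = 1 ∧ (q.2 : ℕ) = ((p.2 : ℕ) + 3) % 8)

def GP16 : SimpleGraph (Fin 2 × Fin 8) :=
  SimpleGraph.fromRel gpRel

set_option linter.unusedSectionVars false

section Hypergraph

variable {α β : Type*} [DecidableEq α] [DecidableEq β] {F : β → Finset α}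
  {X : Finset α} {E : Finset β} {s : ℤ}

/-- `S ⊆ X` meets every edge `F e ∩ X`, `e ∈ E`. -/
def IsCover (F : β → Finset α) (X : Finset α) (E : Finset β) (S : Finset α) : Prop :=
  S ⊆ X ∧ ∀ e ∈ E, ∃ x ∈ S, x ∈ F e

theorem IsCover.insert_of_erase {x : α} (hx : x ∈ X) {S : Finset α}
    (h : IsCover F (X.erase x) (E.filter (x ∉ F ·)) S) : IsCover F X E (insert x S) := by
  refine ⟨Finset.insert_subset hx (h.1.trans (Finset.erase_subset _ _)), fun e he => ?_⟩
  by_cases hxe : x ∈ F e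
  · exact ⟨x, by simp, hxe⟩
  · obtain ⟨y, hy, hye⟩ := h.2 e (by simp [he, hxe])
    exact ⟨y, by simp [hy], hye⟩

/-- Every cover `S` satisfies `|X| + |E| ≤ 4 |S| + s`. -/
def SlackU (F : β → Finset α) (s : ℤ) (X : Finset α) (E : Finset β) : Prop :=
  ∀ S, IsCover F X E S → (X.card : ℤ) + E.card ≤ 4 * S.card + s

theorem SlackU.mono {s t : ℤ} (h : SlackU F s X E) (hst : s ≤ t) : SlackU F t X E :=
  fun S hS => (h S hS).trans (by linarith)

theorem SlackU.pick (h : SlackU F s X E) {x : α} (hx : x ∈ X) {A : Finset β}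
    (hA : A ⊆ E) (hxA : ∀ e ∈ A, x ∈ F e) :
    SlackU F (s + 3 - A.card) (X.erase x) (E.filter (x ∉ F ·)) := by
  intro S hS
  have h1 := h _ (hS.insert_of_erase hx)
  have h2 : ((insert x S).card : ℤ) ≤ S.card + 1 := by exact_mod_cast Finset.card_insert_le x S
  have h3 : ((X.erase x).card : ℤ) + 1 = X.card := by
    exact_mod_cast Finset.card_erase_add_one hx
  have h4 : A.card + (E.filter (x ∉ F ·)).card ≤ E.card := by
    rw [← Finset.card_filter_add_card_filter_not (s := E) (x ∈ F ·)]
    gcongr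
    exact fun e he => by simp [hA he, hxA e he]
  zify at h4
  linarith

theorem SlackU.drop (h : SlackU F s X E) {z : α} (hz : z ∈ X) :
    SlackU F (s - 1) (X.erase z) E := by
  intro S hS
  have h1 := h S ⟨hS.1.trans (Finset.erase_subset _ _), hS.2⟩
  have h3 : ((X.erase z).card : ℤ) + 1 = X.card := by
    exact_mod_cast Finset.card_erase_add_one hz
  linarith

theorem SlackU.pick_one (h : SlackU F s X E) {x : α} (hx : x ∈ X) {e : β} (he : e ∈ E)
    (hxe : x ∈ F e) : SlackU F (s + 2) (X.erase x) (E.filter (x ∉ F ·)) :=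
  (h.pick hx (A := {e}) (by simpa) (by simpa)).mono (by simp; omega)

theorem SlackU.pick_two (h : SlackU F s X E) {x : α} (hx : x ∈ X) {e f : β} (he : e ∈ E)
    (hf : f ∈ E) (hef : e ≠ f) (hxe : x ∈ F e) (hxf : x ∈ F f) :
    SlackU F (s + 1) (X.erase x) (E.filter (x ∉ F ·)) :=
  (h.pick hx (A := {e, f}) (by grind) (by grind)).mono (by
    rw [Finset.card_pair hef]; push_cast; omega)

theorem SlackU.pick_three (h : SlackU F s X E) {x : α} (hx : x ∈ X) {e f g : β} (he : e ∈ E)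
    (hf : f ∈ E) (hg : g ∈ E) (hef : e ≠ f) (heg : e ≠ g) (hfg : f ≠ g)
    (hxe : x ∈ F e) (hxf : x ∈ F f) (hxg : x ∈ F g) :
    SlackU F s (X.erase x) (E.filter (x ∉ F ·)) :=
  (h.pick hx (A := {e, f, g}) (by grind) (by grind)).mono (by
    rw [Finset.card_eq_three.mpr ⟨e, f, g, hef, heg, hfg, rfl⟩]; push_cast; omega)

theorem inter_erase_eq {x : α} {e : β} (h : x ∉ F e) : F e ∩ X.erase x = F e ∩ X := by
  grind

/-- Every edge has exactly three vertices. -/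
def Uniform3 (F : β → Finset α) (X : Finset α) (E : Finset β) : Prop :=
  ∀ e ∈ E, (F e ∩ X).card = 3

theorem Uniform3.exists_others (h : Uniform3 F X E) {e : β} (he : e ∈ E) {x : α} (hx : x ∈ X)
    (hxe : x ∈ F e) : ∃ a b, a ∈ X ∧ b ∈ X ∧ a ∈ F e ∧ b ∈ F e ∧ x ≠ a ∧ x ≠ b ∧ a ≠ b ∧
      ∀ y ∈ X, y ∈ F e → y = x ∨ y = a ∨ y = b := by
  have hm : x ∈ F e ∩ X := by simp [hx, hxe]
  have h2 : ((F e ∩ X).erase x).card = 2 := by rw [Finset.card_erase_of_mem hm, h e he]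
  obtain ⟨a, b, hab, hs⟩ := Finset.card_eq_two.mp h2
  have key : ∀ y, y ∈ (F e ∩ X).erase x ↔ y = a ∨ y = b := by simp [hs]
  refine ⟨a, b, ?_⟩
  have ha := (key a).2 (Or.inl rfl)
  have hb := (key b).2 (Or.inr rfl)
  simp only [Finset.mem_erase, Finset.mem_inter] at key ha hb
  grind

theorem Uniform3.pick (h : Uniform3 F X E) (x : α) :
    Uniform3 F (X.erase x) (E.filter (x ∉ F ·)) := by
  intro e he
  simp only [Finset.mem_filter] at he
  rw [inter_erase_eq he.2, h e he.1]

theorem Uniform3.drop (h : Uniform3 F X E) {z : α} (hz : ∀ e ∈ E, z ∉ F e) :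
    Uniform3 F (X.erase z) E := by
  intro e he
  rw [inter_erase_eq (hz e he), h e he]

/-- Distinct edges share at most one vertex. -/
def Linear (F : β → Finset α) (X : Finset α) (E : Finset β) : Prop :=
  ∀ e ∈ E, ∀ f ∈ E, e ≠ f → ∀ x ∈ X, ∀ y ∈ X, x ∈ F e → x ∈ F f → y ∈ F e → y ∈ F f → x = y

theorem Linear.mono (h : Linear F X E) {X' : Finset α} {E' : Finset β} (hX : X' ⊆ X)
    (hE : E' ⊆ E) : Linear F X' E' :=
  fun e he f hf hef x hx y hy => h e (hE he) f (hE hf) hef x (hX hx) y (hX hy)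

theorem size_pick_lt {x : α} (hx : x ∈ X) :
    (X.erase x).card + (E.filter (x ∉ F ·)).card < X.card + E.card := by
  have := Finset.card_erase_lt_of_mem hx
  have := Finset.card_filter_le E (x ∉ F ·)
  omega

theorem size_drop_lt {x : α} (hx : x ∈ X) : (X.erase x).card + E.card < X.card + E.card := by
  have := Finset.card_erase_lt_of_mem hx
  omega

theorem Uniform3.pick_drop (h : Uniform3 F X E) {x z : α} (hzE : ∀ e ∈ E, z ∈ F e → x ∈ F e) :
    Uniform3 F ((X.erase x).erase z) (E.filter (x ∉ F ·)) :=
  (h.pick x).drop (by simp only [Finset.mem_filter]; tauto)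

theorem Uniform3.pick_drop_drop (h : Uniform3 F X E) {x z y : α}
    (hzE : ∀ e ∈ E, z ∈ F e → x ∈ F e) (hyE : ∀ e ∈ E, y ∈ F e → x ∈ F e) :
    Uniform3 F (((X.erase x).erase z).erase y) (E.filter (x ∉ F ·)) :=
  (h.pick_drop hzE).drop (by simp only [Finset.mem_filter]; tauto)

/-- In every 3-uniform state of size less than `n` the slack is nonnegative, and in every linear
one with slack zero, an edge with a vertex of degree one has only vertices of degree one. -/
def SlackUBelow (F : β → Finset α) (n : ℕ) : Prop :=
  ∀ (X : Finset α) (E : Finset β), X.card + E.card < n → Uniform3 F X E →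
    (∀ s, SlackU F s X E → 0 ≤ s) ∧
    (Linear F X E → SlackU F 0 X E → ∀ z ∈ X, ∀ e ∈ E, z ∈ F e → (∀ f ∈ E, z ∈ F f → f = e) →
      ∀ x ∈ X, x ∈ F e → ∀ f ∈ E, x ∈ F f → f = e)

theorem SlackUBelow.nonneg_of_pick (ih : SlackUBelow F (X.card + E.card)) (hU : Uniform3 F X E)
    {x : α} (hx : x ∈ X) (h : SlackU F s (X.erase x) (E.filter (x ∉ F ·))) : 0 ≤ s :=
  (ih _ _ (size_pick_lt hx) (hU.pick x)).1 _ h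

theorem SlackUBelow.nonneg_of_pick_drop (ih : SlackUBelow F (X.card + E.card))
    (hU : Uniform3 F X E) {x z : α} (hx : x ∈ X) (hz : z ∈ X) (hzx : z ≠ x)
    (hzE : ∀ e ∈ E, z ∈ F e → x ∈ F e)
    (h : SlackU F s ((X.erase x).erase z) (E.filter (x ∉ F ·))) : 0 ≤ s :=
  (ih _ _ ((size_drop_lt (by simp [hz, hzx])).trans (size_pick_lt hx)) (hU.pick_drop hzE)).1 _ h

theorem SlackUBelow.nonneg_of_pick_drop_drop (ih : SlackUBelow F (X.card + E.card))
    (hU : Uniform3 F X E) {x z y : α} (hx : x ∈ X) (hz : z ∈ X) (hy : y ∈ X) (hzx : z ≠ x)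
    (hyx : y ≠ x) (hyz : y ≠ z) (hzE : ∀ e ∈ E, z ∈ F e → x ∈ F e)
    (hyE : ∀ e ∈ E, y ∈ F e → x ∈ F e)
    (h : SlackU F s (((X.erase x).erase z).erase y) (E.filter (x ∉ F ·))) : 0 ≤ s :=
  (ih _ _ ((size_drop_lt (by simp [hy, hyx, hyz])).trans
    ((size_drop_lt (by simp [hz, hzx])).trans (size_pick_lt hx)))
    (hU.pick_drop_drop hzE hyE)).1 _ h

set_option maxHeartbeats 1000000 in
theorem SlackUBelow.nonneg (ih : SlackUBelow F (X.card + E.card)) (hU : Uniform3 F X E)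
    (hs : SlackU F s X E) : 0 ≤ s := by
  by_cases h3 : ∃ x ∈ X, ∃ e ∈ E, ∃ f ∈ E, ∃ g ∈ E, e ≠ f ∧ e ≠ g ∧ f ≠ g ∧
      x ∈ F e ∧ x ∈ F f ∧ x ∈ F g
  · obtain ⟨x, hx, e, he, f, hf, g, hg, hef, heg, hfg, hxe, hxf, hxg⟩ := h3
    exact ih.nonneg_of_pick hU hx (hs.pick_three hx he hf hg hef heg hfg hxe hxf hxg)
  by_cases h0 : ∃ z ∈ X, ∀ e ∈ E, z ∉ F e
  · obtain ⟨z, hz, h⟩ := h0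
    have := (ih _ _ (size_drop_lt hz) (hU.drop h)).1 _ (hs.drop hz)
    omega
  by_cases h1 : ∃ z ∈ X, ∃ e ∈ E, z ∈ F e ∧ ∀ f ∈ E, z ∈ F f → f = e
  · obtain ⟨z, hz, e, he, hze, h1⟩ := h1
    by_cases h2 : ∃ x ∈ X, x ∈ F e ∧ ∃ f ∈ E, f ≠ e ∧ x ∈ F f
    · obtain ⟨x, hx, hxe, f, hf, hfe, hxf⟩ := h2
      have := ih.nonneg_of_pick_drop hU hx hz (by grind) (by grind)
        ((hs.pick_two hx he hf hfe.symm hxe hxf).drop (z := z) (by grind))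
      omega
    · obtain ⟨x, y, hx, hy, hxe, hye, hzx, hzy, hxy, -⟩ := hU.exists_others he hz hze
      have := ih.nonneg_of_pick_drop_drop hU hz hx hy (by grind) (by grind) (by grind) (by grind) (by grind)
        (((hs.pick_one hz he hze).drop (z := x) (by grind)).drop (z := y) (by grind))
      omega
  · by_cases hX : X = ∅
    · have hE : E = ∅ := by
        by_contra hne
        obtain ⟨e, he⟩ := Finset.nonempty_iff_ne_empty.mpr hne
        have := hU e he
        simp [hX] at this
      have := hs ∅ ⟨by simp, by simp [hE]⟩
      simpa [hX, hE] using this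
    obtain ⟨x, hx⟩ := Finset.nonempty_iff_ne_empty.mpr hX
    by_cases hL : Linear F X E
    · obtain ⟨e, he, hxe⟩ : ∃ e ∈ E, x ∈ F e := by grind
      obtain ⟨f, hf, hfe, hxf⟩ : ∃ f ∈ E, f ≠ e ∧ x ∈ F f := by grind
      obtain ⟨a, b, ha, hb, hae, hbe, hxa, hxb, hab, hall⟩ := hU.exists_others he hx hxe
      obtain ⟨c, d, hc, hd, hcf, hdf, hxc, hxd, hcd, hall'⟩ := hU.exists_others hf hx hxf
      obtain ⟨g, hg, hge, hag⟩ : ∃ g ∈ E, g ≠ e ∧ a ∈ F g := by grind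
      obtain ⟨k, l, hk, hl, hkg, hlg, hak, hal, hkl, hall''⟩ := hU.exists_others hg ha hag
      have hp := hs.pick_two hx he hf hfe.symm hxe hxf
      have h := ih.nonneg_of_pick hU hx hp
      by_contra hneg
      have h0' : SlackU F 0 (X.erase x) (E.filter (x ∉ F ·)) := hp.mono (by omega)
      have hxg : x ∉ F g := fun hxg => hxa (hL e he g hg hge.symm x hx a ha hxe hxg hae hag)
      have hL1 := (ih _ _ (size_pick_lt hx) (hU.pick x)).2
        (hL.mono (Finset.erase_subset _ _) (Finset.filter_subset _ _)) h0' a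
        (by grind) g (by grind) hag (by grind)
      have hk' : k ∈ F f := by
        have := hL1 k (by grind) hkg
        obtain ⟨r, hr, hrg, hkr⟩ : ∃ r ∈ E, r ≠ g ∧ k ∈ F r := by grind
        have hxr : x ∈ F r := by by_contra hxr; exact hrg (this r (by grind) hkr)
        have : r = e ∨ r = f := by grind
        rcases this with rfl | rfl
        · exact absurd (hL r he g hg hge.symm a ha k hk hae hag hkr hkg) hak
        · exact hkr
      have hl' : l ∈ F f := by
        have := hL1 l (by grind) hlg
        obtain ⟨r, hr, hrg, hkr⟩ : ∃ r ∈ E, r ≠ g ∧ l ∈ F r := by grind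
        have hxr : x ∈ F r := by by_contra hxr; exact hrg (this r (by grind) hkr)
        have : r = e ∨ r = f := by grind
        rcases this with rfl | rfl
        · exact absurd (hL r he g hg hge.symm a ha l hl hae hag hkr hlg) hal
        · exact hkr
      exact hkl (hL g hg f hf (by grind) k hk l hl hkg hk' hlg hl')
    · unfold Linear at hL
      push Not at hL
      obtain ⟨e, he, f, hf, hef, x, hx, y, hy, hxe, hxf, hye, hyf, hxy⟩ := hL
      have := ih.nonneg_of_pick_drop hU hx hy (by grind) (by grind)
        ((hs.pick_two hx he hf hef hxe hxf).drop (z := y) (by grind))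
      omega

set_option maxHeartbeats 1000000 in
theorem SlackUBelow.eq_of_linear (ih : SlackUBelow F (X.card + E.card)) (hU : Uniform3 F X E)
    (hL : Linear F X E) (hs : SlackU F 0 X E) {z : α} (hz : z ∈ X) {e : β} (he : e ∈ E)
    (hze : z ∈ F e) (hz1 : ∀ f ∈ E, z ∈ F f → f = e)
    {x : α} (hx : x ∈ X) (hxe : x ∈ F e) {f : β} (hf : f ∈ E) (hxf : x ∈ F f) : f = e := by
  by_contra hfe
  by_cases h3 : ∃ g ∈ E, g ≠ e ∧ g ≠ f ∧ x ∈ F g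
  · obtain ⟨g, hg, hge, hgf, hxg⟩ := h3
    have := ih.nonneg_of_pick_drop hU hx hz (by grind) (by grind)
      ((hs.pick_three hx he hf hg (by grind) (by grind) (by grind) hxe hxf hxg).drop (z := z)
        (by grind))
    omega
  have hzx : z ≠ x := by grind
  have hp := (hs.pick_two hx he hf (by grind) hxe hxf).drop (z := z) (by grind)
  obtain ⟨y, hy, hye, hyz, hyx⟩ : ∃ y ∈ X, y ∈ F e ∧ y ≠ z ∧ y ≠ x := by
    obtain ⟨a, b, h⟩ := hU.exists_others he hx hxe
    grind
  by_cases hy1 : ∃ g ∈ E, g ≠ e ∧ y ∈ F g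
  · obtain ⟨g, hg, hge, hyg⟩ := hy1
    have hxg : x ∉ F g := fun hxg => hyx (hL g hg e he hge y hy x hx hyg hye hxg hxe)
    by_cases hy3 : ∃ r ∈ E, r ≠ e ∧ r ≠ g ∧ y ∈ F r
    · obtain ⟨r, hr, hre, hrg, hyr⟩ := hy3
      have := ih.nonneg_of_pick_drop hU hy hz (by grind) (by grind)
        ((hs.pick_three hy he hg hr (by grind) (by grind) (by grind) hye hyg hyr).drop (z := z)
          (by grind))
      omega
    obtain ⟨k, l, hk, hl, hkg, hlg, hyk, hyl, hkl, hall⟩ := hU.exists_others hg hy hyg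
    have hU' : Uniform3 F ((X.erase x).erase z) (E.filter (x ∉ F ·)) :=
      (hU.pick x).drop (by grind)
    have hL1 := (ih _ _ ((size_drop_lt (by simp [hz, hzx])).trans (size_pick_lt hx)) hU').2
      (hL.mono ((Finset.erase_subset _ _).trans (Finset.erase_subset _ _))
        (Finset.filter_subset _ _)) (hp.mono (by omega)) y (by grind) g (by grind) hyg
      (by grind)
    have main : ∀ k ∈ X, k ∈ F g → k ≠ y → k ∈ F f := by
      intro k hk hkg hky
      have h := hL1 k (by grind) hkg
      by_contra hkf
      have hke : k ∉ F e := fun hke => hky (hL g hg e he hge k hk y hy hkg hke hyg hye)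
      have := ih.nonneg_of_pick_drop_drop hU hy hz hk (by grind) (by grind) (by grind) (by grind) (by grind)
        (((hs.pick_two hy he hg (by grind) hye hyg).drop (z := z) (by grind)).drop (z := k)
          (by grind))
      omega
    exact hkl (hL g hg f hf (by grind) k hk l hl hkg (main k hk hkg hyk.symm) hlg
      (main l hl hlg hyl.symm))
  · have := ih.nonneg_of_pick_drop_drop hU hx hz hy (by grind) (by grind) (by grind) (by grind) (by grind)
      (hp.drop (z := y) (by grind))
    omega

theorem slackUBelow (n : ℕ) : SlackUBelow F n := by
  induction n with
  | zero => intro X E h; omega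
  | succ n ih =>
    intro X E h hU
    have ih' : SlackUBelow F (X.card + E.card) := fun X' E' h' => ih X' E' (by omega)
    exact ⟨fun s hs => ih'.nonneg hU hs, fun hL hs z hz e he hze hz1 x hx hxe f hf hxf =>
      ih'.eq_of_linear hU hL hs hz he hze hz1 hx hxe hf hxf⟩

theorem SlackU.nonneg (h : SlackU F s X E) (hU : Uniform3 F X E) : 0 ≤ s :=
  (slackUBelow _ X E (Nat.lt_succ_self _) hU).1 s h

theorem SlackU.eq_of_linear (h : SlackU F 0 X E) (hU : Uniform3 F X E) (hL : Linear F X E)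
    {z : α} (hz : z ∈ X) {e : β} (he : e ∈ E) (hze : z ∈ F e) (h1 : ∀ f ∈ E, z ∈ F f → f = e)
    {x : α} (hx : x ∈ X) (hxe : x ∈ F e) {f : β} (hf : f ∈ E) (hxf : x ∈ F f) : f = e :=
  (slackUBelow _ X E (Nat.lt_succ_self _) hU).2 hL h z hz e he hze h1 x hx hxe f hf hxf

end Hypergraph

section Hypergraph

variable {α β : Type*} [DecidableEq α] [DecidableEq β] {F : β → Finset α}
  {X : Finset α} {E : Finset β} {s : ℤ}

/-- The weight of an edge: `2` for edges of size at most two and `1` otherwise. -/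
def edgeWeight (F : β → Finset α) (X : Finset α) (e : β) : ℤ :=
  if (F e ∩ X).card ≤ 2 then 2 else 1

theorem edgeWeight_nonneg (e : β) : 1 ≤ edgeWeight F X e := by
  unfold edgeWeight; split <;> norm_num

theorem edgeWeight_of_two {e : β} (h : (F e ∩ X).card = 2) : edgeWeight F X e = 2 := by
  simp [edgeWeight, h]

theorem edgeWeight_of_three {e : β} (h : (F e ∩ X).card = 3) : edgeWeight F X e = 1 := by
  simp [edgeWeight, h]

theorem edgeWeight_erase {e : β} {x : α} (h : x ∉ F e) :
    edgeWeight F (X.erase x) e = edgeWeight F X e := by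
  simp [edgeWeight, inter_erase_eq h]

/-- Every cover `S` satisfies `2 |X| + ∑ w(e) ≤ 6 |S| + s`. -/
def Slack (F : β → Finset α) (s : ℤ) (X : Finset α) (E : Finset β) : Prop :=
  ∀ S, IsCover F X E S → 2 * (X.card : ℤ) + ∑ e ∈ E, edgeWeight F X e ≤ 6 * S.card + s

theorem Slack.mono {s t : ℤ} (h : Slack F s X E) (hst : s ≤ t) : Slack F t X E :=
  fun S hS => (h S hS).trans (by linarith)

theorem Slack.pick (h : Slack F s X E) {x : α} (hx : x ∈ X) {A : Finset β}
    (hA : A ⊆ E) (hxA : ∀ e ∈ A, x ∈ F e) :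
    Slack F (s + 4 - ∑ e ∈ A, edgeWeight F X e) (X.erase x) (E.filter (x ∉ F ·)) := by
  intro S hS
  have h1 := h _ (hS.insert_of_erase hx)
  have h2 : ((insert x S).card : ℤ) ≤ S.card + 1 := by exact_mod_cast Finset.card_insert_le x S
  have h3 : ((X.erase x).card : ℤ) + 1 = X.card := by
    exact_mod_cast Finset.card_erase_add_one hx
  have h4 : ∑ e ∈ A, edgeWeight F X e ≤ ∑ e ∈ E.filter (x ∈ F ·), edgeWeight F X e :=
    Finset.sum_le_sum_of_subset_of_nonneg (fun e he => by simp [hA he, hxA e he])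
      (fun e _ _ => by linarith [edgeWeight_nonneg (F := F) (X := X) e])
  have h5 : ∑ e ∈ E.filter (x ∉ F ·), edgeWeight F (X.erase x) e =
      ∑ e ∈ E.filter (x ∉ F ·), edgeWeight F X e :=
    Finset.sum_congr rfl fun e he => edgeWeight_erase (Finset.mem_filter.1 he).2
  have h6 := Finset.sum_filter_add_sum_filter_not E (x ∈ F ·) (edgeWeight F X)
  linarith

theorem Slack.drop (h : Slack F s X E) {z : α} (hz : z ∈ X) (hzE : ∀ e ∈ E, z ∉ F e) :
    Slack F (s - 2) (X.erase z) E := by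
  intro S hS
  have h1 := h S ⟨hS.1.trans (Finset.erase_subset _ _), hS.2⟩
  have h3 : ((X.erase z).card : ℤ) + 1 = X.card := by
    exact_mod_cast Finset.card_erase_add_one hz
  have h5 : ∑ e ∈ E, edgeWeight F (X.erase z) e = ∑ e ∈ E, edgeWeight F X e :=
    Finset.sum_congr rfl fun e he => edgeWeight_erase (hzE e he)
  linarith

theorem card_inter_erase {z : α} {e : β} (hz : z ∈ X) (hze : z ∈ F e) :
    (F e ∩ X.erase z).card + 1 = (F e ∩ X).card := by
  rw [Finset.inter_erase]
  exact Finset.card_erase_add_one (by simp [hz, hze])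

theorem Slack.drop_one (h : Slack F s X E) {z : α} (hz : z ∈ X) {e : β} (he : e ∈ E)
    (hze : z ∈ F e) (h1 : ∀ f ∈ E, z ∈ F f → f = e) (h3 : (F e ∩ X).card = 3) :
    Slack F (s - 1) (X.erase z) E := by
  intro S hS
  have h1' := h S ⟨hS.1.trans (Finset.erase_subset _ _), hS.2⟩
  have hc : ((X.erase z).card : ℤ) + 1 = X.card := by
    exact_mod_cast Finset.card_erase_add_one hz
  have h4 : edgeWeight F (X.erase z) e = 2 :=
    edgeWeight_of_two (by have := card_inter_erase hz hze; omega)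
  have h5 : ∑ f ∈ E.erase e, edgeWeight F (X.erase z) f = ∑ f ∈ E.erase e, edgeWeight F X f :=
    Finset.sum_congr rfl fun f hf => edgeWeight_erase (by
      rw [Finset.mem_erase] at hf; exact fun hzf => hf.1 (h1 f hf.2 hzf))
  rw [← Finset.add_sum_erase _ _ he, edgeWeight_of_three h3] at h1'
  rw [← Finset.add_sum_erase _ _ he, h4, h5]
  linarith

theorem Slack.erase_edge (h : Slack F s X E) {e f : β} (he : e ∈ E) (hf : f ∈ E) (hef : e ≠ f)
    (hsub : ∀ x ∈ X, x ∈ F e → x ∈ F f) : Slack F (s - edgeWeight F X f) X (E.erase f) := by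
  intro S hS
  have h1 := h S ⟨hS.1, fun g hg => by
    by_cases hgf : g = f
    · obtain ⟨x, hx, hxe⟩ := hS.2 e (by simp [he, hef])
      exact ⟨x, hx, hgf ▸ hsub x (hS.1 hx) hxe⟩
    · exact hS.2 g (by simp [hg, hgf])⟩
  rw [← Finset.add_sum_erase _ _ hf] at h1
  linarith

theorem Slack.pick_one (h : Slack F s X E) {x : α} (hx : x ∈ X) {e : β} (he : e ∈ E)
    (hxe : x ∈ F e) :
    Slack F (s + 4 - edgeWeight F X e) (X.erase x) (E.filter (x ∉ F ·)) :=
  (h.pick hx (A := {e}) (by simpa) (by simpa)).mono (by simp)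

theorem Slack.pick_two (h : Slack F s X E) {x : α} (hx : x ∈ X) {e f : β} (he : e ∈ E)
    (hf : f ∈ E) (hef : e ≠ f) (hxe : x ∈ F e) (hxf : x ∈ F f) :
    Slack F (s + 4 - edgeWeight F X e - edgeWeight F X f) (X.erase x) (E.filter (x ∉ F ·)) :=
  (h.pick hx (A := {e, f}) (by grind) (by grind)).mono (by
    rw [Finset.sum_pair hef]; linarith)

theorem Slack.pick_three (h : Slack F s X E) {x : α} (hx : x ∈ X) {e f g : β} (he : e ∈ E)
    (hf : f ∈ E) (hg : g ∈ E) (hef : e ≠ f) (heg : e ≠ g) (hfg : f ≠ g)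
    (hxe : x ∈ F e) (hxf : x ∈ F f) (hxg : x ∈ F g) :
    Slack F (s + 4 - edgeWeight F X e - edgeWeight F X f - edgeWeight F X g)
      (X.erase x) (E.filter (x ∉ F ·)) :=
  (h.pick hx (A := {e, f, g}) (by grind) (by grind)).mono (by
    rw [Finset.sum_insert (by grind), Finset.sum_pair hfg]; linarith)

theorem Slack.pick_four (h : Slack F s X E) {x : α} (hx : x ∈ X) {e f g k : β} (he : e ∈ E)
    (hf : f ∈ E) (hg : g ∈ E) (hk : k ∈ E) (hef : e ≠ f) (heg : e ≠ g) (hek : e ≠ k)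
    (hfg : f ≠ g) (hfk : f ≠ k) (hgk : g ≠ k)
    (hxe : x ∈ F e) (hxf : x ∈ F f) (hxg : x ∈ F g) (hxk : x ∈ F k) :
    Slack F s (X.erase x) (E.filter (x ∉ F ·)) :=
  (h.pick hx (A := {e, f, g, k}) (by grind) (by grind)).mono (by
    rw [Finset.sum_insert (by grind), Finset.sum_insert (by grind), Finset.sum_pair hgk]
    linarith [edgeWeight_nonneg (F := F) (X := X) e, edgeWeight_nonneg (F := F) (X := X) f,
      edgeWeight_nonneg (F := F) (X := X) g, edgeWeight_nonneg (F := F) (X := X) k])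

/-- Every edge has two or three vertices. -/
def Sized (F : β → Finset α) (X : Finset α) (E : Finset β) : Prop :=
  ∀ e ∈ E, (F e ∩ X).card = 2 ∨ (F e ∩ X).card = 3

theorem Sized.exists_other {e : β} (h : (F e ∩ X).card = 2) {x : α} (hx : x ∈ X)
    (hxe : x ∈ F e) : ∃ y ∈ X, y ∈ F e ∧ x ≠ y ∧ ∀ w ∈ X, w ∈ F e → w = x ∨ w = y := by
  have hm : x ∈ F e ∩ X := by simp [hx, hxe]
  have h2 : ((F e ∩ X).erase x).card = 1 := by rw [Finset.card_erase_of_mem hm, h]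
  obtain ⟨y, hy⟩ := Finset.card_eq_one.mp h2
  have key : ∀ w, w ∈ (F e ∩ X).erase x ↔ w = y := by simp [hy]
  refine ⟨y, ?_⟩
  have := (key y).2 rfl
  simp only [Finset.mem_erase, Finset.mem_inter] at key this
  grind

theorem Sized.pick (h : Sized F X E) (x : α) : Sized F (X.erase x) (E.filter (x ∉ F ·)) := by
  intro e he
  simp only [Finset.mem_filter] at he
  rw [inter_erase_eq he.2]
  exact h e he.1

theorem Sized.drop (h : Sized F X E) {z : α} (hz : ∀ e ∈ E, z ∉ F e) : Sized F (X.erase z) E := by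
  intro e he
  rw [inter_erase_eq (hz e he)]
  exact h e he

theorem Sized.drop_one (h : Sized F X E) {z : α} (hz : z ∈ X) {e : β}
    (h1 : ∀ f ∈ E, z ∈ F f → f = e) (h3 : (F e ∩ X).card = 3) : Sized F (X.erase z) E := by
  intro f hf
  by_cases hzf : z ∈ F f
  · obtain rfl := h1 f hf hzf
    have := card_inter_erase hz hzf
    omega
  · rw [inter_erase_eq hzf]
    exact h f hf

theorem Sized.subset (h : Sized F X E) {E' : Finset β} (hE : E' ⊆ E) : Sized F X E' :=
  fun e he => h e (hE he)

theorem sum_degree_eq (F : β → Finset α) (X : Finset α) (E : Finset β) :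
    ∑ x ∈ X, (E.filter (x ∈ F ·)).card = ∑ e ∈ E, (F e ∩ X).card := by
  refine (Finset.sum_card_bipartiteAbove_eq_sum_card_bipartiteBelow (fun x e => x ∈ F e)).trans ?_
  refine Finset.sum_congr rfl fun e _ => ?_
  congr 1
  ext x
  simp [Finset.bipartiteBelow, and_comm]

theorem Uniform3.exists_cover (hU : Uniform3 F X E) :
    ∃ S, IsCover F X E S ∧ 4 * (S.card : ℤ) ≤ X.card + E.card := by
  by_contra! hno
  have h : SlackU F (-1) X E := fun S hS => by
    have := hno S hS
    omega
  have := h.nonneg hU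
  omega

theorem card_mul_three_le (hU : Uniform3 F X E)
    (hd : ∀ x ∈ X, (E.filter (x ∈ F ·)).card ≤ 3) : E.card ≤ X.card := by
  have h1 := sum_degree_eq F X E
  rw [Finset.sum_congr rfl hU, Finset.sum_const, smul_eq_mul] at h1
  have h2 := Finset.sum_le_card_nsmul X _ 3 hd
  rw [smul_eq_mul] at h2
  omega

theorem Uniform3.sum_edgeWeight (hU : Uniform3 F X E) :
    ∑ e ∈ E, edgeWeight F X e = E.card := by
  rw [Finset.sum_congr rfl fun e he => edgeWeight_of_three (hU e he)]
  simp

theorem exists_four_of_card {T : Finset β} (h : 4 ≤ T.card) : ∃ a ∈ T, ∃ b ∈ T, ∃ c ∈ T, ∃ d ∈ T,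
    a ≠ b ∧ a ≠ c ∧ a ≠ d ∧ b ≠ c ∧ b ≠ d ∧ c ≠ d := by
  obtain ⟨U, hU, hc⟩ := Finset.exists_subset_card_eq h
  obtain ⟨a, b, c, d, h⟩ := Finset.card_eq_four.mp hc
  have hm : ∀ x, x ∈ U ↔ x = a ∨ x = b ∨ x = c ∨ x = d := by simp [h]
  exact ⟨a, hU ((hm a).2 (by simp)), b, hU ((hm b).2 (by simp)), c, hU ((hm c).2 (by simp)), d,
    hU ((hm d).2 (by simp)), by tauto⟩

set_option maxHeartbeats 1000000 in
theorem Slack.nonneg (h : Slack F s X E) (hS : Sized F X E) : 0 ≤ s := by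
  induction hn : X.card + E.card using Nat.strong_induction_on generalizing X E s with
  | _ n ih =>
  subst hn
  by_cases h4 : ∃ x ∈ X, ∃ e ∈ E, ∃ f ∈ E, ∃ g ∈ E, ∃ k ∈ E, e ≠ f ∧ e ≠ g ∧ e ≠ k ∧
      f ≠ g ∧ f ≠ k ∧ g ≠ k ∧ x ∈ F e ∧ x ∈ F f ∧ x ∈ F g ∧ x ∈ F k
  · obtain ⟨x, hx, e, he, f, hf, g, hg, k, hk, hh⟩ := h4
    exact ih _ (size_pick_lt hx) (h.pick_four hx he hf hg hk (by tauto) (by tauto) (by tauto)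
      (by tauto) (by tauto) (by tauto) (by tauto) (by tauto) (by tauto) (by tauto)) (hS.pick x) rfl
  by_cases h0 : ∃ z ∈ X, ∀ e ∈ E, z ∉ F e
  · obtain ⟨z, hz, hzE⟩ := h0
    have := ih _ (size_drop_lt hz) (h.drop hz hzE) (hS.drop hzE) rfl
    omega
  by_cases h2 : ∃ e ∈ E, (F e ∩ X).card = 2
  · obtain ⟨e, he, h2⟩ := h2
    obtain ⟨x, hx⟩ : (F e ∩ X).Nonempty := Finset.card_pos.mp (by omega)
    rw [Finset.mem_inter] at hx
    obtain ⟨hxe, hx⟩ := hx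
    obtain ⟨y, hy, hye, hxy, hall⟩ := Sized.exists_other h2 hx hxe
    have hwe := edgeWeight_of_two h2
    have hw := fun f : β => edgeWeight_nonneg (F := F) (X := X) f
    by_cases h22 : ∃ x ∈ X, x ∈ F e ∧ ∃ f ∈ E, f ≠ e ∧ x ∈ F f ∧ (F f ∩ X).card = 2
    · obtain ⟨x, hx, hxe, f, hf, hfe, hxf, h2'⟩ := h22
      have := ih _ (size_pick_lt hx) (h.pick_two hx he hf hfe.symm hxe hxf) (hS.pick x) rfl
      rw [hwe, edgeWeight_of_two h2'] at this
      omega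
    by_cases h23 : ∃ x ∈ X, x ∈ F e ∧ ∃ f ∈ E, ∃ g ∈ E, f ≠ e ∧ g ≠ e ∧ f ≠ g ∧ x ∈ F f ∧ x ∈ F g
    · obtain ⟨x, hx, hxe, f, hf, g, hg, hfe, hge, hfg, hxf, hxg⟩ := h23
      have := ih _ (size_pick_lt hx) (h.pick_three hx he hf hg hfe.symm hge.symm hfg hxe hxf hxg)
        (hS.pick x) rfl
      have := hw f
      have := hw g
      omega
    by_cases hx1 : ∃ f ∈ E, f ≠ e ∧ x ∈ F f
    · obtain ⟨f, hf, hfe, hxf⟩ := hx1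
      have hp := h.pick_two hx he hf hfe.symm hxe hxf
      have hyx : y ∈ X.erase x := by simp [hy, hxy.symm]
      by_cases hy1 : ∃ g ∈ E, g ≠ e ∧ y ∈ F g ∧ x ∉ F g
      · obtain ⟨g, hg, hge, hyg, hxg⟩ := hy1
        have hg3 : (F g ∩ X).card = 3 := by
          rcases hS g hg with h | h
          · exact absurd ⟨y, hy, hye, g, hg, hge, hyg, h⟩ h22
          · exact h
        have hyu : ∀ f ∈ E.filter (x ∉ F ·), y ∈ F f → f = g := by clear ih; grind
        have hg3' : (F g ∩ X.erase x).card = 3 := by rwa [inter_erase_eq hxg]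
        have := ih _ ((size_drop_lt hyx).trans (size_pick_lt hx))
          (hp.drop_one hyx (by simp [hg, hxg]) hyg hyu hg3') ((hS.pick x).drop_one hyx hyu hg3') rfl
        have := hw f
        omega
      · have hyu : ∀ f ∈ E.filter (x ∉ F ·), y ∉ F f := by clear ih; grind
        have := ih _ ((size_drop_lt hyx).trans (size_pick_lt hx)) (hp.drop hyx hyu)
          ((hS.pick x).drop hyu) rfl
        have := hw f
        omega
    · have hp := h.pick_one hy he hye
      have hxu : ∀ f ∈ E.filter (y ∉ F ·), x ∉ F f := by clear ih; grind
      have hxy' : x ∈ X.erase y := by simp [hx, hxy]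
      have := ih _ ((size_drop_lt hxy').trans (size_pick_lt hy)) (hp.drop hxy' hxu)
        ((hS.pick y).drop hxu) rfl
      omega
  · have hU : Uniform3 F X E := fun e he => (hS e he).resolve_left fun h => h2 ⟨e, he, h⟩
    have hd : ∀ x ∈ X, (E.filter (x ∈ F ·)).card ≤ 3 := by
      intro x hx
      by_contra! h
      obtain ⟨e, he, f, hf, g, hg, k, hk, h⟩ := exists_four_of_card h
      simp only [Finset.mem_filter] at he hf hg hk
      exact h4 ⟨x, hx, e, he.1, f, hf.1, g, hg.1, k, hk.1, by tauto⟩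
    have hm := card_mul_three_le hU hd
    obtain ⟨S, hS, hc⟩ := hU.exists_cover
    have := h S hS
    rw [hU.sum_edgeWeight] at this
    omega

/-- Tight 3-uniform states are 3-regular, with as many edges as vertices. -/
theorem Slack.regular_of_uniform (h : Slack F 0 X E) (hU : Uniform3 F X E)
    (hd : ∀ x ∈ X, (E.filter (x ∈ F ·)).card ≤ 3) :
    (∀ x ∈ X, (E.filter (x ∈ F ·)).card = 3) ∧ SlackU F 0 X E := by
  have hm := card_mul_three_le hU hd
  obtain ⟨S, hS, hc⟩ := hU.exists_cover
  have h1 := h S hS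
  rw [hU.sum_edgeWeight] at h1
  have hm' : E.card = X.card := by omega
  constructor
  · intro x hx
    refine le_antisymm (hd x hx) ?_
    by_contra! hlt
    have h1 := sum_degree_eq F X E
    rw [Finset.sum_congr rfl hU, Finset.sum_const, smul_eq_mul] at h1
    have h2 := Finset.sum_lt_sum hd ⟨x, hx, hlt⟩
    rw [Finset.sum_const, smul_eq_mul] at h2
    omega
  · intro S hS
    have := h S hS
    rw [hU.sum_edgeWeight] at this
    omega

end Hypergraph

section Hypergraph

variable {α β : Type*} [DecidableEq α] [DecidableEq β] {F : β → Finset α}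
  {X : Finset α} {E : Finset β} {s : ℤ}

theorem IsCover.of_subset {F' : β → Finset α} (hF : ∀ e ∈ E, F' e ⊆ F e) {S : Finset α}
    (h : IsCover F' X E S) : IsCover F X E S :=
  ⟨h.1, fun e he => (h.2 e he).imp fun _ hx => ⟨hx.1, hF e he hx.2⟩⟩

theorem exists_cover_of_two_le (h : ∀ e ∈ E, 2 ≤ (F e ∩ X).card) :
    ∃ S, IsCover F X E S ∧ 6 * (S.card : ℤ) ≤ 2 * X.card + ∑ e ∈ E, edgeWeight F X e := by
  have hex : ∀ e, ∃ T ⊆ F e ∩ X, T.card = min 3 (F e ∩ X).card := fun e =>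
    Finset.exists_subset_card_eq (min_le_right _ _)
  choose T hT hc using hex
  have hTX : ∀ e, T e ∩ X = T e := fun e =>
    Finset.inter_eq_left.2 ((hT e).trans Finset.inter_subset_right)
  have hS : Sized T X E := fun e he => by
    have := h e he
    rw [hTX, hc]
    omega
  have hw : ∑ e ∈ E, edgeWeight T X e = ∑ e ∈ E, edgeWeight F X e :=
    Finset.sum_congr rfl fun e he => by
      unfold edgeWeight
      rw [hTX, hc]
      congr 1
      simp
  by_contra! hno
  have hs : Slack T (-1) X E := fun S hS => by
    have := hno S (hS.of_subset fun e _ => (hT e).trans Finset.inter_subset_left)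
    omega
  have := hs.nonneg hS
  omega

theorem exists_cover_of_three_le (h : ∀ e ∈ E, 3 ≤ (F e ∩ X).card) :
    ∃ S, IsCover F X E S ∧ 4 * (S.card : ℤ) ≤ X.card + E.card := by
  have hex : ∀ e, ∃ T ⊆ F e ∩ X, T.card = min 3 (F e ∩ X).card := fun e =>
    Finset.exists_subset_card_eq (min_le_right _ _)
  choose T hT hc using hex
  have hTX : ∀ e, T e ∩ X = T e := fun e =>
    Finset.inter_eq_left.2 ((hT e).trans Finset.inter_subset_right)
  have hU : Uniform3 T X E := fun e he => by
    have := h e he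
    rw [hTX, hc]
    omega
  obtain ⟨S, hS, hc⟩ := hU.exists_cover
  exact ⟨S, hS.of_subset fun e _ => (hT e).trans Finset.inter_subset_left, hc⟩

theorem exists_cover_of_four_le (h : ∀ e ∈ E, 4 ≤ (F e ∩ X).card) (hX : X.Nonempty) :
    ∃ S, IsCover F X E S ∧ 6 * (S.card : ℤ) < 2 * X.card + E.card := by
  induction hn : X.card using Nat.strong_induction_on generalizing X E with
  | _ n ih =>
  subst hn
  by_cases hd : ∃ x ∈ X, 4 ≤ (E.filter (x ∈ F ·)).card
  · obtain ⟨x, hx, h4⟩ := hd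
    obtain ⟨e, he⟩ : (E.filter (x ∈ F ·)).Nonempty := Finset.card_pos.mp (by omega)
    have h' := (h e (Finset.mem_filter.1 he).1).trans (Finset.card_le_card Finset.inter_subset_right)
    have hc := Finset.card_erase_add_one hx
    obtain ⟨S, hS, hlt⟩ := ih _ (Finset.card_erase_lt_of_mem hx) (X := X.erase x)
      (E := E.filter (x ∉ F ·)) (fun e he => by
        rw [Finset.mem_filter] at he
        rw [inter_erase_eq he.2]
        exact h e he.1) (Finset.card_pos.mp (by omega)) rfl
    refine ⟨_, hS.insert_of_erase hx, ?_⟩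
    have h1 := Finset.card_insert_le x S
    have h2 := Finset.card_filter_add_card_filter_not (s := E) (x ∈ F ·)
    omega
  · push Not at hd
    obtain ⟨S, hS, hc⟩ := exists_cover_of_three_le (F := F) (X := X) (E := E)
      fun e he => (by norm_num : 3 ≤ 4).trans (h e he)
    refine ⟨S, hS, ?_⟩
    have h1 := sum_degree_eq F X E
    have h2 := Finset.sum_le_card_nsmul X _ 3 fun x hx => Nat.lt_succ_iff.1 (hd x hx)
    have h3 := Finset.card_nsmul_le_sum E _ 4 h
    have h4 := hX.card_pos
    rw [smul_eq_mul] at h2 h3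
    omega

end Hypergraph

section Hypergraph

variable {α β : Type*} [DecidableEq α] [DecidableEq β] {F : β → Finset α}
  {X : Finset α} {E : Finset β} {s : ℤ}

theorem Sized.exists_others {e : β} (h : (F e ∩ X).card = 3) {x : α} (hx : x ∈ X)
    (hxe : x ∈ F e) : ∃ a b, a ∈ X ∧ b ∈ X ∧ a ∈ F e ∧ b ∈ F e ∧ x ≠ a ∧ x ≠ b ∧ a ≠ b ∧
      ∀ y ∈ X, y ∈ F e → y = x ∨ y = a ∨ y = b :=
  Uniform3.exists_others (E := {e}) (by simpa [Uniform3] using h) (by simp) hx hxe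

/-- States with slack zero, edges of size two or three and maximum degree at most three. -/
structure Tight (F : β → Finset α) (X : Finset α) (E : Finset β) : Prop where
  sized : Sized F X E
  degree : ∀ x ∈ X, (E.filter (x ∈ F ·)).card ≤ 3
  slack : Slack F 0 X E

namespace Tight

theorem degree_mono (h : Tight F X E) {X' : Finset α} {E' : Finset β} (hX : X' ⊆ X)
    (hE : E' ⊆ E) : ∀ x ∈ X', (E'.filter (x ∈ F ·)).card ≤ 3 := fun x hx =>
  (Finset.card_le_card (Finset.filter_subset_filter _ hE)).trans (h.degree x (hX hx))

theorem not_four (h : Tight F X E) {x : α} (hx : x ∈ X) {e f g k : β} (he : e ∈ E)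
    (hf : f ∈ E) (hg : g ∈ E) (hk : k ∈ E) (hxe : x ∈ F e) (hxf : x ∈ F f) (hxg : x ∈ F g)
    (hxk : x ∈ F k) (hef : e ≠ f) (heg : e ≠ g) (hek : e ≠ k) (hfg : f ≠ g) (hfk : f ≠ k)
    (hgk : g ≠ k) : False := by
  have h1 : ({e, f, g, k} : Finset β) ⊆ E.filter (x ∈ F ·) := by grind
  have h2 := Finset.card_le_card h1
  rw [Finset.card_eq_four.mpr ⟨e, f, g, k, hef, heg, hek, hfg, hfk, hgk, rfl⟩] at h2
  have := h.degree x hx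
  omega

theorem not_two_two (h : Tight F X E) {x : α} (hx : x ∈ X) {e f g : β} (he : e ∈ E)
    (hf : f ∈ E) (hg : g ∈ E) (hxe : x ∈ F e) (hxf : x ∈ F f) (hxg : x ∈ F g)
    (hef : e ≠ f) (heg : e ≠ g) (hfg : f ≠ g) (he2 : (F e ∩ X).card = 2)
    (hf2 : (F f ∩ X).card = 2) : False := by
  have := (h.slack.pick_three hx he hf hg hef heg hfg hxe hxf hxg).nonneg (h.sized.pick x)
  rw [edgeWeight_of_two he2, edgeWeight_of_two hf2] at this
  have := edgeWeight_nonneg (F := F) (X := X) g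
  omega

theorem pick_two (h : Tight F X E) {x : α} (hx : x ∈ X) {e f : β} (he : e ∈ E)
    (hf : f ∈ E) (hxe : x ∈ F e) (hxf : x ∈ F f) (hef : e ≠ f) (he2 : (F e ∩ X).card = 2)
    (hf2 : (F f ∩ X).card = 2) : Tight F (X.erase x) (E.filter (x ∉ F ·)) :=
  ⟨h.sized.pick x, h.degree_mono (Finset.erase_subset _ _) (Finset.filter_subset _ _),
    (h.slack.pick_two hx he hf hef hxe hxf).mono
      (by rw [edgeWeight_of_two he2, edgeWeight_of_two hf2]; norm_num)⟩

theorem pick_three (h : Tight F X E) {x : α} (hx : x ∈ X) {e f g : β} (he : e ∈ E)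
    (hf : f ∈ E) (hg : g ∈ E) (hxe : x ∈ F e) (hxf : x ∈ F f) (hxg : x ∈ F g)
    (hef : e ≠ f) (heg : e ≠ g) (hfg : f ≠ g) (he2 : (F e ∩ X).card = 2) :
    Tight F (X.erase x) (E.filter (x ∉ F ·)) :=
  ⟨h.sized.pick x, h.degree_mono (Finset.erase_subset _ _) (Finset.filter_subset _ _),
    (h.slack.pick_three hx he hf hg hef heg hfg hxe hxf hxg).mono (by
      have := edgeWeight_nonneg (F := F) (X := X) f
      have := edgeWeight_nonneg (F := F) (X := X) g
      rw [edgeWeight_of_two he2]; omega)⟩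

theorem exists_edge (h : Tight F X E) {x : α} (hx : x ∈ X) : ∃ e ∈ E, x ∈ F e := by
  by_contra! hno
  have := (h.slack.drop hx hno).nonneg (h.sized.drop hno)
  omega

theorem not_subset (h : Tight F X E) {e f : β} (he : e ∈ E) (hf : f ∈ E) (hef : e ≠ f)
    (hsub : ∀ x ∈ X, x ∈ F e → x ∈ F f) : False := by
  have := (h.slack.erase_edge he hf hef hsub).nonneg (h.sized.subset (Finset.erase_subset _ _))
  have := edgeWeight_nonneg (F := F) (X := X) f
  omega

theorem card_eq_two_of_unique (h : Tight F X E) {z : α} (hz : z ∈ X) {e : β} (he : e ∈ E)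
    (hze : z ∈ F e) (h1 : ∀ f ∈ E, z ∈ F f → f = e) : (F e ∩ X).card = 2 := by
  refine (h.sized e he).resolve_right fun h3 => ?_
  have := (h.slack.drop_one hz he hze h1 h3).nonneg (h.sized.drop_one hz h1 h3)
  omega

theorem unique_of_unique (h : Tight F X E) {z : α} (hz : z ∈ X) {e : β} (he : e ∈ E)
    (hze : z ∈ F e) (h1 : ∀ f ∈ E, z ∈ F f → f = e) {y : α} (hy : y ∈ X) (hye : y ∈ F e)
    {f : β} (hf : f ∈ E) (hyf : y ∈ F f) : f = e := by
  by_contra hfe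
  have hzy : z ≠ y := by grind
  have h2 := h.card_eq_two_of_unique hz he hze h1
  have hyu : ∀ g ∈ E.filter (y ∉ F ·), z ∉ F g := by grind
  have := ((h.slack.pick_two hy he hf (Ne.symm hfe) hye hyf).drop (z := z) (by simp [hz, hzy])
    hyu).nonneg ((h.sized.pick y).drop hyu)
  rw [edgeWeight_of_two h2] at this
  have := edgeWeight_nonneg (F := F) (X := X) f
  omega

theorem exists_ne_edge (h : Tight F X E) {z : α} (hz : z ∈ X) {e : β} (he : e ∈ E)
    (hze : z ∈ F e) (h3 : (F e ∩ X).card = 3) : ∃ f ∈ E, f ≠ e ∧ z ∈ F f := by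
  by_contra! hno
  have := h.card_eq_two_of_unique hz he hze (by grind)
  omega

set_option maxHeartbeats 1000000 in
/-- A vertex in exactly one 2-edge and one 3-edge can be reduced together with its neighbour in
the 2-edge. -/
theorem reduce (h : Tight F X E) {z y : α} (hz : z ∈ X) (hy : y ∈ X) {d e : β} (hd : d ∈ E)
    (he : e ∈ E) (hzd : z ∈ F d) (hze : z ∈ F e) (hyd : y ∈ F d) (hyz : y ≠ z)
    (hd2 : (F d ∩ X).card = 2) (he3 : (F e ∩ X).card = 3)
    (huniq : ∀ f ∈ E, z ∈ F f → f = d ∨ f = e) :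
    ∃ e' ∈ E, (F e' ∩ X).card = 3 ∧ y ∈ F e' ∧ z ∉ F e' ∧ y ∉ F e ∧
      (∀ f ∈ E, y ∈ F f → f = d ∨ f = e') ∧
      Tight F ((X.erase z).erase y) (E.filter (z ∉ F ·)) := by
  have hde : d ≠ e := by rintro rfl; omega
  have hp := h.slack.pick_two hz hd he hde hzd hze
  rw [edgeWeight_of_two hd2, edgeWeight_of_three he3] at hp
  have hy' : y ∈ X.erase z := by simp [hy, hyz]
  obtain ⟨e', he', hze', hye'⟩ : ∃ e' ∈ E, z ∉ F e' ∧ y ∈ F e' := by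
    by_contra! hno
    have hyu : ∀ f ∈ E.filter (z ∉ F ·), y ∉ F f := by grind
    have := (hp.drop hy' hyu).nonneg ((h.sized.pick z).drop hyu)
    omega
  have hsep : ∀ f ∈ E, y ∈ F f → f = d ∨ f = e' := by
    by_contra! hno
    obtain ⟨f, hf, hyf, hfd, hfe'⟩ := hno
    have hT := h.pick_three hy hd he' hf hyd hye' hyf (by grind) (by grind) (by grind) hd2
    have hz' : z ∈ X.erase y := by grind
    by_cases hye : y ∈ F e
    · obtain ⟨g, hg, hzg⟩ := hT.exists_edge hz'
      grind
    · obtain ⟨g, hg, hge, hzg⟩ := hT.exists_ne_edge hz' (e := e) (by grind) hze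
        (by rwa [inter_erase_eq hye])
      grind
  have he3' : (F e' ∩ X).card = 3 := by
    refine (h.sized e' he').resolve_left fun h2 => ?_
    have hT := h.pick_two hy hd he' hyd hye' (by grind) hd2 h2
    have hz' : z ∈ X.erase y := by grind
    obtain ⟨g, hg, hge, hzg⟩ := hT.exists_ne_edge hz' (e := e) (by grind) hze
        (by rwa [inter_erase_eq (by grind)])
    grind
  have hu : ∀ f ∈ E.filter (z ∉ F ·), y ∈ F f → f = e' := by grind
  have he3'' : (F e' ∩ X.erase z).card = 3 := by rwa [inter_erase_eq hze']
  refine ⟨e', he', he3', hye', hze', by grind, hsep, ?_⟩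
  exact ⟨(h.sized.pick z).drop_one hy' hu he3'',
    h.degree_mono ((Finset.erase_subset _ _).trans (Finset.erase_subset _ _))
      (Finset.filter_subset _ _),
    (hp.drop_one hy' (by grind) hye' hu he3'').mono (by norm_num)⟩

set_option maxHeartbeats 1000000 in
/-- The two neighbours of a vertex in two 2-edges. -/
theorem two_two (h : Tight F X E) {x p q : α} (hx : x ∈ X) (hp : p ∈ X) (hq : q ∈ X) {e f : β}
    (he : e ∈ E) (hf : f ∈ E) (hxe : x ∈ F e) (hxf : x ∈ F f) (hpe : p ∈ F e) (hqf : q ∈ F f)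
    (hef : e ≠ f) (hpx : p ≠ x) (hqx : q ≠ x) (he2 : (F e ∩ X).card = 2)
    (hf2 : (F f ∩ X).card = 2) :
    p ≠ q ∧
    ((∃ g ∈ E, (F g ∩ X).card = 2 ∧ p ∈ F g ∧ q ∈ F g ∧ g ≠ e ∧ g ≠ f ∧
        (∀ k ∈ E, p ∈ F k → k = e ∨ k = g) ∧ ∀ k ∈ E, q ∈ F k → k = f ∨ k = g) ∨
      ∃ u ∈ E, ∃ w ∈ E, u ≠ w ∧ (F u ∩ X).card = 3 ∧ (F w ∩ X).card = 3 ∧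
        p ∈ F u ∧ p ∈ F w ∧ q ∈ F u ∧ q ∈ F w ∧
        (∀ k ∈ E, p ∈ F k → k = e ∨ k = u ∨ k = w) ∧
        ∀ k ∈ E, q ∈ F k → k = f ∨ k = u ∨ k = w) := by
  have hpair : ∀ w ∈ X, w ∈ F e → w = x ∨ w = p := by
    obtain ⟨y, h⟩ := Sized.exists_other he2 hx hxe
    grind
  have hpair' : ∀ w ∈ X, w ∈ F f → w = x ∨ w = q := by
    obtain ⟨y, h⟩ := Sized.exists_other hf2 hx hxf
    grind
  have hpq : p ≠ q := by
    rintro rfl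
    exact h.not_subset he hf hef (by grind)
  refine ⟨hpq, ?_⟩
  have hxu : ∀ g ∈ E, x ∈ F g → g = e ∨ g = f := by
    intro g hg hxg
    by_contra! hno
    exact h.not_two_two hx he hf hg hxe hxf hxg hef hno.1.symm hno.2.symm he2 hf2
  have hT := h.pick_two hx he hf hxe hxf hef he2 hf2
  obtain ⟨g, hg, hge, hpg⟩ : ∃ g ∈ E, g ≠ e ∧ p ∈ F g := by
    by_contra! hno
    exact hef (h.unique_of_unique hp he hpe (by grind) hx hxe hf hxf).symm
  have hxg : x ∉ F g := by grind
  have hp' : p ∈ X.erase x := by grind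
  rcases h.sized g hg with hg2 | hg3
  · left
    have hpu : ∀ k ∈ E, p ∈ F k → k = e ∨ k = g := by
      intro k hk hpk
      by_contra! hno
      exact h.not_two_two hp he hg hk hpe hpg hpk hge.symm hno.1.symm hno.2.symm he2 hg2
    obtain ⟨r, hr, hrg, hpr, hrall⟩ := Sized.exists_other hg2 hp hpg
    have hr1 : ∀ k ∈ E, x ∉ F k → r ∈ F k → k = g := fun k hk hxk hrk =>
      hT.unique_of_unique hp' (e := g) (by grind) hpg (by grind) (y := r) (by grind) hrg
        (by grind) hrk
    have hrf : r ∈ F f := by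
      by_contra hrf
      exact hge (h.unique_of_unique hr hg hrg (by grind) hp hpg he hpe).symm
    have : r = q := by grind
    subst this
    exact ⟨g, hg, hg2, hpg, hrg, hge, by grind, hpu, by grind⟩
  · right
    obtain ⟨k, hk, hkg, hpk⟩ := hT.exists_ne_edge hp' (e := g) (by grind) hpg
      (by rwa [inter_erase_eq hxg])
    simp only [Finset.mem_filter] at hk
    have hke : k ≠ e := by grind
    have hk3 : (F k ∩ X).card = 3 := by
      refine (h.sized k hk.1).resolve_left fun hk2 => ?_
      exact h.not_two_two hp he hk.1 hg hpe hpk hpg hke.symm hge.symm hkg he2 hk2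
    have hpu : ∀ l ∈ E, p ∈ F l → l = e ∨ l = g ∨ l = k := by
      intro l hl hpl
      by_contra! hno
      exact h.not_four hp he hg hk.1 hl hpe hpg hpk hpl hge.symm hke.symm hno.1.symm hkg.symm
        hno.2.1.symm hno.2.2.symm
    have hT' := h.pick_three hp he hg hk.1 hpe hpg hpk hge.symm hke.symm hkg.symm he2
    have hq1 : ∀ l ∈ E, p ∉ F l → q ∈ F l → l = f := fun l hl hpl hql =>
      hT'.unique_of_unique (z := x) (e := f) (y := q) (by grind) (by grind) hxf (by grind)
        (by grind) hqf (by grind) hql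
    -- both 3-edges at `p` contain `q`
    have hq' : q ∈ X.erase x := by grind
    obtain ⟨g', hg', hg_f, hqg'⟩ : ∃ g' ∈ E, g' ≠ f ∧ q ∈ F g' := by
      by_contra! hno
      exact hef (h.unique_of_unique hq hf hqf (by grind) hx hxf he hxe)
    have hg_3 : (F g' ∩ X).card = 3 := by
      have : g' = g ∨ g' = k := by grind
      rcases this with rfl | rfl <;> assumption
    obtain ⟨k', hk', hk_g, hqk'⟩ := hT.exists_ne_edge hq' (e := g') (by grind) hqg'
      (by rwa [inter_erase_eq (by grind)])
    simp only [Finset.mem_filter] at hk'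
    clear hT hT'
    have hk_f : k' ≠ f := fun h => hk'.2 (h ▸ hxf)
    refine ⟨g, hg, k, hk.1, hkg.symm, hg3, hk3, hpg, hpk, ?_, ?_, hpu, ?_⟩ <;> grind

end Tight

end Hypergraph

section Hypergraph

variable {α β : Type*} [DecidableEq α] [DecidableEq β] {F : β → Finset α}
  {X : Finset α} {E : Finset β} {s : ℤ}

/-- A 2-edge `d = {x, y}` both of whose vertices have degree at least three. -/
structure Nontail (F : β → Finset α) (X : Finset α) (E : Finset β) (d : β) (x y : α)
    (u w u' w' : β) : Prop where
  hx : x ∈ X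
  hy : y ∈ X
  hd : d ∈ E
  hu : u ∈ E
  hw : w ∈ E
  hu' : u' ∈ E
  hw' : w' ∈ E
  xd : x ∈ F d
  yd : y ∈ F d
  xu : x ∈ F u
  xw : x ∈ F w
  yu' : y ∈ F u'
  yw' : y ∈ F w'
  ne : x ≠ y
  ud : u ≠ d
  wd : w ≠ d
  uw : u ≠ w
  ud' : u' ≠ d
  wd' : w' ≠ d
  uw' : u' ≠ w'
  two : (F d ∩ X).card = 2

namespace Nontail

variable {d u w u' w' : β} {x y : α}

theorem symm (h : Nontail F X E d x y u w u' w') : Nontail F X E d y x u' w' u w :=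
  ⟨h.hy, h.hx, h.hd, h.hu', h.hw', h.hu, h.hw, h.yd, h.xd, h.yu', h.yw', h.xu, h.xw, h.ne.symm,
    h.ud', h.wd', h.uw', h.ud, h.wd, h.uw, h.two⟩

theorem swap (h : Nontail F X E d x y u w u' w') : Nontail F X E d x y w u u' w' :=
  ⟨h.hx, h.hy, h.hd, h.hw, h.hu, h.hu', h.hw', h.xd, h.yd, h.xw, h.xu, h.yu', h.yw', h.ne,
    h.wd, h.ud, h.uw.symm, h.ud', h.wd', h.uw', h.two⟩

theorem mono (h : Nontail F X E d x y u w u' w') {X' : Finset α} {E' : Finset β} (hx : x ∈ X')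
    (hy : y ∈ X') (hd : d ∈ E') (hu : u ∈ E') (hw : w ∈ E') (hu' : u' ∈ E') (hw' : w' ∈ E')
    (two : (F d ∩ X').card = 2) : Nontail F X' E' d x y u w u' w' :=
  ⟨hx, hy, hd, hu, hw, hu', hw', h.xd, h.yd, h.xu, h.xw, h.yu', h.yw', h.ne,
    h.ud, h.wd, h.uw, h.ud', h.wd', h.uw', two⟩

theorem edge_eq (h : Nontail F X E d x y u w u' w') (hT : Tight F X E) {k : β} (hk : k ∈ E)
    (hxk : x ∈ F k) : k = d ∨ k = u ∨ k = w := by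
  by_contra! hno
  exact hT.not_four h.hx h.hd h.hu h.hw hk h.xd h.xu h.xw hxk h.ud.symm h.wd.symm hno.1.symm h.uw
    hno.2.1.symm hno.2.2.symm

theorem card_eq (h : Nontail F X E d x y u w u' w') (hT : Tight F X E) : (F u ∩ X).card = 3 :=
  (hT.sized u h.hu).resolve_left fun h2 => hT.not_two_two h.hx h.hd h.hu h.hw h.xd h.xu h.xw
    h.ud.symm h.wd.symm h.uw h.two h2

theorem eq_or (h : Nontail F X E d x y u w u' w') {v : α} (hv : v ∈ X) (hvd : v ∈ F d) :
    v = x ∨ v = y := by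
  obtain ⟨z, hz⟩ := Sized.exists_other h.two h.hx h.xd
  have := h.hy
  have := h.yd
  have := h.ne
  grind

theorem pick (h : Nontail F X E d x y u w u' w') (hT : Tight F X E) :
    Tight F (X.erase x) (E.filter (x ∉ F ·)) :=
  hT.pick_three h.hx h.hd h.hu h.hw h.xd h.xu h.xw h.ud.symm h.wd.symm h.uw h.two

theorem notMem (h : Nontail F X E d x y u w u' w') (hT : Tight F X E) : x ∉ F u' := by
  intro hxu'
  have hP := h.pick hT
  have hy' : y ∈ X.erase x := by simp [h.hy, h.ne.symm]
  have hyE := fun k hk hyk => h.symm.edge_eq hT (k := k) hk hyk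
  have := h.ud'
  have := h.xd
  obtain ⟨g, hg, hyg⟩ := hP.exists_edge hy'
  simp only [Finset.mem_filter] at hg
  have hgw : g = w' := by grind
  have hw_3 := h.symm.swap.card_eq hT
  obtain ⟨k, hk, hkg, hyk⟩ := hP.exists_ne_edge hy' (e := g) (by simp [hg]) hyg
    (by rw [inter_erase_eq hg.2, hgw, hw_3])
  simp only [Finset.mem_filter] at hk
  grind

end Nontail

/-- No tight state of size less than `n` has a nontail 2-edge. -/
def NoNontailBelow (F : β → Finset α) (n : ℕ) : Prop :=
  ∀ (X : Finset α) (E : Finset β), X.card + E.card < n → Tight F X E →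
    ∀ d x y u w u' w', ¬ Nontail F X E d x y u w u' w'

namespace NoNontailBelow

variable {d u w u' w' : β} {x y : α}

theorem unique_false (ih : NoNontailBelow F (X.card + E.card)) (hT : Tight F X E)
    (h : Nontail F X E d x y u w u' w') {z : α} (hz : z ∈ X) {e : β} (he : e ∈ E)
    (hze : z ∈ F e) (h1 : ∀ f ∈ E, z ∈ F f → f = e) : False := by
  have he2 := hT.card_eq_two_of_unique hz he hze h1
  obtain ⟨z', hz', hze', hzz', hall⟩ := Sized.exists_other he2 hz hze
  have h1' := fun f hf hzf => hT.unique_of_unique hz he hze h1 hz' hze' (f := f) hf hzf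
  have hp := hT.slack.pick_one hz he hze
  rw [edgeWeight_of_two he2] at hp
  have hz'' : z' ∈ X.erase z := by grind
  have hu : ∀ f ∈ E.filter (z ∉ F ·), z' ∉ F f := by grind
  have hT' : Tight F ((X.erase z).erase z') (E.filter (z ∉ F ·)) :=
    ⟨(hT.sized.pick z).drop hu,
      hT.degree_mono ((Finset.erase_subset _ _).trans (Finset.erase_subset _ _))
        (Finset.filter_subset _ _), (hp.drop hz'' hu).mono (by norm_num)⟩
  refine ih _ _ ((size_drop_lt hz'').trans (size_pick_lt hz)) hT' d x y u w u' w' ?_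
  have hxz : x ≠ z ∧ x ≠ z' := ⟨fun h' => h.ud ((h1 u h.hu (h' ▸ h.xu)).trans
    (h1 d h.hd (h' ▸ h.xd)).symm), fun h' => h.ud ((h1' u h.hu (h' ▸ h.xu)).trans
    (h1' d h.hd (h' ▸ h.xd)).symm)⟩
  have hyz : y ≠ z ∧ y ≠ z' := ⟨fun h' => h.ud' ((h1 u' h.hu' (h' ▸ h.yu')).trans
    (h1 d h.hd (h' ▸ h.yd)).symm), fun h' => h.ud' ((h1' u' h.hu' (h' ▸ h.yu')).trans
    (h1' d h.hd (h' ▸ h.yd)).symm)⟩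
  have hE : ∀ k ∈ E, (x ∈ F k ∨ y ∈ F k) → k ∈ E.filter (z ∉ F ·) := by
    intro k hk hxy
    simp only [Finset.mem_filter]
    refine ⟨hk, fun hzk => ?_⟩
    obtain rfl := h1 k hk hzk
    rcases hxy with hxk | hyk
    · have := hall x h.hx hxk; tauto
    · have := hall y h.hy hyk; tauto
  have hd' := hE d h.hd (.inl h.xd)
  refine h.mono (by simp [hxz, h.hx]) (by simp [hyz, h.hy]) hd' (hE u h.hu (.inl h.xu))
    (hE w h.hw (.inl h.xw)) (hE u' h.hu' (.inr h.yu')) (hE w' h.hw' (.inr h.yw')) ?_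
  rw [inter_erase_eq (hu d hd'), inter_erase_eq (Finset.mem_filter.1 hd').2]
  exact h.two

theorem two_two_false (ih : NoNontailBelow F (X.card + E.card)) (hT : Tight F X E)
    (h : Nontail F X E d x y u w u' w') {z : α} (hz : z ∈ X) {e f : β} (he : e ∈ E) (hf : f ∈ E)
    (hze : z ∈ F e) (hzf : z ∈ F f) (hef : e ≠ f) (he2 : (F e ∩ X).card = 2)
    (hf2 : (F f ∩ X).card = 2) : False := by
  refine ih _ _ (size_pick_lt hz) (hT.pick_two hz he hf hze hzf hef he2 hf2) d x y u w u' w' ?_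
  have hz2 : ∀ k ∈ E, z ∈ F k → k = e ∨ k = f := by
    intro k hk hzk
    by_contra! hno
    exact hT.not_two_two hz he hf hk hze hzf hzk hef hno.1.symm hno.2.symm he2 hf2
  have h3 : ∀ k ∈ E, (F k ∩ X).card = 3 → z ∉ F k := by
    intro k hk hk3 hzk
    rcases hz2 k hk hzk with rfl | rfl <;> omega
  have hu := h3 u h.hu (h.card_eq hT)
  have hw := h3 w h.hw (h.swap.card_eq hT)
  have hu' := h3 u' h.hu' (h.symm.card_eq hT)
  have hw' := h3 w' h.hw' (h.symm.swap.card_eq hT)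
  have hxz : x ≠ z := fun h' => hu (h' ▸ h.xu)
  have hyz : y ≠ z := fun h' => hu' (h' ▸ h.yu')
  have hzd : z ∉ F d := fun hzd => by
    have := h.eq_or hz hzd
    tauto
  refine h.mono (by simp [hxz, h.hx]) (by simp [hyz, h.hy]) (by simp [hzd, h.hd])
    (by simp [hu, h.hu]) (by simp [hw, h.hw]) (by simp [hu', h.hu']) (by simp [hw', h.hw']) ?_
  rw [inter_erase_eq hzd]
  exact h.two

/-- The edge `e` of a reducible vertex `z` is one of the edges of a nontail. -/
theorem mem_of_two_three (ih : NoNontailBelow F (X.card + E.card)) (hT : Tight F X E)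
    (h : Nontail F X E d x y u w u' w') {z z' : α} (hz : z ∈ X) (hz' : z' ∈ X) {c e : β}
    (hc : c ∈ E) (he : e ∈ E) (hzc : z ∈ F c) (hze : z ∈ F e) (hzc' : z' ∈ F c) (hzz : z' ≠ z)
    (hc2 : (F c ∩ X).card = 2) (he3 : (F e ∩ X).card = 3)
    (huniq : ∀ f ∈ E, z ∈ F f → f = c ∨ f = e) : e = u ∨ e = w ∨ e = u' ∨ e = w' := by
  obtain ⟨e', he', he3', hze', hze'', -, huniq', hR⟩ :=
    hT.reduce hz hz' hc he hzc hze hzc' hzz hc2 he3 huniq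
  by_contra! hno
  have hz'' : z' ∈ X.erase z := by grind
  refine ih _ _ ((size_drop_lt hz'').trans (size_pick_lt hz)) hR d x y u w u' w' ?_
  have hxy : x ≠ z ∧ x ≠ z' ∧ y ≠ z ∧ y ≠ z' := by
    have := h.xd; have := h.xu; have := h.xw; have := h.yd; have := h.yu'; have := h.yw'
    have := h.hd; have := h.hu; have := h.hw; have := h.hu'; have := h.hw'
    have := h.ud; have := h.wd; have := h.uw; have := h.ud'; have := h.wd'; have := h.uw'
    grind
  have hzd : z ∉ F d := fun hzd => by
    have := h.eq_or hz hzd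
    tauto
  have hzd' : z' ∉ F d := fun hzd => by
    have := h.eq_or hz' hzd
    tauto
  have h3 : ∀ k ∈ E, (F k ∩ X).card = 3 → k ≠ e → z ∉ F k := by
    intro k hk hk3 hke hzk
    rcases huniq k hk hzk with rfl | rfl
    · omega
    · exact hke rfl
  have hu := h3 u h.hu (h.card_eq hT) hno.1.symm
  have hw := h3 w h.hw (h.swap.card_eq hT) hno.2.1.symm
  have hu' := h3 u' h.hu' (h.symm.card_eq hT) hno.2.2.1.symm
  have hw' := h3 w' h.hw' (h.symm.swap.card_eq hT) hno.2.2.2.symm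
  refine h.mono (by simp [hxy, h.hx]) (by simp [hxy, h.hy]) (by simp [hzd, h.hd])
    (by simp [hu, h.hu]) (by simp [hw, h.hw]) (by simp [hu', h.hu']) (by simp [hw', h.hw']) ?_
  rw [inter_erase_eq hzd', inter_erase_eq hzd]
  exact h.two

set_option maxHeartbeats 1000000 in
theorem false_of_two_three_orbit (hT : Tight F X E)
    (h : Nontail F X E d x y u w u' w') {z z' : α} (hz : z ∈ X) (hz' : z' ∈ X) {c e' : β}
    (hc : c ∈ E) (he' : e' ∈ E) (hzc : z ∈ F c) (hze : z ∈ F u) (hzc' : z' ∈ F c)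
    (hze' : z' ∈ F e') (hzz : z' ≠ z) (hzu : z' ∉ F u) (hzue : z ∉ F e')
    (hc2 : (F c ∩ X).card = 2) (he3' : (F e' ∩ X).card = 3)
    (huniq : ∀ f ∈ E, z ∈ F f → f = c ∨ f = u)
    (huniq' : ∀ f ∈ E, z' ∈ F f → f = c ∨ f = e')
    (hR : Tight F ((X.erase z).erase z') (E.filter (z ∉ F ·)))
    (hmem : e' = w ∨ e' = u') : False := by
  have hxu' := h.notMem hT
  have hxw' := h.symm.swap.symm.notMem hT
  have hyu := h.symm.notMem hT
  have hyw := h.swap.symm.notMem hT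
  have hu3 := h.card_eq hT
  have hw3 := h.swap.card_eq hT
  have hu_3 := h.symm.card_eq hT
  have hw_3 := h.symm.swap.card_eq hT
  have hxy : x ≠ z ∧ x ≠ z' ∧ y ≠ z ∧ y ≠ z' := by
    have := h.xd; have := h.xu; have := h.xw; have := h.yd; have := h.yu'; have := h.yw'
    have := h.hd; have := h.hu; have := h.hw; have := h.hu'; have := h.hw'
    have := h.ud; have := h.wd; have := h.uw; have := h.ud'; have := h.wd'; have := h.uw'
    clear hR
    grind
  have hzd : z ∉ F d := fun hzd => by
    have := h.eq_or hz hzd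
    tauto
  have hzd' : z' ∉ F d := fun hzd => by
    have := h.eq_or hz' hzd
    tauto
  have h3 : ∀ k ∈ E, (F k ∩ X).card = 3 → k ≠ u → z ∉ F k := by
    intro k hk hk3 hke hzk
    rcases huniq k hk hzk with rfl | rfl
    · omega
    · exact hke rfl
  have hzw := h3 w h.hw hw3 h.uw.symm
  have hzu' := h3 u' h.hu' hu_3 fun h' => hyu (h' ▸ h.yu')
  have hzw' := h3 w' h.hw' hw_3 fun h' => hyu (h' ▸ h.yw')
  have hz'' : z' ∈ X.erase z := by simp [hz', hzz]
  have he2' : (F e' ∩ (X.erase z).erase z').card = 2 := by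
    have := card_inter_erase hz'' hze'
    rw [inter_erase_eq hzue] at this
    omega
  have hd2 : (F d ∩ (X.erase z).erase z').card = 2 := by
    rw [inter_erase_eq hzd', inter_erase_eq hzd]
    exact h.two
  have hxR : x ∈ (X.erase z).erase z' := by simp [hxy, h.hx]
  have hyR : y ∈ (X.erase z).erase z' := by simp [hxy, h.hy]
  have hdR : d ∈ E.filter (z ∉ F ·) := by simp [h.hd, hzd]
  have hu_R : u' ∈ E.filter (z ∉ F ·) := by simp [h.hu', hzu']
  have hw_R : w' ∈ E.filter (z ∉ F ·) := by simp [h.hw', hzw']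
  rcases hmem with rfl | rfl
  · obtain ⟨q, hq, hqe, hxq, hall⟩ := Sized.exists_other he2' hxR h.xw
    obtain ⟨-, ⟨g, hg, -, -, -, -, -, hpu, -⟩ | ⟨a, ha, b, hb, hab, -, -, -, -, hqa, hqb, hya, hqE⟩⟩ :=
      hR.two_two hxR hyR hq hdR (f := e') (by simp [he', hzue]) h.xd h.xw h.yd hqe h.wd.symm
        h.ne.symm hxq.symm hd2 he2'
    · have h1 := hpu u' hu_R h.yu'
      have h2 := hpu w' hw_R h.yw'
      have := h.ud'; have := h.wd'; have := h.uw'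
      grind
    · have hqu' : q ∈ F u' := by
        have := hya u' hu_R h.yu'
        have := h.ud'
        grind
      have hqw' : q ∈ F w' := by
        have := hya w' hw_R h.yw'
        have := h.wd'
        grind
      have hue : u' ≠ e' := fun h' => hyw (h' ▸ h.yu')
      have hwe : w' ≠ e' := fun h' => hyw (h' ▸ h.yw')
      simp only [Finset.mem_erase] at hq
      have hP := h.symm.pick hT
      have hqy : q ≠ y := fun h' => hyw (h' ▸ hqe)
      have := hP.card_eq_two_of_unique (z := q) (e := e') (by simp [hq, hqy])
        (by simp [he', hyw]) hqe (by
          intro f hf hqf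
          simp only [Finset.mem_filter] at hf
          by_contra hfe
          exact hT.not_four hq.2.2 h.hu' h.hw' he' hf.1 hqu' hqw' hqe hqf h.uw' hue
            (fun h' => hf.2 (h' ▸ h.yu')) hwe (fun h' => hf.2 (h' ▸ h.yw')) (Ne.symm hfe))
      rw [inter_erase_eq hyw] at this
      omega
  · exact hR.not_two_two hyR hdR hu_R hw_R h.yd h.yu' h.yw' h.ud'.symm h.wd'.symm h.uw' hd2 he2'

theorem two_three_false (ih : NoNontailBelow F (X.card + E.card)) (hT : Tight F X E)
    (h : Nontail F X E d x y u w u' w') {z : α} (hz : z ∈ X) {c e : β}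
    (hc : c ∈ E) (he : e ∈ E) (hzc : z ∈ F c) (hze : z ∈ F e)
    (hc2 : (F c ∩ X).card = 2) (he3 : (F e ∩ X).card = 3)
    (huniq : ∀ f ∈ E, z ∈ F f → f = c ∨ f = e) : False := by
  obtain ⟨z', hz', hzc', hzz, -⟩ := Sized.exists_other hc2 hz hzc
  obtain ⟨e', he', he3', hze', hze'', hze3, huniq', hR⟩ :=
    hT.reduce hz hz' hc he hzc hze hzc' hzz.symm hc2 he3 huniq
  have hm := ih.mem_of_two_three hT h hz hz' hc he hzc hze hzc' hzz.symm hc2 he3 huniq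
  have hm' := ih.mem_of_two_three hT h hz' hz hc he' hzc' hze' hzc hzz hc2 he3' huniq'
  have hee : e' ≠ e := fun h' => hze'' (h' ▸ hze)
  rcases hm with rfl | rfl | rfl | rfl
  · rcases hm' with hm' | hm' | hm' | hm'
    · exact hee hm'
    · exact false_of_two_three_orbit hT h hz hz' hc he' hzc hze hzc' hze' hzz.symm hze3 hze'' hc2 he3'
        huniq huniq' hR (.inl hm')
    · exact false_of_two_three_orbit hT h hz hz' hc he' hzc hze hzc' hze' hzz.symm hze3 hze'' hc2 he3'
        huniq huniq' hR (.inr hm')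
    · exact false_of_two_three_orbit hT h.symm.swap.symm hz hz' hc he' hzc hze hzc' hze' hzz.symm hze3
        hze'' hc2 he3' huniq huniq' hR (.inr hm')
  · rcases hm' with hm' | hm' | hm' | hm'
    · exact false_of_two_three_orbit hT h.swap hz hz' hc he' hzc hze hzc' hze' hzz.symm hze3 hze'' hc2
        he3' huniq huniq' hR (.inl hm')
    · exact hee hm'
    · exact false_of_two_three_orbit hT h.swap hz hz' hc he' hzc hze hzc' hze' hzz.symm hze3 hze'' hc2
        he3' huniq huniq' hR (.inr hm')
    · exact false_of_two_three_orbit hT h.swap.symm.swap.symm hz hz' hc he' hzc hze hzc' hze' hzz.symm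
        hze3 hze'' hc2 he3' huniq huniq' hR (.inr hm')
  · rcases hm' with hm' | hm' | hm' | hm'
    · exact false_of_two_three_orbit hT h.symm hz hz' hc he' hzc hze hzc' hze' hzz.symm hze3 hze'' hc2
        he3' huniq huniq' hR (.inr hm')
    · exact false_of_two_three_orbit hT h.swap.symm hz hz' hc he' hzc hze hzc' hze' hzz.symm hze3 hze''
        hc2 he3' huniq huniq' hR (.inr hm')
    · exact hee hm'
    · exact false_of_two_three_orbit hT h.symm hz hz' hc he' hzc hze hzc' hze' hzz.symm hze3 hze'' hc2
        he3' huniq huniq' hR (.inl hm')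
  · rcases hm' with hm' | hm' | hm' | hm'
    · exact false_of_two_three_orbit hT h.symm.swap hz hz' hc he' hzc hze hzc' hze' hzz.symm hze3 hze''
        hc2 he3' huniq huniq' hR (.inr hm')
    · exact false_of_two_three_orbit hT h.swap.symm.swap hz hz' hc he' hzc hze hzc' hze' hzz.symm hze3
        hze'' hc2 he3' huniq huniq' hR (.inr hm')
    · exact false_of_two_three_orbit hT h.symm.swap hz hz' hc he' hzc hze hzc' hze' hzz.symm hze3 hze''
        hc2 he3' huniq huniq' hR (.inl hm')
    · exact (hee hm')

/-- In a minimal tight state with a nontail, every vertex of a 2-edge has degree three. -/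
theorem exists_edges (ih : NoNontailBelow F (X.card + E.card)) (hT : Tight F X E)
    (h : Nontail F X E d x y u w u' w') {z : α} (hz : z ∈ X) {c : β} (hc : c ∈ E) (hzc : z ∈ F c)
    (hc2 : (F c ∩ X).card = 2) : ∃ a ∈ E, ∃ b ∈ E, a ≠ c ∧ b ≠ c ∧ a ≠ b ∧ z ∈ F a ∧ z ∈ F b := by
  obtain ⟨a, ha, hac, hza⟩ : ∃ a ∈ E, a ≠ c ∧ z ∈ F a := by
    by_contra! hno
    exact ih.unique_false hT h hz hc hzc fun f hf hzf => by_contra fun hfc => hno f hf hfc hzf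
  by_contra! hno
  have huniq : ∀ f ∈ E, z ∈ F f → f = c ∨ f = a := by
    intro f hf hzf
    by_contra! hf'
    exact hno a ha f hf hac hf'.1 hf'.2.symm hza hzf
  rcases hT.sized a ha with ha2 | ha3
  · exact ih.two_two_false hT h hz hc ha hzc hza hac.symm hc2 ha2
  · exact ih.two_three_false hT h hz hc ha hzc hza hc2 ha3 huniq

end NoNontailBelow

end Hypergraph

section Hypergraph

variable {α β : Type*} [DecidableEq α] [DecidableEq β] {F : β → Finset α}
  {X : Finset α} {E : Finset β} {s : ℤ}

namespace NoNontailBelow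

variable {d u w u' w' : β} {x y : α}

theorem pair_notMem (hT : Tight F X E) (h : Nontail F X E d x y u w u' w') {δ a b a' b' : β}
    {p q : α} (hδ : Nontail F X E δ p q a b a' b') (hne : δ ≠ d) : x ∉ F δ ∧ p ∉ F d ∧ q ∉ F d := by
  have hx : x ∉ F δ := fun hxδ => hT.not_two_two h.hx h.hd hδ.hd h.hu h.xd hxδ h.xu hne.symm
    h.ud.symm (by rintro rfl; have := h.card_eq hT; have := hδ.two; omega) h.two hδ.two
  have hy : y ∉ F δ := fun hxδ => hT.not_two_two h.hy h.hd hδ.hd h.hu' h.yd hxδ h.yu' hne.symm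
    h.ud'.symm (by rintro rfl; have := h.symm.card_eq hT; have := hδ.two; omega) h.two hδ.two
  refine ⟨hx, fun hp => ?_, fun hp => ?_⟩
  · rcases h.eq_or hδ.hx hp with rfl | rfl
    · exact hx hδ.xd
    · exact hy hδ.xd
  · rcases h.eq_or hδ.hy hp with rfl | rfl
    · exact hx hδ.yd
    · exact hy hδ.yd

theorem pair_not_both (hT : Tight F X E) (h : Nontail F X E d x y u w u' w') {δ a b a' b' : β}
    {p q : α} (hδ : Nontail F X E δ p q a b a' b') (hne : δ ≠ d) (hpu : p ∈ F u) (hpw : p ∈ F w) :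
    False := by
  obtain ⟨hxδ, hpd, hqd⟩ := pair_notMem hT h hδ hne
  have hK := h.pick hT
  have hpx : p ≠ x := fun hh => hxδ (hh ▸ hδ.xd)
  have hqx : q ≠ x := fun hh => hxδ (hh ▸ hδ.yd)
  have huδ : u ≠ δ := fun hh => hxδ (hh ▸ h.xu)
  have hwδ : w ≠ δ := fun hh => hxδ (hh ▸ h.xw)
  have h1 := fun f hf hqf => hK.unique_of_unique (z := p) (e := δ) (y := q) (f := f)
    (by simp [hδ.hx, hpx]) (by simp [hδ.hd, hxδ]) hδ.xd
    (by
      intro f hf hpf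
      simp only [Finset.mem_filter] at hf
      by_contra hfδ
      exact hT.not_four hδ.hx hδ.hd h.hu h.hw hf.1 hδ.xd hpu hpw hpf huδ.symm hwδ.symm
        (Ne.symm hfδ) h.uw (fun hh => hf.2 (hh ▸ h.xu)) (fun hh => hf.2 (hh ▸ h.xw)))
    (by simp [hδ.hy, hqx]) hδ.yd hf hqf
  have h2 : ∀ k ∈ E, q ∈ F k → k ≠ δ → k = u ∨ k = w := by
    intro k hk hqk hkδ
    rcases h.edge_eq hT hk (by_contra fun hh => hkδ (h1 k (by simp [hk, hh]) hqk)) with rfl | h' | h'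
    · exact absurd hqk hqd
    · exact .inl h'
    · exact .inr h'
  have hqu : q ∈ F u := by
    have ha := h2 a' hδ.hu' hδ.yu' hδ.ud'
    have hb := h2 b' hδ.hw' hδ.yw' hδ.wd'
    have := hδ.uw'; have := hδ.yu'; have := hδ.yw'
    rcases ha with rfl | rfl
    · assumption
    · rcases hb with rfl | rfl
      · assumption
      · contradiction
  exact hT.not_subset hδ.hd h.hu huδ.symm fun v hv hvδ => by
    rcases hδ.eq_or hv hvδ with rfl | rfl <;> assumption

theorem pair_one (hT : Tight F X E) (h : Nontail F X E d x y u w u' w') {δ a b a' b' : β}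
    {p q : α} (hδ : Nontail F X E δ p q a b a' b') (hne : δ ≠ d) (hpu : p ∈ F u) (hpw : p ∉ F w) :
    q ∈ F w ∧ q ∉ F u := by
  obtain ⟨hxδ, hpd, hqd⟩ := pair_notMem hT h hδ hne
  have hK := h.pick hT
  have hpx : p ≠ x := fun hh => hxδ (hh ▸ hδ.xd)
  have hqx : q ≠ x := fun hh => hxδ (hh ▸ hδ.yd)
  have huδ : u ≠ δ := fun hh => hxδ (hh ▸ h.xu)
  have hqu : q ∉ F u := fun hqu => hT.not_subset hδ.hd h.hu huδ.symm fun v hv hvδ => by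
    rcases hδ.eq_or hv hvδ with rfl | rfl <;> assumption
  refine ⟨?_, hqu⟩
  obtain ⟨c, hc, hcδ, hcu, hpc, hc3⟩ : ∃ c ∈ E, c ≠ δ ∧ c ≠ u ∧ p ∈ F c ∧ (F c ∩ X).card = 3 := by
    by_cases hau : a = u
    · refine ⟨b, hδ.hw, hδ.wd, ?_, hδ.xw, hδ.swap.card_eq hT⟩
      rintro rfl
      exact hδ.uw hau
    · exact ⟨a, hδ.hu, hδ.ud, hau, hδ.xu, hδ.card_eq hT⟩
  have hxc : x ∉ F c := fun hxc => by
    rcases h.edge_eq hT hc hxc with rfl | rfl | rfl <;> contradiction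
  obtain ⟨e', -, -, -, -, -, h1, -⟩ := hK.reduce (z := p) (y := q) (d := δ) (e := c)
    (by simp [hδ.hx, hpx]) (by simp [hδ.hy, hqx]) (by simp [hδ.hd, hxδ]) (by simp [hc, hxc])
    hδ.xd hpc hδ.yd hδ.ne.symm (by rw [inter_erase_eq hxδ]; exact hδ.two)
    (by rw [inter_erase_eq hxc]; exact hc3)
    (by
      intro f hf hpf
      simp only [Finset.mem_filter] at hf
      by_contra! hfδ
      exact hT.not_four hδ.hx hδ.hd h.hu hc hf.1 hδ.xd hpu hpc hpf huδ.symm hcδ.symm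
        (Ne.symm hfδ.1) hcu.symm (fun hh => hf.2 (hh ▸ h.xu)) hfδ.2.symm)
  by_contra hqw
  have h2 : ∀ k ∈ E, q ∈ F k → k ≠ δ → k = e' := by
    intro k hk hqk hkδ
    refine (h1 k ?_ hqk).resolve_left hkδ
    simp only [Finset.mem_filter]
    refine ⟨hk, fun hxk => ?_⟩
    rcases h.edge_eq hT hk hxk with rfl | rfl | rfl <;> contradiction
  exact hδ.uw' ((h2 a' hδ.hu' hδ.yu' hδ.ud').trans (h2 b' hδ.hw' hδ.yw' hδ.wd').symm)

/-- A second 2-edge has its two vertices in different 3-edges at `x`. -/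
theorem pair_mem (ih : NoNontailBelow F (X.card + E.card)) (hT : Tight F X E)
    (h : Nontail F X E d x y u w u' w') {δ a b a' b' : β}
    {p q : α} (hδ : Nontail F X E δ p q a b a' b') (hne : δ ≠ d) :
    (p ∈ F u ∧ p ∉ F w ∧ q ∈ F w ∧ q ∉ F u) ∨ (p ∈ F w ∧ p ∉ F u ∧ q ∈ F u ∧ q ∉ F w) := by
  obtain ⟨hxδ, hpd, hqd⟩ := pair_notMem hT h hδ hne
  have hpx : p ≠ x := fun hh => hxδ (hh ▸ hδ.xd)
  have hqx : q ≠ x := fun hh => hxδ (hh ▸ hδ.yd)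
  have key : p ∈ F u ∨ p ∈ F w ∨ q ∈ F u ∨ q ∈ F w := by
    by_contra! hno
    have hE : ∀ k ∈ E, p ∈ F k ∨ q ∈ F k → k ∈ E.filter (x ∉ F ·) := by
      intro k hk hpq
      simp only [Finset.mem_filter]
      refine ⟨hk, fun hxk => ?_⟩
      rcases h.edge_eq hT hk hxk with rfl | rfl | rfl <;> tauto
    exact ih _ _ (size_pick_lt h.hx) (h.pick hT) δ p q a b a' b'
      (hδ.mono (by simp [hδ.hx, hpx]) (by simp [hδ.hy, hqx]) (hE _ hδ.hd (.inl hδ.xd))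
        (hE _ hδ.hu (.inl hδ.xu)) (hE _ hδ.hw (.inl hδ.xw)) (hE _ hδ.hu' (.inr hδ.yu'))
        (hE _ hδ.hw' (.inr hδ.yw')) (by rw [inter_erase_eq hxδ]; exact hδ.two))
  have a1 := pair_not_both hT h hδ hne
  have a2 := pair_not_both hT h hδ.symm hne
  have a3 := pair_one hT h hδ hne
  have a4 := pair_one hT h hδ.symm hne
  have a5 := pair_one hT h.swap hδ hne
  have a6 := pair_one hT h.swap hδ.symm hne
  clear ih hδ h hT
  by_cases b1 : p ∈ F u <;> by_cases b2 : p ∈ F w <;> by_cases b3 : q ∈ F u <;>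
    by_cases b4 : q ∈ F w <;> simp_all

theorem exists_configuration (hT : Tight F X E) (h : Nontail F X E d x y u w u' w') {δ : β} {p q t : α}
    (hδ : δ ∈ E) (hδ2 : (F δ ∩ X).card = 2) (hp : p ∈ X) (hq : q ∈ X) (hpδ : p ∈ F δ)
    (hqδ : q ∈ F δ) (hxδ : x ∉ F δ) (hne : δ ≠ d)
    (hpu' : p ∈ F u') (hpw' : p ∉ F w') (hqw : q ∈ F w) (hqw' : q ∈ F w')
    (hpd : p ∉ F d) (hqd : q ∉ F d) (ht : t ∈ X) (htw' : t ∈ F w') (hty : t ≠ y) :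
    (∀ f ∈ E, t ∈ F f → x ∈ F f ∨ p ∈ F f ∨ f = w') ∧
    ∀ v ∈ X, v ≠ x → v ≠ p → v ≠ y → ∃ f ∈ E, x ∉ F f ∧ p ∉ F f ∧ v ∈ F f := by
  have hxu' := h.notMem hT
  have hxw' := h.symm.swap.symm.notMem hT
  have hyw := h.swap.symm.notMem hT
  have hu_3 := h.symm.card_eq hT
  have hw_3 := h.symm.swap.card_eq hT
  have hK := h.pick hT
  have hpx : p ≠ x := fun hh => hxδ (hh ▸ hpδ)
  have hpy : p ≠ y := fun hh => hpd (hh ▸ h.yd)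
  have hqx : q ≠ x := fun hh => hxδ (hh ▸ hqδ)
  have hqy : q ≠ y := fun hh => hqd (hh ▸ h.yd)
  have hqp : q ≠ p := fun hh => hpw' (hh ▸ hqw')
  have hδu' : δ ≠ u' := by rintro rfl; omega
  have hw_δ : w' ≠ δ := by rintro rfl; omega
  have hww' : w ≠ w' := fun hh => hxw' (hh ▸ h.xw)
  have hwδ : w ≠ δ := fun hh => hxδ (hh ▸ h.xw)
  have hyE := fun k hk hyk => h.symm.edge_eq hT (k := k) hk hyk
  have hqE : ∀ k ∈ E, q ∈ F k → k = δ ∨ k = w ∨ k = w' := by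
    intro k hk hqk
    by_contra! hno
    exact hT.not_four hq hδ h.hw h.hw' hk hqδ hqw hqw' hqk hwδ.symm hw_δ.symm
      hno.1.symm hww' hno.2.1.symm hno.2.2.symm
  have hs := hK.slack.pick_two (x := p) (e := δ) (f := u') (by simp [hp, hpx]) (by simp [hδ, hxδ])
    (by simp [h.hu', hxu']) hδu' hpδ hpu'
  have hsz := hK.sized.pick p
  rw [edgeWeight_erase hxδ, edgeWeight_erase hxu', edgeWeight_of_two hδ2,
    edgeWeight_of_three hu_3] at hs
  have hy2 : y ∈ (X.erase x).erase p := by simp [h.hy, hpy.symm, h.ne.symm]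
  have hmem : ∀ f, f ∈ (E.filter (x ∉ F ·)).filter (p ∉ F ·) ↔ f ∈ E ∧ x ∉ F f ∧ p ∉ F f := by
    intro f; simp [and_assoc]
  have hyu : ∀ f ∈ (E.filter (x ∉ F ·)).filter (p ∉ F ·), y ∈ F f → f = w' := by
    intro f hf hyf
    rw [hmem] at hf
    rcases hyE f hf.1 hyf with rfl | rfl | rfl
    · exact absurd h.xd hf.2.1
    · exact absurd hpu' hf.2.2
    · rfl
  have hw_m : w' ∈ (E.filter (x ∉ F ·)).filter (p ∉ F ·) := by rw [hmem]; exact ⟨h.hw', hxw', hpw'⟩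
  have h3 : (F w' ∩ (X.erase x).erase p).card = 3 := by
    rw [inter_erase_eq hpw', inter_erase_eq hxw', hw_3]
  have hR : Tight F (((X.erase x).erase p).erase y) ((E.filter (x ∉ F ·)).filter (p ∉ F ·)) :=
    ⟨hsz.drop_one hy2 hyu h3, hK.degree_mono ((Finset.erase_subset _ _).trans
      (Finset.erase_subset _ _)) (Finset.filter_subset _ _),
      (hs.drop_one hy2 hw_m h.yw' hyu h3).mono (by norm_num)⟩
  have htx : t ≠ x := fun hh => hxw' (hh ▸ htw')
  have htp : t ≠ p := fun hh => hpw' (hh ▸ htw')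
  constructor
  · intro f hf htf
    by_contra! hno
    refine hno.2.2 (hR.unique_of_unique (z := q) (e := w') (y := t) (by simp [hq, hqx, hqy, hqp]) hw_m
      hqw' ?_ (by simp [ht, htx, htp, hty]) htw' ((hmem f).2 ⟨hf, hno.1, hno.2.1⟩) htf)
    intro g hg hqg
    rw [hmem] at hg
    rcases hqE g hg.1 hqg with rfl | rfl | rfl
    · exact absurd hpδ hg.2.2
    · exact absurd h.xw hg.2.1
    · rfl
  · intro v hv hvx hvp hvy
    obtain ⟨f, hf, hvf⟩ := hR.exists_edge (x := v) (by simp [hv, hvx, hvp, hvy])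
    rw [hmem] at hf
    exact ⟨f, hf.1, hf.2.1, hf.2.2, hvf⟩

theorem exists_third {e : β} (he3 : (F e ∩ X).card = 3) {p q : α} (hp : p ∈ X)
    (hq : q ∈ X) (hpe : p ∈ F e) (hqe : q ∈ F e) (hpq : p ≠ q) :
    ∃ t ∈ X, t ∈ F e ∧ t ≠ p ∧ t ≠ q ∧ ∀ v ∈ X, v ∈ F e → v = p ∨ v = q ∨ v = t := by
  obtain ⟨a, b, ha, hb, hae, hbe, hpa, hpb, hab, hall⟩ := Sized.exists_others he3 hp hpe
  rcases hall q hq hqe with rfl | rfl | rfl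
  · exact absurd rfl hpq
  · exact ⟨b, hb, hbe, hpb.symm, hab.symm, hall⟩
  · exact ⟨a, ha, hae, hpa.symm, hab, fun v hv hve => by have := hall v hv hve; tauto⟩

set_option maxHeartbeats 1000000 in
theorem false_of_pair (hT : Tight F X E) (h : Nontail F X E d x y u w u' w') {δ a b a' b' : β}
    {p q : α} (hδ : Nontail F X E δ p q a b a' b') (hne : δ ≠ d)
    (hpu : p ∈ F u) (hpw : p ∉ F w) (hqw : q ∈ F w) (hqu : q ∉ F u)
    (hpu' : p ∈ F u') (hpw' : p ∉ F w') (hqw' : q ∈ F w') (hqu' : q ∉ F u') : False := by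
  obtain ⟨hxδ, hpd, hqd⟩ := pair_notMem hT h hδ hne
  obtain ⟨hyδ, -, -⟩ := pair_notMem hT h.symm hδ hne
  have hxu' := h.notMem hT
  have hxw' := h.symm.swap.symm.notMem hT
  have hyu := h.symm.notMem hT
  have hyw := h.swap.symm.notMem hT
  have hpx : p ≠ x := fun hh => hxδ (hh ▸ hδ.xd)
  have hqx : q ≠ x := fun hh => hxδ (hh ▸ hδ.yd)
  have hpy : p ≠ y := fun hh => hyδ (hh ▸ hδ.xd)
  have hqy : q ≠ y := fun hh => hyδ (hh ▸ hδ.yd)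
  obtain ⟨s, hs, hsu, hsx, hsp, -⟩ := exists_third (h.card_eq hT) h.hx hδ.hx h.xu hpu hpx.symm
  obtain ⟨t, ht, htw, htx, htq, -⟩ := exists_third (h.swap.card_eq hT) h.hx hδ.hy h.xw hqw hqx.symm
  obtain ⟨s', hs', hsu', hsy', hsp', -⟩ := exists_third (h.symm.card_eq hT) h.hy hδ.hx h.yu' hpu'
    hpy.symm
  obtain ⟨t', ht', htw', hty', htq', hall⟩ := exists_third (h.symm.swap.card_eq hT) h.hy hδ.hy h.yw'
    hqw' hqy.symm
  obtain ⟨c1, ex⟩ := exists_configuration hT h hδ.hd hδ.two hδ.hx hδ.hy hδ.xd hδ.yd hxδ hne hpu' hpw' hqw hqw' hpd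
    hqd ht' htw' hty'
  obtain ⟨c2, -⟩ := exists_configuration hT h.symm.swap.symm.swap hδ.hd hδ.two hδ.hy hδ.hx hδ.yd hδ.xd hxδ hne
    hqw' hqu' hpu hpu' hqd hpd hs' hsu' hsy'
  obtain ⟨c3, -⟩ := exists_configuration hT h.symm hδ.hd hδ.two hδ.hx hδ.hy hδ.xd hδ.yd hyδ hne hpu hpw hqw' hqw hpd
    hqd ht htw htx
  obtain ⟨c4, -⟩ := exists_configuration hT h.symm.swap.symm.swap.symm hδ.hd hδ.two hδ.hy hδ.hx hδ.yd hδ.xd hyδ hne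
    hqw hqu hpu' hpu hqd hpd hs hsu hsx
  have huδ : u ≠ δ := fun hh => hxδ (hh ▸ h.xu)
  have hwδ : w ≠ δ := fun hh => hxδ (hh ▸ h.xw)
  have huδ' : u' ≠ δ := fun hh => hyδ (hh ▸ h.yu')
  have hwδ' : w' ≠ δ := fun hh => hyδ (hh ▸ h.yw')
  have huu : u ≠ u' := fun hh => hyu (hh ▸ h.yu')
  have huw' : u ≠ w' := fun hh => hyu (hh ▸ h.yw')
  have hwu' : w ≠ u' := fun hh => hyw (hh ▸ h.yu')
  have hww' : w ≠ w' := fun hh => hyw (hh ▸ h.yw')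
  have hxE := fun k hk hxk => h.edge_eq hT (k := k) hk hxk
  have hyE := fun k hk hxk => h.symm.edge_eq hT (k := k) hk hxk
  have hpE : ∀ k ∈ E, p ∈ F k → k = δ ∨ k = u ∨ k = u' := by
    intro k hk hqk
    by_contra! hno
    exact hT.not_four hδ.hx hδ.hd h.hu h.hu' hk hδ.xd hpu hpu' hqk huδ.symm huδ'.symm
      hno.1.symm huu hno.2.1.symm hno.2.2.symm
  have hqE : ∀ k ∈ E, q ∈ F k → k = δ ∨ k = w ∨ k = w' := by
    intro k hk hqk
    by_contra! hno
    exact hT.not_four hδ.hy hδ.hd h.hw h.hw' hk hδ.yd hqw hqw' hqk hwδ.symm hwδ'.symm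
      hno.1.symm hww' hno.2.1.symm hno.2.2.symm
  have hdm := fun v hv hvd => h.eq_or (v := v) hv hvd
  have hδm := fun v hv hvd => hδ.eq_or (v := v) hv hvd
  have not4 := fun (h1 : t' ∈ F u) (h2 : t' ∈ F w) (h3 : t' ∈ F u') =>
    hT.not_four ht' h.hu h.hw h.hu' h.hw' h1 h2 h3 htw' h.uw huu huw' hwu' hww' h.uw'
  have hxw := h.xw; have hxu := h.xu; have hyu' := h.yu'; have hyw' := h.yw'; have hud := h.ud
  have hwd := h.wd; have hud' := h.ud'; have hwd' := h.wd'
  have huw := h.uw; have huw'' := h.uw'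
  clear hT h hδ
  have e1 : s = t' := by
    obtain ⟨f, hf, hxf, hpf, hsf⟩ := ex s hs hsx hsp (by rintro rfl; contradiction)
    have hfw : f = w' := by
      rcases c4 f hf hsf with hh | hh | rfl
      · rcases hyE f hf hh with rfl | rfl | rfl
        · rcases hdm s hs hsf with rfl | rfl <;> contradiction
        · contradiction
        · rfl
      · rcases hqE f hf hh with rfl | rfl | rfl
        · rcases hδm s hs hsf with rfl | rfl <;> contradiction
        · contradiction
        · rfl
      · contradiction
    subst hfw
    rcases hall s hs hsf with rfl | rfl | rfl
    · contradiction
    · contradiction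
    · rfl
  have e2 : t = t' := by
    obtain ⟨f, hf, hxf, hpf, hsf⟩ := ex t ht htx (by rintro rfl; contradiction)
      (by rintro rfl; contradiction)
    have hfw : f = w' := by
      rcases c3 f hf hsf with hh | hh | rfl
      · rcases hyE f hf hh with rfl | rfl | rfl
        · rcases hdm t ht hsf with rfl | rfl <;> contradiction
        · contradiction
        · rfl
      · contradiction
      · contradiction
    subst hfw
    rcases hall t ht hsf with rfl | rfl | rfl
    · contradiction
    · contradiction
    · rfl
  have e3 : s' = t' := by
    obtain ⟨f, hf, hxf, hpf, hsf⟩ := ex s' hs' (by rintro rfl; contradiction) hsp' hsy'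
    have hfw : f = w' := by
      rcases c2 f hf hsf with hh | hh | rfl
      · contradiction
      · rcases hqE f hf hh with rfl | rfl | rfl
        · rcases hδm s' hs' hsf with rfl | rfl <;> contradiction
        · contradiction
        · rfl
      · contradiction
    subst hfw
    rcases hall s' hs' hsf with rfl | rfl | rfl
    · contradiction
    · contradiction
    · rfl
  subst e1
  exact not4 hsu (e2 ▸ htw) (e3 ▸ hsu')

theorem of_minimal (ih : NoNontailBelow F (X.card + E.card)) (hT : Tight F X E)
    (h : Nontail F X E d x y u w u' w') : False := by
  have hxu' := h.notMem hT
  have hxw' := h.symm.swap.symm.notMem hT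
  have hK := h.pick hT
  by_cases hex : ∃ δ ∈ E.filter (x ∉ F ·), (F δ ∩ X.erase x).card = 2
  · obtain ⟨δ, hδ, hδ2⟩ := hex
    simp only [Finset.mem_filter] at hδ
    rw [inter_erase_eq hδ.2] at hδ2
    obtain ⟨p, hp⟩ : (F δ ∩ X).Nonempty := Finset.card_pos.1 (by omega)
    simp only [Finset.mem_inter] at hp
    obtain ⟨q, hq, hqδ, hpq, -⟩ := Sized.exists_other hδ2 hp.2 hp.1
    obtain ⟨a, ha, b, hb, haδ, hbδ, hab, hpa, hpb⟩ := ih.exists_edges hT h hp.2 hδ.1 hp.1 hδ2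
    obtain ⟨a', ha', b', hb', haδ', hbδ', hab', hpa', hpb'⟩ := ih.exists_edges hT h hq hδ.1 hqδ hδ2
    have hN : Nontail F X E δ p q a b a' b' := ⟨hp.2, hq, hδ.1, ha, hb, ha', hb', hp.1, hqδ, hpa,
      hpb, hpa', hpb', hpq, haδ, hbδ, hab, haδ', hbδ', hab', hδ2⟩
    have hne : δ ≠ d := fun hh => hδ.2 (hh ▸ h.xd)
    rcases ih.pair_mem hT h hN hne with ⟨h1, h2, h3, h4⟩ | ⟨h1, h2, h3, h4⟩ <;>
    rcases ih.pair_mem hT h.symm hN hne with ⟨h5, h6, h7, h8⟩ | ⟨h5, h6, h7, h8⟩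
    · exact false_of_pair hT h hN hne h1 h2 h3 h4 h5 h6 h7 h8
    · exact false_of_pair hT h.symm.swap.symm hN hne h1 h2 h3 h4 h5 h6 h7 h8
    · exact false_of_pair hT h.swap hN hne h1 h2 h3 h4 h5 h6 h7 h8
    · exact false_of_pair hT h.swap.symm.swap.symm hN hne h1 h2 h3 h4 h5 h6 h7 h8
  · push Not at hex
    have hU : Uniform3 F (X.erase x) (E.filter (x ∉ F ·)) := fun e he =>
      (hK.sized e he).resolve_left (hex e he)
    have hd := (hK.slack.regular_of_uniform hU hK.degree).1 y (by simp [h.hy, h.ne.symm])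
    have hsub : (E.filter (x ∉ F ·)).filter (y ∈ F ·) ⊆ {u', w'} := by
      intro k hk
      simp only [Finset.mem_filter] at hk
      rcases h.symm.edge_eq hT hk.1.1 hk.2 with rfl | rfl | rfl
      · exact absurd h.xd hk.1.2
      · simp
      · simp
    have := Finset.card_le_card hsub
    have := Finset.card_le_two (a := u') (b := w')
    omega

end NoNontailBelow

theorem noNontailBelow (F : β → Finset α) (n : ℕ) : NoNontailBelow F n := by
  induction n with
  | zero => intro X E hn; omega
  | succ n ih =>
    intro X E hn hT d x y u w u' w' h
    exact NoNontailBelow.of_minimal (fun X' E' h' => ih X' E' (by omega)) hT h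

theorem Tight.not_nontail (hT : Tight F X E) {d u w u' w' : β} {x y : α} :
    ¬ Nontail F X E d x y u w u' w' :=
  noNontailBelow F _ X E (Nat.lt_succ_self _) hT d x y u w u' w'

end Hypergraph

section Hypergraph

variable {α β : Type*} [DecidableEq α] [DecidableEq β] {F : β → Finset α}
  {X : Finset α} {E : Finset β} {s : ℤ}

/-- The possible neighbourhoods of a 2-edge in a tight state. -/
theorem Tight.types (hT : Tight F X E) {c : β} {z z' : α} (hz : z ∈ X) (hz' : z' ∈ X) (hc : c ∈ E)
    (hzc : z ∈ F c) (hzc' : z' ∈ F c) (hne : z ≠ z') (hc2 : (F c ∩ X).card = 2) :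
    ((∀ f ∈ E, z ∈ F f → f = c) ∧ ∀ f ∈ E, z' ∈ F f → f = c) ∨
    (∃ h ∈ E, h ≠ c ∧ z ∈ F h ∧ (F h ∩ X).card = 2) ∨
    (∃ h ∈ E, h ≠ c ∧ z' ∈ F h ∧ (F h ∩ X).card = 2) ∨
    ∃ e ∈ E, ∃ e' ∈ E, e ≠ c ∧ e' ≠ c ∧ (F e ∩ X).card = 3 ∧ (F e' ∩ X).card = 3 ∧ z ∈ F e ∧
      z' ∈ F e' ∧ (∀ f ∈ E, z ∈ F f → f = c ∨ f = e) ∧ ∀ f ∈ E, z' ∈ F f → f = c ∨ f = e' := by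
  by_cases h1 : ∀ f ∈ E, z ∈ F f → f = c
  · exact .inl ⟨h1, fun f hf hzf => hT.unique_of_unique hz hc hzc h1 hz' hzc' hf hzf⟩
  by_cases h1' : ∀ f ∈ E, z' ∈ F f → f = c
  · exact absurd (fun f hf hzf => hT.unique_of_unique hz' hc hzc' h1' hz hzc hf hzf) h1
  by_cases h2 : ∃ h ∈ E, h ≠ c ∧ z ∈ F h ∧ (F h ∩ X).card = 2
  · exact .inr (.inl h2)
  by_cases h2' : ∃ h ∈ E, h ≠ c ∧ z' ∈ F h ∧ (F h ∩ X).card = 2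
  · exact .inr (.inr (.inl h2'))
  right; right; right
  push Not at h1 h1' h2 h2'
  obtain ⟨a, ha, hza, hac⟩ := h1
  obtain ⟨a', ha', hza', hac'⟩ := h1'
  have ha3 := (hT.sized a ha).resolve_left (h2 a ha hac hza)
  have ha3' := (hT.sized a' ha').resolve_left (h2' a' ha' hac' hza')
  by_cases h3 : ∀ f ∈ E, z ∈ F f → f = c ∨ f = a
  · obtain ⟨e', he', h4, h5, h6, -, h7, -⟩ :=
      hT.reduce hz hz' hc ha hzc hza hzc' hne.symm hc2 ha3 h3
    exact ⟨a, ha, e', he', hac, fun hh => h6 (hh ▸ hzc), ha3, h4, hza, h5, h3, h7⟩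
  by_cases h3' : ∀ f ∈ E, z' ∈ F f → f = c ∨ f = a'
  · obtain ⟨e', he', h4, h5, h6, -, h7, -⟩ :=
      hT.reduce hz' hz hc ha' hzc' hza' hzc hne hc2 ha3' h3'
    exact ⟨e', he', a', ha', fun hh => h6 (hh ▸ hzc'), hac', h4, ha3', h5, hza', h7, h3'⟩
  push Not at h3 h3'
  obtain ⟨b, hb, hzb, hbc, hba⟩ := h3
  obtain ⟨b', hb', hzb', hbc', hba'⟩ := h3'
  exact absurd ⟨hz, hz', hc, ha, hb, ha', hb', hzc, hzc', hza, hzb, hza', hzb', hne, hac, hbc,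
    hba.symm, hac', hbc', hba'.symm, hc2⟩ (hT.not_nontail (d := c) (x := z) (y := z') (u := a)
      (w := b) (u' := a') (w' := b'))

/-- Every vertex in two 3-edges has a third edge. -/
def TwoInTwoEdge (F : β → Finset α) (X : Finset α) (E : Finset β) : Prop :=
  ∀ z ∈ X, ∀ e ∈ E, ∀ f ∈ E, e ≠ f → z ∈ F e → z ∈ F f → (F e ∩ X).card = 3 →
    (F f ∩ X).card = 3 → ∃ g ∈ E, g ≠ e ∧ g ≠ f ∧ z ∈ F g

/-- A tight state which remains tight after picking `z` and dropping `y`, which shrinks the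
3-edge `g = {y, c, d}` to the 2-edge `{c, d}`. -/
structure ShrinkEdge (F : β → Finset α) (X : Finset α) (E : Finset β) (z y c d : α) (g : β) :
    Prop where
  tight : Tight F X E
  tight' : Tight F ((X.erase z).erase y) (E.filter (z ∉ F ·))
  hz : z ∈ X
  hy : y ∈ X
  hc : c ∈ X
  hd : d ∈ X
  hg : g ∈ E
  yz : y ≠ z
  yc : y ≠ c
  yd : y ≠ d
  cd : c ≠ d
  zg : z ∉ F g
  yg : y ∈ F g
  cg : c ∈ F g
  dg : d ∈ F g
  g3 : (F g ∩ X).card = 3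
  uniq : ∀ f ∈ E, z ∉ F f → y ∈ F f → f = g

namespace ShrinkEdge

variable {z y c d : α} {g : β}

theorem symm (h : ShrinkEdge F X E z y c d g) : ShrinkEdge F X E z y d c g :=
  ⟨h.tight, h.tight', h.hz, h.hy, h.hd, h.hc, h.hg, h.yz, h.yd, h.yc, h.cd.symm, h.zg, h.yg, h.dg, h.cg,
    h.g3, h.uniq⟩

theorem mem (h : ShrinkEdge F X E z y c d g) : ∀ v ∈ X, v ∈ F g → v = y ∨ v = c ∨ v = d := by
  obtain ⟨t, ht, htg, -, -, hall⟩ := NoNontailBelow.exists_third h.g3 h.hy h.hc h.yg h.cg h.yc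
  have hd := hall d h.hd h.dg
  have h1 := h.yd
  have h2 := h.cd
  have : d = t := by tauto
  subst this
  exact hall

theorem two (h : ShrinkEdge F X E z y c d g) : (F g ∩ (X.erase z).erase y).card = 2 := by
  have := card_inter_erase (F := F) (e := g) (X := X.erase z) (z := y) (by simp [h.yz, h.hy]) h.yg
  rw [inter_erase_eq h.zg, h.g3] at this
  omega

theorem card_eq (h : ShrinkEdge F X E z y c d g) {k : β} (hk : k ∈ E) (hzk : z ∉ F k) (hkg : k ≠ g) :
    F k ∩ (X.erase z).erase y = F k ∩ X := by
  rw [inter_erase_eq fun hyk => hkg (h.uniq k hk hzk hyk), inter_erase_eq hzk]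

theorem hc' (h : ShrinkEdge F X E z y c d g) : c ∈ (X.erase z).erase y := by
  simp [h.hc, h.yc.symm, show c ≠ z from fun hh => h.zg (hh ▸ h.cg)]

theorem hg' (h : ShrinkEdge F X E z y c d g) : g ∈ E.filter (z ∉ F ·) := by simp [h.hg, h.zg]

set_option maxHeartbeats 1000000 in
theorem two_two (h : ShrinkEdge F X E z y c d g) {k : β} (hk : k ∈ E) (hkg : k ≠ g) (hzk : z ∉ F k)
    (hck : c ∈ F k) (hk2 : (F k ∩ X).card = 2) :
    ∃ e ∈ E, z ∈ F e ∧ c ∈ F e ∧ d ∈ F e ∧ (F e ∩ X).card = 3 := by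
  have hT := h.tight
  have hyk : y ∉ F k := fun hyk => hkg (h.uniq k hk hzk hyk)
  obtain ⟨r, hr, hrk, hcr, hrall⟩ := Sized.exists_other hk2 h.hc hck
  have hrz : r ≠ z := fun hh => hzk (hh ▸ hrk)
  have hry : r ≠ y := fun hh => hyk (hh ▸ hrk)
  have hr' : r ∈ (X.erase z).erase y := by simp [hr, hrz, hry]
  have hk' : k ∈ E.filter (z ∉ F ·) := by simp [hk, hzk]
  have hrg : r ∉ F g := fun hrg => hT.not_subset hk h.hg hkg fun v hv hvk => by
    rcases hrall v hv hvk with rfl | rfl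
    · exact h.cg
    · exact hrg
  -- `c` has a third edge
  obtain ⟨e, he, hek, heg, hce⟩ : ∃ e ∈ E, e ≠ k ∧ e ≠ g ∧ c ∈ F e := by
    by_contra! hno
    obtain ⟨e', he', he3', hre', hce', -, huniq, -⟩ := hT.reduce h.hc hr hk h.hg hck h.cg hrk
      hcr.symm hk2 h.g3 fun f hf hcf => by
        by_contra! hh
        exact hno f hf hh.1 hh.2 hcf
    obtain ⟨-, ⟨m, hm, hm2, hrm, -, hmk, -, -⟩ | ⟨a, ha, b, hb, hab, ha3, hb3, hra, hrb, -⟩⟩ :=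
      h.tight'.two_two h.hc' hr' h.symm.hc' hk' h.hg' hck h.cg hrk h.dg hkg hcr.symm h.cd.symm
        (by rw [h.card_eq hk hzk hkg, hk2]) h.two
    · simp only [Finset.mem_filter] at hm
      have hme : m = e' := (huniq m hm.1 hrm).resolve_left hmk
      have hmg : m ≠ g := fun hh => hrg (hh ▸ hrm)
      rw [h.card_eq hm.1 hm.2 hmg, hme] at hm2
      omega
    · simp only [Finset.mem_filter] at ha hb
      have key : ∀ l ∈ E, r ∈ F l → z ∉ F l → (F l ∩ (X.erase z).erase y).card = 3 → l = e' := by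
        intro l hl hrl hzl hl3
        refine (huniq l hl hrl).resolve_left ?_
        rintro rfl
        rw [h.card_eq hk hzk hkg] at hl3
        omega
      exact hab ((key a ha.1 hra ha.2 ha3).trans (key b hb.1 hrb hb.2 hb3).symm)
  have he3 : (F e ∩ X).card = 3 := (hT.sized e he).resolve_left fun he2 =>
    hT.not_two_two h.hc hk he h.hg hck hce h.cg hek.symm hkg heg hk2 he2
  rcases hT.types hr h.hc hk hrk hck hcr.symm hk2 with
    ⟨-, h1⟩ | ⟨m, hm, hmk, hrm, hm2⟩ | ⟨m, hm, hmk, hcm, hm2⟩ | ⟨-, -, a, -, -, -, -, -, -, -, -, h1⟩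
  · exact absurd (h1 e he hce) hek
  · -- the other 2-edge at `r`
    obtain ⟨r', hr'', hrm', hrr', hrall'⟩ := Sized.exists_other hm2 hr hrm
    obtain ⟨-, ⟨n, hn, hn2, hcn, -, hnk, -, h1, -⟩ |
        ⟨a, ha, b, hb, hab, ha3, hb3, hca, hcb, hra, hrb, hc3, -⟩⟩ :=
      hT.two_two hr h.hc hr'' hk hm hrk hrm hck hrm' hmk.symm hcr hrr'.symm hk2 hm2
    · rcases h1 e he hce with h1 | rfl
      · exact absurd h1 hek
      · omega
    have hge : g = a ∨ g = b := by
      rcases hc3 g h.hg h.cg with h1 | h1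
      · exact absurd h1.symm hkg
      · exact h1
    have hee : e = a ∨ e = b := by
      rcases hc3 e he hce with h1 | h1
      · exact absurd h1 hek
      · exact h1
    have hrg' : r' ∈ F g := by rcases hge with rfl | rfl <;> assumption
    have hre' : r' ∈ F e := by rcases hee with rfl | rfl <;> assumption
    have hcr' : c ≠ r' := by
      rintro rfl
      exact hT.not_two_two h.hc hk hm h.hg hck hrm' h.cg hmk.symm hkg
        (by rintro rfl; exact hrg hrm) hk2 hm2
    have hry' : r' ≠ y := by
      rintro rfl
      by_cases hzm : z ∈ F m
      · rcases hrall' z h.hz hzm with hh | hh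
        · exact hrz hh.symm
        · exact h.yz hh.symm
      · have := h.uniq m hm hzm hrm'
        subst this
        exact hrg hrm
    rcases h.mem r' hr'' hrg' with hh | hh | rfl
    · exact absurd hh hry'
    · exact absurd hh.symm hcr'
    have hze : z ∈ F e := by
      by_contra hze
      exact h.tight'.not_two_two h.hc' hk' h.hg' (by simp [he, hze] : e ∈ E.filter (z ∉ F ·)) hck
        h.cg hce hkg hek.symm heg.symm (by rw [h.card_eq hk hzk hkg, hk2]) h.two
    exact ⟨e, he, hze, hce, hre', he3⟩
  · exact (hT.not_two_two h.hc hk hm h.hg hck hcm h.cg hmk.symm hkg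
      (by rintro rfl; have := h.g3; omega) hk2 hm2).elim
  · have h2 := h1 g h.hg h.cg
    have h3 := h1 e he hce
    exact absurd ((h3.resolve_left hek).trans (h2.resolve_left hkg.symm).symm) heg

theorem exists_two (h : ShrinkEdge F X E z y c d g) (hD : TwoInTwoEdge F X E)
    (hz3 : ∀ e ∈ E, z ∈ F e → c ∈ F e → (F e ∩ X).card = 3)
    (h1 : ∀ f ∈ E.filter (z ∉ F ·), c ∈ F f → f = g) :
    ∃ e ∈ E, ∃ e' ∈ E, e ≠ e' ∧ z ∈ F e ∧ c ∈ F e ∧ z ∈ F e' ∧ c ∈ F e' := by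
  have h2 : ∀ f ∈ E, c ∈ F f → f ≠ g → z ∈ F f := fun f hf hcf hfg => by
    by_contra hzf
    exact hfg (h1 f (by simp [hf, hzf]) hcf)
  obtain ⟨f, hf, hfg, hcf⟩ := h.tight.exists_ne_edge h.hc h.hg h.cg h.g3
  have hzf := h2 f hf hcf hfg
  obtain ⟨f', hf', hfg', hff', hcf'⟩ :=
    hD c h.hc g h.hg f hf hfg.symm h.cg hcf h.g3 (hz3 f hf hzf hcf)
  exact ⟨f, hf, f', hf', hff'.symm, hzf, hcf, h2 f' hf' hcf' hfg', hcf'⟩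

theorem exists_one (h : ShrinkEdge F X E z y c d g) (hD : TwoInTwoEdge F X E) {k : β}
    (hk : k ∈ E.filter (z ∉ F ·)) (hkg : k ≠ g) (hck : c ∈ F k)
    (hk3 : (F k ∩ (X.erase z).erase y).card = 3)
    (h1 : ∀ f ∈ E.filter (z ∉ F ·), c ∈ F f → f = g ∨ f = k) :
    ∃ e ∈ E, z ∈ F e ∧ c ∈ F e ∧ (∀ f ∈ E, c ∈ F f → f = g ∨ f = k ∨ f = e) ∧
      k ∈ E ∧ z ∉ F k ∧ k ≠ g ∧ c ∈ F k := by
  simp only [Finset.mem_filter] at hk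
  rw [h.card_eq hk.1 hk.2 hkg] at hk3
  obtain ⟨e, he, heg, hek, hce⟩ := hD c h.hc g h.hg k hk.1 hkg.symm h.cg hck h.g3 hk3
  refine ⟨e, he, ?_, hce, ?_, hk.1, hk.2, hkg, hck⟩
  · by_contra hze
    rcases h1 e (by simp [he, hze]) hce with hh | hh <;> contradiction
  · intro f hf hcf
    by_contra! hno
    exact h.tight.not_four h.hc h.hg hk.1 he hf h.cg hck hce hcf hkg.symm heg.symm hno.1.symm
      hek.symm hno.2.1.symm hno.2.2.symm

theorem trichotomy (h : ShrinkEdge F X E z y c d g) (hD : TwoInTwoEdge F X E)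
    (hz3 : ∀ e ∈ E, z ∈ F e → c ∈ F e ∨ d ∈ F e → (F e ∩ X).card = 3) :
    (∃ e ∈ E, z ∈ F e ∧ c ∈ F e ∧ d ∈ F e ∧ (F e ∩ X).card = 3) ∨
    ((∃ e ∈ E, ∃ e' ∈ E, e ≠ e' ∧ z ∈ F e ∧ c ∈ F e ∧ z ∈ F e' ∧ c ∈ F e') ∧
      ∃ e ∈ E, ∃ e' ∈ E, e ≠ e' ∧ z ∈ F e ∧ d ∈ F e ∧ z ∈ F e' ∧ d ∈ F e') ∨
    ((∃ k, ∃ e ∈ E, z ∈ F e ∧ c ∈ F e ∧ (∀ f ∈ E, c ∈ F f → f = g ∨ f = k ∨ f = e) ∧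
      k ∈ E ∧ z ∉ F k ∧ k ≠ g ∧ c ∈ F k) ∧
      ∃ k, ∃ e ∈ E, z ∈ F e ∧ d ∈ F e ∧ (∀ f ∈ E, d ∈ F f → f = g ∨ f = k ∨ f = e) ∧
      k ∈ E ∧ z ∉ F k ∧ k ≠ g ∧ d ∈ F k) := by
  rcases h.tight'.types h.hc' h.symm.hc' h.hg' h.cg h.dg h.cd h.two with
    ⟨h1, h2⟩ | ⟨m, hm, hmk, hrm, hm2⟩ | ⟨m, hm, hmk, hcm, hm2⟩ |
      ⟨a, ha, b, hb, hag, hbg, ha3, hb3, hca, hdb, h1, h2⟩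
  · exact .inr (.inl ⟨h.exists_two hD (fun e he hze hce => hz3 e he hze (.inl hce)) h1,
      h.symm.exists_two hD (fun e he hze hce => hz3 e he hze (.inr hce)) h2⟩)
  · simp only [Finset.mem_filter] at hm
    rw [h.card_eq hm.1 hm.2 hmk] at hm2
    exact .inl (h.two_two hm.1 hmk hm.2 hrm hm2)
  · simp only [Finset.mem_filter] at hm
    rw [h.card_eq hm.1 hm.2 hmk] at hm2
    obtain ⟨e, he, h1, h2, h3, h4⟩ := h.symm.two_two hm.1 hmk hm.2 hcm hm2
    exact .inl ⟨e, he, h1, h3, h2, h4⟩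
  · exact .inr (.inr ⟨⟨a, h.exists_one hD ha hag hca ha3 h1⟩,
      ⟨b, h.symm.exists_one hD hb hbg hdb hb3 h2⟩⟩)

end ShrinkEdge

/-- The two edges at the ends of a 2-edge whose ends have degree two share their other vertices. -/
theorem Tight.exists_pair (hT : Tight F X E) (hD : TwoInTwoEdge F X E) {x x' : α} {ε e : β}
    (hx : x ∈ X) (hx' : x' ∈ X) (hε : ε ∈ E) (he : e ∈ E) (hxε : x ∈ F ε) (hxe : x ∈ F e)
    (hxε' : x' ∈ F ε) (hne : x' ≠ x) (hε2 : (F ε ∩ X).card = 2) (he3 : (F e ∩ X).card = 3)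
    (huniq : ∀ f ∈ E, x ∈ F f → f = ε ∨ f = e) :
    ∃ e' ∈ E, ∃ c ∈ X, ∃ d ∈ X, (F e' ∩ X).card = 3 ∧ x' ∈ F e' ∧ x ∉ F e' ∧ x' ∉ F e ∧ c ≠ d ∧
      c ∈ F e ∧ c ∈ F e' ∧ d ∈ F e ∧ d ∈ F e' ∧ (∀ f ∈ E, x' ∈ F f → f = ε ∨ f = e') := by
  obtain ⟨e', he', he3', hxe', hxe'', hxe3, huniq', hR⟩ :=
    hT.reduce hx hx' hε he hxε hxe hxε' hne hε2 he3 huniq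
  obtain ⟨c, d, hc, hd, hce, hde, hxc, hxd, hcd, hall⟩ := Sized.exists_others he3' hx' hxe'
  have hS : ShrinkEdge F X E x x' c d e' := ⟨hT, hR, hx, hx', hc, hd, he', hne, hxc, hxd, hcd, hxe'',
    hxe', hce, hde, he3', fun f hf hxf hxf' =>
      (huniq' f hf hxf').resolve_left fun hh => hxf (hh ▸ hxε)⟩
  have hεm : ∀ v ∈ X, v ∈ F ε → v = x ∨ v = x' := by
    obtain ⟨t, ht, hte, hxt, hall'⟩ := Sized.exists_other hε2 hx hxε
    have := hall' x' hx' hxε'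
    have : t = x' := by tauto
    subst this
    exact hall'
  have key : ∀ v ∈ X, v ∈ F e' → v ≠ x' → ∀ f ∈ E, x ∈ F f → v ∈ F f → f = e := by
    intro v hv hve hvx f hf hxf hvf
    refine (huniq f hf hxf).resolve_left ?_
    rintro rfl
    rcases hεm v hv hvf with rfl | rfl <;> contradiction
  refine ⟨e', he', c, hc, d, hd, he3', hxe', hxe'', hxe3, hcd, ?_⟩
  have kc := key c hc hce hxc.symm
  have kd := key d hd hde hxd.symm
  rcases hS.trichotomy hD (by
      rintro f hf hxf (hcf | hdf)
      · rw [kc f hf hxf hcf, he3]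
      · rw [kd f hf hxf hdf, he3]) with
    ⟨f, hf, hxf, hcf, hdf, -⟩ | ⟨⟨f, hf, f', hf', hff, hxf, hcf, hxf', hcf'⟩, -⟩ |
      ⟨⟨-, f, hf, hxf, hcf, -⟩, ⟨-, f', hf', hxf', hdf', -⟩⟩
  · have := kc f hf hxf hcf
    subst this
    exact ⟨hcf, hce, hdf, hde, huniq'⟩
  · exact absurd ((kc f hf hxf hcf).trans (kc f' hf' hxf' hcf').symm) hff
  · rw [kc f hf hxf hcf] at hcf
    rw [kd f' hf' hxf' hdf'] at hdf'
    exact ⟨hcf, hce, hdf', hde, huniq'⟩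

/-- Two vertices sharing two 3-edges, with their third edges. -/
structure Block (F : β → Finset α) (X : Finset α) (E : Finset β) (p q : α) (e e' f g : β) :
    Prop where
  hp : p ∈ X
  hq : q ∈ X
  he : e ∈ E
  he' : e' ∈ E
  hf : f ∈ E
  hg : g ∈ E
  pe : p ∈ F e
  pe' : p ∈ F e'
  qe : q ∈ F e
  qe' : q ∈ F e'
  pf : p ∈ F f
  qg : q ∈ F g
  pq : p ≠ q
  ee' : e ≠ e'
  fe : f ≠ e
  fe' : f ≠ e'
  ge : g ≠ e
  ge' : g ≠ e'
  e3 : (F e ∩ X).card = 3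
  e3' : (F e' ∩ X).card = 3

namespace Block

variable {p q : α} {e e' f g : β}

theorem symm (h : Block F X E p q e e' f g) : Block F X E q p e e' g f :=
  ⟨h.hq, h.hp, h.he, h.he', h.hg, h.hf, h.qe, h.qe', h.pe, h.pe', h.qg, h.pf, h.pq.symm, h.ee',
    h.ge, h.ge', h.fe, h.fe', h.e3, h.e3'⟩

theorem edge_eq (h : Block F X E p q e e' f g) (hT : Tight F X E) {k : β} (hk : k ∈ E)
    (hpk : p ∈ F k) : k = e ∨ k = e' ∨ k = f := by
  by_contra! hno
  exact hT.not_four h.hp h.he h.he' h.hf hk h.pe h.pe' h.pf hpk h.ee' h.fe.symm hno.1.symm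
    h.fe'.symm hno.2.1.symm hno.2.2.symm

theorem ne (h : Block F X E p q e e' f g) (hT : Tight F X E) : f ≠ g := by
  rintro rfl
  have hs := hT.slack.pick_three h.hp h.he h.he' h.hf h.ee' h.fe.symm h.fe'.symm h.pe h.pe' h.pf
  rw [edgeWeight_of_three h.e3, edgeWeight_of_three h.e3'] at hs
  have hu : ∀ k ∈ E.filter (p ∉ F ·), q ∉ F k := by
    intro k hk hqk
    simp only [Finset.mem_filter] at hk
    rcases h.symm.edge_eq hT hk.1 hqk with rfl | rfl | rfl
    · exact hk.2 h.pe
    · exact hk.2 h.pe'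
    · exact hk.2 h.pf
  have := (hs.drop (by simp [h.hq, h.pq.symm]) hu).nonneg ((hT.sized.pick p).drop hu)
  have := edgeWeight_nonneg (F := F) (X := X) f
  omega

theorem qf (h : Block F X E p q e e' f g) (hT : Tight F X E) : q ∉ F f := by
  intro hqf
  rcases h.symm.edge_eq hT h.hf hqf with hh | hh | hh
  · exact h.fe hh
  · exact h.fe' hh
  · exact h.ne hT hh

theorem exists_of_two (h : Block F X E p q e e' f g) (hT : Tight F X E)
    (hf2 : (F f ∩ X).card = 2) :
    (F g ∩ X).card = 2 ∧ ∃ r ∈ X, r ≠ p ∧ r ≠ q ∧ r ∈ F f ∧ r ∈ F g ∧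
      ∀ k ∈ E, r ∈ F k → k = f ∨ k = g := by
  have hpg := h.symm.qf hT
  have hK := hT.pick_three h.hp h.hf h.he h.he' h.pf h.pe h.pe' h.fe h.fe' h.ee' hf2
  have hq' : q ∈ X.erase p := by simp [h.hq, h.pq.symm]
  have hg' : g ∈ E.filter (p ∉ F ·) := by simp [h.hg, hpg]
  have hq1 : ∀ k ∈ E.filter (p ∉ F ·), q ∈ F k → k = g := by
    intro k hk hqk
    simp only [Finset.mem_filter] at hk
    rcases h.symm.edge_eq hT hk.1 hqk with rfl | rfl | rfl
    · exact absurd h.pe hk.2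
    · exact absurd h.pe' hk.2
    · rfl
  have hg2 := hK.card_eq_two_of_unique hq' hg' h.qg hq1
  rw [inter_erase_eq hpg] at hg2
  refine ⟨hg2, ?_⟩
  obtain ⟨r, hr, hrg, hqr, hall⟩ := Sized.exists_other hg2 h.hq h.qg
  have hrp : r ≠ p := fun hh => hpg (hh ▸ hrg)
  have hr1 : ∀ k ∈ E, r ∈ F k → p ∉ F k → k = g := fun k hk hrk hpk =>
    hK.unique_of_unique hq' hg' h.qg hq1 (by simp [hr, hrp]) hrg (by simp [hk, hpk]) hrk
  have hr2 : ∀ k ∈ E, r ∈ F k → k = f ∨ k = g := by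
    intro k hk hrk
    by_cases hpk : p ∈ F k
    · left
      have hno : ∀ l ∈ E, g ≠ l → q ∈ F l → r ∉ F l := fun l hl hgl hql hrl =>
        hT.not_subset h.hg hl hgl fun v hv hvg => by
          rcases hall v hv hvg with rfl | rfl <;> assumption
      rcases h.edge_eq hT hk hpk with rfl | rfl | rfl
      · exact absurd hrk (hno _ hk h.ge h.qe)
      · exact absurd hrk (hno _ hk h.ge' h.qe')
      · rfl
    · exact .inr (hr1 k hk hrk hpk)
  have hrf : r ∈ F f := by
    by_contra hrf
    exact h.ge (hT.unique_of_unique hr h.hg hrg (fun k hk hrk => (hr2 k hk hrk).resolve_left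
      fun hh => hrf (hh ▸ hrk)) h.hq h.qg h.he h.qe).symm
  exact ⟨r, hr, hrp, hqr.symm, hrf, hrg, hr2⟩

theorem shrink (h : Block F X E p q e e' f g) (hT : Tight F X E)
    (hf3 : (F f ∩ X).card = 3) (hg3 : (F g ∩ X).card = 3) {c d : α} (hc : c ∈ X) (hd : d ∈ X)
    (hcg : c ∈ F g) (hdg : d ∈ F g) (hqc : q ≠ c) (hqd : q ≠ d) (hcd : c ≠ d) :
    ShrinkEdge F X E p q c d g := by
  have hpg := h.symm.qf hT
  have hs := hT.slack.pick_three h.hp h.he h.he' h.hf h.ee' h.fe.symm h.fe'.symm h.pe h.pe' h.pf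
  rw [edgeWeight_of_three h.e3, edgeWeight_of_three h.e3', edgeWeight_of_three hf3] at hs
  have hq' : q ∈ X.erase p := by simp [h.hq, h.pq.symm]
  have hg' : g ∈ E.filter (p ∉ F ·) := by simp [h.hg, hpg]
  have hq1 : ∀ k ∈ E.filter (p ∉ F ·), q ∈ F k → k = g := by
    intro k hk hqk
    simp only [Finset.mem_filter] at hk
    rcases h.symm.edge_eq hT hk.1 hqk with rfl | rfl | rfl
    · exact absurd h.pe hk.2
    · exact absurd h.pe' hk.2
    · rfl
  have hg3' : (F g ∩ X.erase p).card = 3 := by rw [inter_erase_eq hpg, hg3]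
  exact ⟨hT, ⟨(hT.sized.pick p).drop_one hq' hq1 hg3', hT.degree_mono
    ((Finset.erase_subset _ _).trans (Finset.erase_subset _ _)) (Finset.filter_subset _ _),
      (hs.drop_one hq' hg' h.qg hq1 hg3').mono (by norm_num)⟩, h.hp, h.hq, hc, hd, h.hg,
    h.pq.symm, hqc, hqd, hcd, hpg, h.qg, hcg, hdg, hg3, fun k hk hpk hqk =>
      hq1 k (by simp [hk, hpk]) hqk⟩

theorem false_of_third (h : Block F X E p q e e' f g) (hT : Tight F X E) {x y : α} {k : β}
    (hx : x ∈ X) (hy : y ∈ X) (hk : k ∈ E) (hxe : x ∈ F e) (hxg : x ∈ F g) (hxk : x ∈ F k)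
    (hkg : k ≠ g) (hke : k ≠ e) (hye' : y ∈ F e') (hyf : y ∈ F f) (hxe' : x ∉ F e')
    (hxf : x ∉ F f) (hyp : y ≠ p) : False := by
  have hqf := h.qf hT
  have hxy : x ≠ y := fun hh => hxf (hh ▸ hyf)
  have hxp : x ≠ p := fun hh => hxf (hh ▸ h.pf)
  have hxq : x ≠ q := fun hh => hxe' (hh ▸ h.qe')
  have hyq : y ≠ q := fun hh => hqf (hh ▸ hyf)
  have hs := hT.slack.pick_three hx h.he h.hg hk h.ge.symm hke.symm hkg.symm hxe hxg hxk
  have hz := hT.sized.pick x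
  have hs2 := hs.pick_two (x := y) (e := e') (f := f) (by simp [hy, hxy.symm])
    (by simp [h.he', hxe']) (by simp [h.hf, hxf]) h.fe'.symm hye' hyf
  have hz2 := hz.pick y
  have hu : ∀ l ∈ (E.filter (x ∉ F ·)).filter (y ∉ F ·), p ∉ F l := by
    intro l hl hpl
    simp only [Finset.mem_filter] at hl
    rcases h.edge_eq hT hl.1.1 hpl with rfl | rfl | rfl
    · exact hl.1.2 hxe
    · exact hl.2 hye'
    · exact hl.2 hyf
  have hu' : ∀ l ∈ (E.filter (x ∉ F ·)).filter (y ∉ F ·), q ∉ F l := by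
    intro l hl hpl
    simp only [Finset.mem_filter] at hl
    rcases h.symm.edge_eq hT hl.1.1 hpl with rfl | rfl | rfl
    · exact hl.1.2 hxe
    · exact hl.2 hye'
    · exact hl.1.2 hxg
  have hs3 := hs2.drop (z := q) (by simp [h.hq, hxq.symm, hyq.symm]) hu'
  have h0 := edgeWeight_nonneg (F := F) (X := X) e
  have h1 := edgeWeight_nonneg (F := F) (X := X) g
  have h2 := edgeWeight_nonneg (F := F) (X := X) k
  have h3 := edgeWeight_nonneg (F := F) (X := X.erase x) e'
  have h4 := edgeWeight_nonneg (F := F) (X := X.erase x) f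
  have hs4 := hs3.drop (z := p) (by simp [h.hp, h.pq, hxp.symm, Ne.symm hyp]) hu
  have := hs4.nonneg ((hz2.drop hu').drop hu)
  omega

theorem mem_of_three (h : Block F X E p q e e' f g) (hT : Tight F X E) (hD : TwoInTwoEdge F X E)
    (hf3 : (F f ∩ X).card = 3) (hg3 : (F g ∩ X).card = 3) {c d : α} (hc : c ∈ X) (hd : d ∈ X)
    (hcg : c ∈ F g) (hdg : d ∈ F g) (hqc : q ≠ c) (hqd : q ≠ d) (hcd : c ≠ d) :
    (c ∈ F f ∧ d ∈ F f) ∨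
    ((∃ l ∈ E, p ∈ F l ∧ c ∈ F l ∧ (∀ l' ∈ E, p ∈ F l' → c ∈ F l' → l' = l) ∧
        ∃ k ∈ E, p ∉ F k ∧ k ≠ g ∧ c ∈ F k) ∧
      ∃ l ∈ E, p ∈ F l ∧ d ∈ F l ∧ (∀ l' ∈ E, p ∈ F l' → d ∈ F l' → l' = l) ∧
        ∃ k ∈ E, p ∉ F k ∧ k ≠ g ∧ d ∈ F k) := by
  have hS := h.shrink hT hf3 hg3 hc hd hcg hdg hqc hqd hcd
  have hpg := h.symm.qf hT
  have hpc : p ≠ c := fun hh => hpg (hh ▸ hcg)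
  have hpd : p ≠ d := fun hh => hpg (hh ▸ hdg)
  obtain ⟨x, hx, hxe, hxp, hxq, hxall⟩ := NoNontailBelow.exists_third h.e3 h.hp h.hq h.pe h.qe h.pq
  obtain ⟨y, hy, hye, hyp, hyq, hyall⟩ := NoNontailBelow.exists_third h.e3' h.hp h.hq h.pe' h.qe' h.pq
  have hxy : x ≠ y := by
    rintro rfl
    exact hT.not_subset h.he h.he' h.ee' fun v hv hve => by
      rcases hxall v hv hve with rfl | rfl | rfl
      · exact h.pe'
      · exact h.qe'
      · exact hye
  have hno : ∀ v ∈ X, p ≠ v → q ≠ v → v ∈ F e → v ∈ F e' → False := by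
    intro v hv hpv hqv hve hve'
    have := hxall v hv hve
    have := hyall v hv hve'
    grind
  have key : ∀ v ∈ X, p ≠ v → q ≠ v → (∃ l ∈ E, ∃ l' ∈ E, l ≠ l' ∧ p ∈ F l ∧ v ∈ F l ∧ p ∈ F l' ∧
      v ∈ F l') → v ∈ F f := by
    rintro v hv hpv hqv ⟨l, hl, l', hl', hll, hpl, hvl, hpl', hvl'⟩
    rcases h.edge_eq hT hl hpl with rfl | rfl | rfl
    · rcases h.edge_eq hT hl' hpl' with rfl | rfl | rfl
      · contradiction
      · exact (hno v hv hpv hqv hvl hvl').elim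
      · exact hvl'
    · rcases h.edge_eq hT hl' hpl' with rfl | rfl | rfl
      · exact (hno v hv hpv hqv hvl' hvl).elim
      · contradiction
      · exact hvl'
    · exact hvl
  rcases hS.trichotomy hD (fun l hl hpl _ => by
      rcases h.edge_eq hT hl hpl with rfl | rfl | rfl
      · exact h.e3
      · exact h.e3'
      · exact hf3) with
    ⟨l, hl, hpl, hcl, hdl, -⟩ | ⟨h1, h2⟩ |
      ⟨⟨k, l, hl, hpl, hcl, hall, hk, hpk, hkg, hck⟩, ⟨k', l', hl', hpl', hdl, hall', hk', hpk', hkg',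
        hdk⟩⟩
  · left
    rcases h.edge_eq hT hl hpl with rfl | rfl | rfl
    · have := hxall c hc hcl
      have := hxall d hd hdl
      grind
    · have := hyall c hc hcl
      have := hyall d hd hdl
      grind
    · exact ⟨hcl, hdl⟩
  · exact .inl ⟨key c hc hpc hqc h1, key d hd hpd hqd h2⟩
  · refine .inr ⟨⟨l, hl, hpl, hcl, fun m hm hpm hcm => ?_, k, hk, hpk, hkg, hck⟩,
      ⟨l', hl', hpl', hdl, fun m hm hpm hcm => ?_, k', hk', hpk', hkg', hdk⟩⟩
    · rcases hall m hm hcm with rfl | rfl | rfl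
      · contradiction
      · contradiction
      · rfl
    · rcases hall' m hm hcm with rfl | rfl | rfl
      · contradiction
      · contradiction
      · rfl

theorem swap (h : Block F X E p q e e' f g) : Block F X E p q e' e f g :=
  ⟨h.hp, h.hq, h.he', h.he, h.hf, h.hg, h.pe', h.pe, h.qe', h.qe, h.pf, h.qg, h.pq, h.ee'.symm,
    h.fe', h.fe, h.ge', h.ge, h.e3', h.e3⟩

theorem mem_mem_of_place {A B : Finset α} {c d c' d' x y : α} (hcd' : c' ≠ d')
    (b3 : c' ∈ B → c' = c ∨ c' = d) (b4 : d' ∈ B → d' = c ∨ d' = d) (hc : c ∈ B) (hd : d ∈ B)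
    (hc' : c' ∈ A) (hd' : d' ∈ A) (h1 : x ∈ B → y ∈ A → x ∉ A → False)
    (h2 : y ∈ B → x ∈ A → y ∉ A → False)
    (a1 : (c = x ∧ c ∉ A) ∨ (c = y ∧ c ∉ A) ∨ c ∈ A)
    (a2 : (d = x ∧ d ∉ A) ∨ (d = y ∧ d ∉ A) ∨ d ∈ A)
    (a3 : (c' = x ∧ c' ∉ B) ∨ (c' = y ∧ c' ∉ B) ∨ c' ∈ B)
    (a4 : (d' = x ∧ d' ∉ B) ∨ (d' = y ∧ d' ∉ B) ∨ d' ∈ B) : c ∈ A ∧ d ∈ A := by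
  by_contra hno
  grind

set_option maxHeartbeats 1000000 in
theorem exists_of_three_of_covered (h : Block F X E p q e e' f g) (hT : Tight F X E)
    (hD : TwoInTwoEdge F X E) (hf3 : (F f ∩ X).card = 3) (hg3 : (F g ∩ X).card = 3) {c d c' d' : α}
    (hc : c ∈ X) (hd : d ∈ X) (hcg : c ∈ F g) (hdg : d ∈ F g) (hqc : q ≠ c) (hqd : q ≠ d)
    (hcd : c ≠ d) (hall : ∀ v ∈ X, v ∈ F g → v = q ∨ v = c ∨ v = d)
    (hc' : c' ∈ X) (hd' : d' ∈ X) (hcf' : c' ∈ F f) (hdf' : d' ∈ F f) (hpc' : p ≠ c')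
    (hpd' : p ≠ d') (hcd' : c' ≠ d') (hall' : ∀ v ∈ X, v ∈ F f → v = p ∨ v = c' ∨ v = d') :
    c ∈ F f ∧ d ∈ F f := by
  have hpg := h.symm.qf hT
  have hqf := h.qf hT
  have hpc : p ≠ c := fun hh => hpg (hh ▸ hcg)
  have hpd : p ≠ d := fun hh => hpg (hh ▸ hdg)
  have hqc' : q ≠ c' := fun hh => hqf (hh ▸ hcf')
  have hqd' : q ≠ d' := fun hh => hqf (hh ▸ hdf')
  rcases h.mem_of_three hT hD hf3 hg3 hc hd hcg hdg hqc hqd hcd with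
    h1 | ⟨⟨l₁, hl₁, hp₁, hc₁, hu₁, k₁, hk₁, hpk₁, hkg₁, hck₁⟩,
      ⟨l₂, hl₂, hp₂, hc₂, hu₂, k₂, hk₂, hpk₂, hkg₂, hck₂⟩⟩
  · exact h1
  by_contra hgoal
  rcases h.symm.mem_of_three hT hD hg3 hf3 hc' hd' hcf' hdf' hpc' hpd' hcd' with
    ⟨h1, h2⟩ | ⟨⟨l₃, hl₃, hp₃, hc₃, hu₃, -⟩, ⟨l₄, hl₄, hp₄, hc₄, hu₄, -⟩⟩
  · have hcc := hall c' hc' h1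
    have hdd := hall d' hd' h2
    clear hT hD
    grind
  obtain ⟨x, hx, hxe, hxp, hxq, hxall⟩ := NoNontailBelow.exists_third h.e3 h.hp h.hq h.pe h.qe h.pq
  obtain ⟨y, hy, hye, hyp, hyq, hyall⟩ := NoNontailBelow.exists_third h.e3' h.hp h.hq h.pe' h.qe' h.pq
  have hxy : x ≠ y := by
    rintro rfl
    exact hT.not_subset h.he h.he' h.ee' fun v hv hve => by
      rcases hxall v hv hve with rfl | rfl | rfl
      · exact h.pe'
      · exact h.qe'
      · exact hye
  have hxe' : x ∉ F e' := fun hh => (hyall x hx hh).elim hxp fun hh => hh.elim hxq hxy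
  have hye' : y ∉ F e := fun hh => (hxall y hy hh).elim hyp fun hh => hh.elim hyq hxy.symm
  have H : ∀ v ∈ X, q ≠ v → v ∈ F g → ∃ k ∈ E, p ∉ F k ∧ k ≠ g ∧ v ∈ F k := by
    intro v hv hqv hvg
    rcases hall v hv hvg with rfl | rfl | rfl
    · contradiction
    · exact ⟨k₁, hk₁, hpk₁, hkg₁, hck₁⟩
    · exact ⟨k₂, hk₂, hpk₂, hkg₂, hck₂⟩
  have H1 : x ∈ F g → y ∈ F f → x ∉ F f → False := fun hxg hyf hxf => by
    obtain ⟨k, hk, hpk, hkg, hxk⟩ := H x hx hxq.symm hxg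
    exact h.false_of_third hT hx hy hk hxe hxg hxk hkg (fun hh => hpk (hh ▸ h.pe)) hye hyf hxe' hxf
      hyp
  have H2 : y ∈ F g → x ∈ F f → y ∉ F f → False := fun hxg hyf hxf => by
    obtain ⟨k, hk, hpk, hkg, hxk⟩ := H y hy hyq.symm hxg
    exact h.swap.false_of_third hT hy hx hk hye hxg hxk hkg (fun hh => hpk (hh ▸ h.pe')) hxe hyf hye'
      hxf hxp
  have place : ∀ v ∈ X, p ≠ v → q ≠ v → ∀ l ∈ E, p ∈ F l → v ∈ F l →
      (∀ l' ∈ E, p ∈ F l' → v ∈ F l' → l' = l) →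
      (v = x ∧ v ∉ F f) ∨ (v = y ∧ v ∉ F f) ∨ v ∈ F f := by
    intro v hv hpv hqv l hl hpl hvl hu
    by_cases hvf : v ∈ F f
    · exact .inr (.inr hvf)
    rcases h.edge_eq hT hl hpl with rfl | rfl | rfl
    · exact .inl ⟨((hxall v hv hvl).resolve_left hpv.symm).resolve_left hqv.symm, hvf⟩
    · exact .inr (.inl ⟨((hyall v hv hvl).resolve_left hpv.symm).resolve_left hqv.symm, hvf⟩)
    · contradiction
  have place' : ∀ v ∈ X, p ≠ v → q ≠ v → ∀ l ∈ E, q ∈ F l → v ∈ F l →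
      (∀ l' ∈ E, q ∈ F l' → v ∈ F l' → l' = l) →
      (v = x ∧ v ∉ F g) ∨ (v = y ∧ v ∉ F g) ∨ v ∈ F g := by
    intro v hv hpv hqv l hl hpl hvl hu
    by_cases hvf : v ∈ F g
    · exact .inr (.inr hvf)
    rcases h.symm.edge_eq hT hl hpl with rfl | rfl | rfl
    · exact .inl ⟨((hxall v hv hvl).resolve_left hpv.symm).resolve_left hqv.symm, hvf⟩
    · exact .inr (.inl ⟨((hyall v hv hvl).resolve_left hpv.symm).resolve_left hqv.symm, hvf⟩)
    · contradiction
  have a1 := place c hc hpc hqc l₁ hl₁ hp₁ hc₁ hu₁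
  have a2 := place d hd hpd hqd l₂ hl₂ hp₂ hc₂ hu₂
  have a3 := place' c' hc' hpc' hqc' l₃ hl₃ hp₃ hc₃ hu₃
  have a4 := place' d' hd' hpd' hqd' l₄ hl₄ hp₄ hc₄ hu₄
  have b3 := hall c' hc'
  have b4 := hall d' hd'
  exact hgoal (mem_mem_of_place hcd' (fun h => (b3 h).resolve_left hqc'.symm)
    (fun h => (b4 h).resolve_left hqd'.symm) hcg hdg hcf' hdf' H1 H2 a1 a2 a3 a4)

theorem exists_of_three (h : Block F X E p q e e' f g) (hT : Tight F X E)
    (hD : TwoInTwoEdge F X E) (hf3 : (F f ∩ X).card = 3) (hg3 : (F g ∩ X).card = 3) :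
    ∃ c ∈ X, ∃ d ∈ X, c ≠ d ∧ c ≠ p ∧ c ≠ q ∧ d ≠ p ∧ d ≠ q ∧ c ∈ F f ∧ c ∈ F g ∧ d ∈ F f ∧
      d ∈ F g := by
  have hpg := h.symm.qf hT
  obtain ⟨c, d, hc, hd, hcg, hdg, hqc, hqd, hcd, hall⟩ := Sized.exists_others hg3 h.hq h.qg
  obtain ⟨c', d', hc', hd', hcf', hdf', hpc', hpd', hcd', hall'⟩ := Sized.exists_others hf3 h.hp h.pf
  obtain ⟨h1, h2⟩ := h.exists_of_three_of_covered hT hD hf3 hg3 hc hd hcg hdg hqc hqd hcd hall hc' hd' hcf'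
    hdf' hpc' hpd' hcd' hall'
  exact ⟨c, hc, d, hd, hcd, fun hh => hpg (hh ▸ hcg), hqc.symm, fun hh => hpg (hh ▸ hdg), hqd.symm,
    h1, hcg, h2, hdg⟩

end Block

end Hypergraph

section GraphBound

variable {V : Type*} [Fintype V] [DecidableEq V] {G : SimpleGraph V} [DecidableRel G.Adj]

/-- A set `S` in which every vertex of `G` has a neighbor. -/
def IsTotalDominating (G : SimpleGraph V) (S : Finset V) : Prop :=
  ∀ v, ∃ u ∈ S, G.Adj v u

/-- The weight `6 - d` of a vertex of degree `d ≤ 3`, and `3` for larger degrees. -/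
def degreeWeight (d : ℕ) : ℤ :=
  if d ≤ 1 then 5 else if d = 2 then 4 else 3

/-- The vertices are those of the `2`-corona of a `2`-regular graph: those of degree `3` are the
vertices of the regular graph, and those of degree `2` and `1` are on the pendant paths. -/
structure IsCorona (G : SimpleGraph V) [DecidableRel G.Adj] : Prop where
  three : ∀ x, G.degree x = 3 → ∃ p, G.Adj x p ∧ G.degree p = 2 ∧
    ∀ y, G.Adj x y → y = p ∨ G.degree y = 3
  two : ∀ p, G.degree p = 2 → ∃ x l, G.Adj p x ∧ G.Adj p l ∧ G.degree x = 3 ∧ G.degree l = 1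
  one : ∀ l, G.degree l = 1 → ∃ p, G.Adj l p ∧ G.degree p = 2
  all : ∀ v, G.degree v = 1 ∨ G.degree v = 2 ∨ G.degree v = 3

/-- A nonempty set of vertices containing all neighbors of its elements is everything. -/
theorem SimpleGraph.Connected.mem_of_closed (hconn : G.Connected) {A : Set V} {a : V} (ha : a ∈ A)
    (hA : ∀ u ∈ A, ∀ v, G.Adj u v → v ∈ A) (v : V) : v ∈ A := by
  obtain ⟨w⟩ := hconn.preconnected a v
  induction w with
  | nil => exact ha
  | cons h _ ih => exact ih (hA _ ha _ h)

theorem degree_eq_one_unique {l p q : V} (h : G.degree l = 1) (hp : G.Adj l p)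
    (hq : G.Adj l q) : p = q := by
  rw [← SimpleGraph.card_neighborFinset_eq_degree, Finset.card_eq_one] at h
  obtain ⟨a, ha⟩ := h
  rw [← SimpleGraph.mem_neighborFinset, ha, Finset.mem_singleton] at hp hq
  rw [hp, hq]

/-- The leaves of `G`. -/
def leaves (G : SimpleGraph V) [DecidableRel G.Adj] : Finset V := {v | G.degree v = 1}

theorem sum_card_neighborFinset_inter_leaves :
    ∑ v, (((G.neighborFinset v ∩ leaves G).card : ℕ) : ℤ) = (leaves G).card := by
  have h1 : ∀ v, (G.neighborFinset v ∩ leaves G) = (leaves G).filter (fun l => G.Adj v l) := by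
    intro v; ext; simp [and_comm]
  have h2 : ∑ v, ((leaves G).filter (fun l => G.Adj v l)).card
      = ∑ l ∈ leaves G, (Finset.univ.filter (fun v => G.Adj v l)).card :=
    Finset.sum_card_bipartiteAbove_eq_sum_card_bipartiteBelow _
  have h3 : ∑ l ∈ leaves G, (Finset.univ.filter (fun v => G.Adj v l)).card
      = ∑ l ∈ leaves G, 1 := by
    refine Finset.sum_congr rfl fun l hl => ?_
    have : Finset.univ.filter (fun v => G.Adj v l) = G.neighborFinset l := by
      ext; simp [G.adj_comm]
    rw [this, SimpleGraph.card_neighborFinset_eq_degree]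
    simpa [leaves] using hl
  simp_rw [h1]
  rw [← Nat.cast_sum, h2, h3]
  simp

/-- The support vertices, i.e. the neighbors of leaves. -/
def supports (G : SimpleGraph V) [DecidableRel G.Adj] : Finset V :=
  {v | (G.neighborFinset v ∩ leaves G).Nonempty}

theorem mem_supports {v : V} : v ∈ supports G ↔ ∃ l, G.Adj v l ∧ G.degree l = 1 := by
  simp [supports, leaves, Finset.Nonempty]

theorem two_le_degree_of_mem_supports (hconn : G.Connected) (hn : 3 ≤ Fintype.card V) {p : V}
    (hp : p ∈ supports G) : 2 ≤ G.degree p := by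
  obtain ⟨l, hpl, hl⟩ := mem_supports.1 hp
  have h0 : 0 < G.degree p := (G.degree_pos_iff_exists_adj p).2 ⟨l, hpl⟩
  by_contra hlt
  have h1 : G.degree p = 1 := by lia
  have : ∀ v, v ∈ ({p, l} : Set V) := hconn.mem_of_closed (a := p) (by simp) (by
    rintro u (rfl | rfl) v huv
    · right; exact degree_eq_one_unique h1 huv hpl
    · left; exact degree_eq_one_unique hl huv hpl.symm)
  have hle : (Finset.univ : Finset V).card ≤ ({p, l} : Finset V).card :=
    Finset.card_le_card fun v _ => by simpa using this v
  have := Finset.card_le_two (a := p) (b := l)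
  rw [Finset.card_univ] at hle
  lia

end GraphBound

section PendantBound

variable {V : Type*} [Fintype V] [DecidableEq V] {G : SimpleGraph V} [DecidableRel G.Adj]

/-- The vertices that are neither leaves nor supports. -/
def core (G : SimpleGraph V) [DecidableRel G.Adj] : Finset V := {v | v ∉ leaves G ∧ v ∉ supports G}

/-- The vertices without a neighbor among the supports. -/
def undominated (G : SimpleGraph V) [DecidableRel G.Adj] : Finset V :=
  {u | ∀ v, G.Adj u v → v ∉ supports G}

/-- The supports which have to be dominated and have only one inner neighbor. -/
def forcers (G : SimpleGraph V) [DecidableRel G.Adj] : Finset V :=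
  {p | p ∈ supports G ∧ p ∈ undominated G ∧ (G.neighborFinset p ∩ core G).card = 1}

/-- The unique inner neighbors of the vertices in `forcers G`. -/
def forced (G : SimpleGraph V) [DecidableRel G.Adj] : Finset V :=
  {x | x ∈ core G ∧ ∃ p ∈ forcers G, G.Adj p x}

/-- The undominated vertices without a neighbor in `forced G`. -/
def remaining (G : SimpleGraph V) [DecidableRel G.Adj] : Finset V :=
  {u | u ∈ undominated G ∧ ∀ x ∈ forced G, ¬ G.Adj u x}

theorem card_forced_le : (forced G).card ≤ (forcers G).card := by
  have : forced G ⊆ (forcers G).biUnion fun p => G.neighborFinset p ∩ core G := by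
    intro x hx
    simp only [forced, Finset.mem_filter, Finset.mem_univ, true_and] at hx
    obtain ⟨hx, p, hp, hpx⟩ := hx
    simp only [Finset.mem_biUnion, Finset.mem_inter, SimpleGraph.mem_neighborFinset]
    exact ⟨p, hp, hpx, hx⟩
  refine (Finset.card_le_card this).trans ((Finset.card_biUnion_le).trans ?_)
  rw [Finset.card_eq_sum_ones]
  refine Finset.sum_le_sum fun p hp => ?_
  simp only [forcers, Finset.mem_filter] at hp
  exact hp.2.2.2.le

theorem notMem_supports_of_leaf (hconn : G.Connected) (hn : 3 ≤ Fintype.card V) {l : V}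
    (hl : l ∈ leaves G) : l ∉ supports G := fun h => by
  have := two_le_degree_of_mem_supports hconn hn h
  simp [leaves] at hl
  lia

theorem notMem_undominated_of_leaf {l : V} (hl : l ∈ leaves G) : l ∉ undominated G := by
  intro hu
  simp only [undominated, Finset.mem_filter, Finset.mem_univ, true_and] at hu
  have hl' : G.degree l = 1 := by simpa [leaves] using hl
  obtain ⟨p, hp⟩ := (G.degree_pos_iff_exists_adj l).1 (by lia)
  exact hu p hp (mem_supports.2 ⟨l, hp.symm, hl'⟩)

/-- The neighbors of an undominated vertex are inner vertices or leaves. -/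
theorem degree_eq_of_undominated {u : V} (hu : u ∈ undominated G) :
    G.degree u = (G.neighborFinset u ∩ leaves G).card + (G.neighborFinset u ∩ core G).card := by
  rw [← SimpleGraph.card_neighborFinset_eq_degree, ← Finset.card_union_of_disjoint]
  · congr 1
    ext v
    simp only [Finset.mem_union, Finset.mem_inter, SimpleGraph.mem_neighborFinset, core,
      Finset.mem_filter, Finset.mem_univ, true_and, undominated] at hu ⊢
    constructor
    · intro h
      by_cases hv : v ∈ leaves G
      · exact Or.inl ⟨h, hv⟩
      · exact Or.inr ⟨h, hv, hu v h⟩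
    · rintro (h | h) <;> exact h.1
  · refine Finset.disjoint_left.2 fun v hv hv' => ?_
    simp [core] at hv hv'
    exact hv'.2.1 hv.2

theorem inter_inner_of_remaining {u : V} (hu : u ∈ remaining G) :
    G.neighborFinset u ∩ (core G \ forced G) = G.neighborFinset u ∩ core G := by
  ext v
  simp only [Finset.mem_inter, Finset.mem_sdiff, SimpleGraph.mem_neighborFinset]
  simp only [remaining, Finset.mem_filter] at hu
  exact ⟨fun h => ⟨h.1, h.2.1⟩, fun h => ⟨h.1, h.2, fun hf => hu.2.2 v hf h.1⟩⟩

/-- The edge sizes that occur when covering the remaining vertices. -/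
theorem two_le_of_remaining
    (hstar : ∀ p ∈ supports G, p ∈ undominated G → (G.neighborFinset p ∩ core G).Nonempty)
    (h0 : ∀ v, 0 < G.degree v) {u : V}
    (hu : u ∈ remaining G) : 2 ≤ (G.neighborFinset u ∩ (core G \ forced G)).card := by
  rw [inter_inner_of_remaining hu]
  have hu' : u ∈ undominated G := by simp only [remaining, Finset.mem_filter] at hu; exact hu.2.1
  have hd := degree_eq_of_undominated hu'
  by_cases hp : u ∈ supports G
  · have h1 := (hstar u hp hu').card_pos
    by_contra hlt
    have h1 : (G.neighborFinset u ∩ core G).card = 1 := by lia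
    have hq : u ∈ forcers G := by simp [forcers, hp, hu', h1]
    obtain ⟨x, hx⟩ := Finset.card_eq_one.1 h1
    have hx' : x ∈ G.neighborFinset u ∩ core G := by simp [hx]
    simp only [Finset.mem_inter, SimpleGraph.mem_neighborFinset] at hx'
    simp only [remaining, Finset.mem_filter] at hu
    refine hu.2.2 x ?_ hx'.1
    simp only [forced, Finset.mem_filter, Finset.mem_univ, true_and]
    exact ⟨hx'.2, u, hq, hx'.1⟩
  · have hl : (G.neighborFinset u ∩ leaves G).card = 0 := by
      simpa [supports, Finset.not_nonempty_iff_eq_empty] using hp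
    have hu1 : u ∉ leaves G := fun h => notMem_undominated_of_leaf h hu'
    have hu1 : G.degree u ≠ 1 := by simpa [leaves] using hu1
    have := h0 u
    lia

/-- The share of a vertex in the size of the total dominating set. -/
def share (G : SimpleGraph V) [DecidableRel G.Adj] (v : V) : ℤ :=
  (if v ∈ supports G then 6 else 0) + (if v ∈ forcers G then 3 else 0) +
  (if v ∈ core G then 2 else 0) + (if v ∈ forced G then 1 else 0) +
  if v ∈ remaining G then edgeWeight (G.neighborFinset ·) (core G \ forced G) v else 0

/-- The weight of a vertex after it has received the weights of the adjacent leaves. -/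
def charge (G : SimpleGraph V) [DecidableRel G.Adj] (v : V) : ℤ :=
  degreeWeight (G.degree v) - (if v ∈ leaves G then 5 else 0) +
    5 * (G.neighborFinset v ∩ leaves G).card

theorem sum_charge : ∑ v, charge G v = ∑ v, degreeWeight (G.degree v) := by
  simp only [charge, Finset.sum_add_distrib, Finset.sum_sub_distrib, ← Finset.mul_sum,
    sum_card_neighborFinset_inter_leaves]
  simp
  ring

theorem share_le_charge (hconn : G.Connected) (hn : 3 ≤ Fintype.card V)
    (h0 : ∀ v, 0 < G.degree v)
    (hstar : ∀ p ∈ supports G, p ∈ undominated G → (G.neighborFinset p ∩ core G).Nonempty)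
    (v : V) : share G v ≤ charge G v ∧ (share G v = charge G v →
      v ∈ leaves G ∨ 
      (v ∈ forcers G ∧ G.degree v = 2 ∧ (G.neighborFinset v ∩ leaves G).card = 1) ∨
      (v ∈ supports G ∧ v ∈ remaining G) ∨
      (v ∈ forced G ∧ v ∈ core G ∧ 3 ≤ G.degree v) ∨
      (v ∈ remaining G ∧ v ∈ core G)) := by
  have hrem : v ∈ remaining G → v ∈ undominated G := fun h => by
    simp only [remaining, Finset.mem_filter] at h; exact h.2.1
  have hforced : v ∈ forced G → v ∈ core G ∧ v ∉ undominated G := fun h => by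
    simp only [forced, forcers, undominated, Finset.mem_filter, Finset.mem_univ, true_and] at h ⊢
    obtain ⟨h1, p, ⟨hp, -⟩, hpv⟩ := h
    exact ⟨h1, fun h => h p hpv.symm hp⟩
  have hforcers : v ∈ forcers G →
      v ∈ supports G ∧ v ∈ undominated G ∧ (G.neighborFinset v ∩ core G).card = 1 := fun h => by
    simpa only [forcers, Finset.mem_filter, Finset.mem_univ, true_and] using h
  have hd := degree_eq_of_undominated (G := G) (u := v)
  have h2 := two_le_of_remaining hstar h0 (u := v)
  have hinter := inter_inner_of_remaining (G := G) (u := v)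
  have hv0 := h0 v
  by_cases hl : v ∈ leaves G
  · have h1 : G.degree v = 1 := by simpa [leaves] using hl
    have hs := notMem_supports_of_leaf hconn hn hl
    have hu := notMem_undominated_of_leaf hl
    have hi : v ∉ core G := by simp [core, hl]
    have hz : G.neighborFinset v ∩ leaves G = ∅ := by
      simpa [supports, Finset.not_nonempty_iff_eq_empty] using hs
    have e1 : v ∉ forcers G := fun h => hs (hforcers h).1
    have e2 : v ∉ forced G := fun h => hi (hforced h).1
    have e3 : v ∉ remaining G := fun h => hu (hrem h)
    simp [share, charge, hl, hs, e1, e2, e3, hi, hz, h1, degreeWeight]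
  · have h1 : G.degree v ≠ 1 := by simpa [leaves] using hl
    by_cases hs : v ∈ supports G
    · have hi : v ∉ core G := by simp [core, hs]
      have e2 : v ∉ forced G := fun h => hi (hforced h).1
      have hpos : 0 < (G.neighborFinset v ∩ leaves G).card := by
        rw [Finset.card_pos]; simpa [supports] using hs
      by_cases hq : v ∈ forcers G
      · obtain ⟨-, hu, hc⟩ := hforcers hq
        have e3 : v ∉ remaining G := fun h => by
          have := h2 h; rw [hinter h] at this; lia
        have := hd hu
        simp only [share, charge, hl, hs, hq, e2, e3, hi, if_true, if_false, degreeWeight]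
        constructor
        · split_ifs <;> lia
        · intro h
          refine Or.inr (Or.inl ⟨trivial, ?_⟩)
          split_ifs at h <;> lia
      · by_cases hr : v ∈ remaining G
        · have := hd (hrem hr)
          have h3 := h2 hr
          have h4 : edgeWeight (G.neighborFinset ·) (core G \ forced G) v ≤ 2 := by
            simp only [edgeWeight]; split_ifs <;> simp
          rw [hinter hr] at h3
          simp only [share, charge, hl, hs, hq, e2, hr, hi, if_true, if_false, degreeWeight]
          constructor
          · split_ifs <;> lia
          · simp
        · simp only [share, charge, hl, hs, hq, e2, hr, hi, if_true, if_false, degreeWeight]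
          constructor
          · split_ifs <;> lia
          · intro h; exfalso; split_ifs at h <;> lia
    · have hi : v ∈ core G := by simp [core, hs, hl]
      have e1 : v ∉ forcers G := fun h => hs (hforcers h).1
      have hz : G.neighborFinset v ∩ leaves G = ∅ := by
        simpa [supports, Finset.not_nonempty_iff_eq_empty] using hs
      by_cases hf : v ∈ forced G
      · have e3 : v ∉ remaining G := fun h => (hforced hf).2 (hrem h)
        simp only [share, charge, hl, hs, e1, hf, e3, hi, if_true, if_false, degreeWeight, hz]
        constructor
        · split_ifs
          all_goals simp
        · intro h
          refine Or.inr (Or.inr (Or.inr (Or.inl ⟨trivial, trivial, ?_⟩)))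
          split_ifs at h with h5 h6 <;> simp at h
          lia
      · by_cases hr : v ∈ remaining G
        · have h5 := hd (hrem hr)
          simp only [share, charge, hl, hs, e1, hf, hr, hi, if_true, if_false, degreeWeight, hz,
            edgeWeight, hinter hr]
          rw [hz] at h5
          constructor
          · (split_ifs; all_goals simp at *; all_goals lia)
          · simp
        · simp only [share, charge, hl, hs, e1, hf, hr, hi, if_true, if_false, degreeWeight, hz]
          constructor
          · split_ifs <;> simp
          · intro h; exfalso; split_ifs at h <;> simp at h

theorem sum_share : ∑ v, share G v = 6 * (supports G).card + 3 * (forcers G).card +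
    2 * (core G).card + (forced G).card +
      ∑ e ∈ remaining G, edgeWeight (G.neighborFinset ·) (core G \ forced G) e := by
  simp only [share, Finset.sum_add_distrib]
  simp [Finset.sum_ite_mem]
  ring

/-- The total dominating set obtained from the supports. -/
theorem exists_isTotalDominating (h0 : ∀ v, 0 < G.degree v)
    (hstar : ∀ p ∈ supports G, p ∈ undominated G → (G.neighborFinset p ∩ core G).Nonempty) :
    ∃ S, IsTotalDominating G S ∧
      6 * (S.card : ℤ) + 3 * ((forcers G).card - (forced G).card) ≤ ∑ v, share G v := by
  obtain ⟨S, hS, hc⟩ := exists_cover_of_two_le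
    (F := (G.neighborFinset ·)) (X := core G \ forced G) (E := remaining G)
    fun e he => two_le_of_remaining hstar h0 he
  refine ⟨supports G ∪ forced G ∪ S, ?_, ?_⟩
  · intro v
    by_cases hu : v ∈ undominated G
    · by_cases hr : v ∈ remaining G
      · obtain ⟨x, hx, hxv⟩ := hS.2 v hr
        exact ⟨x, by simp [hx], by simpa using hxv⟩
      · simp [remaining, hu] at hr
        obtain ⟨x, hx, hvx⟩ := hr
        exact ⟨x, by simp [hx], hvx⟩
    · simp [undominated] at hu
      obtain ⟨x, hvx, hx⟩ := hu
      exact ⟨x, by simp [hx], hvx⟩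
  · have h1 : ((supports G ∪ forced G ∪ S).card : ℤ) ≤
        (supports G).card + (forced G).card + S.card := by
      exact_mod_cast (Finset.card_union_le _ _).trans
        (Nat.add_le_add_right (Finset.card_union_le _ _) _)
    have h2 : forced G ⊆ core G := fun v hv => by
      simp only [forced, Finset.mem_filter] at hv; exact hv.2.1
    have h3 := Finset.card_sdiff_add_card_eq_card h2
    rw [sum_share]
    push_cast [← h3] at hc ⊢
    linarith

/-- In a star the center and one leaf form a total dominating set. -/
theorem exists_isTotalDominating_of_star (hconn : G.Connected) (hn : 3 ≤ Fintype.card V) {p : V}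
    (hp : p ∈ supports G) (hu : p ∈ undominated G)
    (he : ¬ (G.neighborFinset p ∩ core G).Nonempty) :
    ∃ S, IsTotalDominating G S ∧ 6 * (S.card : ℤ) < ∑ v, degreeWeight (G.degree v) := by
  obtain ⟨l, hpl, hl⟩ := mem_supports.1 hp
  have hd := degree_eq_of_undominated hu
  rw [Finset.not_nonempty_iff_eq_empty.1 he, Finset.card_empty, add_zero,
    ← SimpleGraph.card_neighborFinset_eq_degree] at hd
  have hsub : G.neighborFinset p ⊆ leaves G := by
    have := Finset.eq_of_subset_of_card_le
      (Finset.inter_subset_left (s₁ := G.neighborFinset p) (s₂ := leaves G)) hd.le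
    exact Finset.inter_eq_left.1 this
  have hleaf : ∀ v, G.Adj p v → G.degree v = 1 := fun v hv => by
    have := hsub ((G.mem_neighborFinset p v).2 hv)
    simpa [leaves] using this
  have hall : ∀ v, v = p ∨ G.Adj p v := hconn.mem_of_closed (A := {v | v = p ∨ G.Adj p v})
    (a := p) (by simp) (by
      rintro u (rfl | hpu) v huv
      · exact Or.inr huv
      · exact Or.inl (degree_eq_one_unique (hleaf u hpu) huv hpu.symm))
  refine ⟨{p, l}, fun v => ?_, ?_⟩
  · rcases hall v with rfl | h
    · exact ⟨l, by simp, hpl⟩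
    · exact ⟨p, by simp, h.symm⟩
  · have h2 : 6 * (({p, l} : Finset V).card : ℤ) ≤ 12 := by
      have := Finset.card_le_two (a := p) (b := l)
      lia
    have h3 : (3 : ℤ) + 5 * (Fintype.card V - 1 : ℤ) ≤ ∑ v, degreeWeight (G.degree v) := by
      rw [← Finset.add_sum_erase _ _ (Finset.mem_univ p)]
      have h4 : ∀ v ∈ Finset.univ.erase p, degreeWeight (G.degree v) = 5 := fun v hv => by
        rcases hall v with rfl | h
        · simp at hv
        · simp [hleaf v h, degreeWeight]
      rw [Finset.sum_congr rfl h4, Finset.sum_const, Finset.card_erase_of_mem (Finset.mem_univ p),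
        Finset.card_univ]
      have h5 : 3 ≤ degreeWeight (G.degree p) := by simp only [degreeWeight]; split_ifs <;> simp
      rw [nsmul_eq_mul, Nat.cast_sub (by lia)]
      push_cast
      linarith
    lia

theorem degree_pos_of_connected (hconn : G.Connected) (hn : 3 ≤ Fintype.card V) (v : V) :
    0 < G.degree v := by
  have : Nontrivial V := Fintype.one_lt_card_iff_nontrivial.1 (by lia)
  exact hconn.preconnected.degree_pos_of_nontrivial v

theorem exists_isTotalDominating_le (hconn : G.Connected) (hn : 3 ≤ Fintype.card V) :
    ∃ S, IsTotalDominating G S ∧ 6 * (S.card : ℤ) ≤ ∑ v, degreeWeight (G.degree v) := by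
  have h0 := degree_pos_of_connected hconn hn
  by_cases hstar : ∀ p ∈ supports G, p ∈ undominated G → (G.neighborFinset p ∩ core G).Nonempty
  · obtain ⟨S, hS, hc⟩ := exists_isTotalDominating h0 hstar
    refine ⟨S, hS, ?_⟩
    have h1 : ∑ v, share G v ≤ ∑ v, charge G v :=
      Finset.sum_le_sum fun v _ => (share_le_charge hconn hn h0 hstar v).1
    rw [sum_charge] at h1
    have h2 := card_forced_le (G := G)
    lia
  · push Not at hstar
    obtain ⟨p, hp, hu, he⟩ := hstar
    obtain ⟨S, hS, hc⟩ := exists_isTotalDominating_of_star hconn hn hp hu (by simpa using he)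
    exact ⟨S, hS, hc.le⟩

theorem isCorona_of_le (hconn : G.Connected) (hn : 3 ≤ Fintype.card V)
    (hmin : ∀ S, IsTotalDominating G S → ∑ v, degreeWeight (G.degree v) ≤ 6 * (S.card : ℤ))
    (h3 : ∀ v, G.degree v ≤ 3) {l₀ : V} (hl₀ : G.degree l₀ = 1) : IsCorona G := by
  have h0 := degree_pos_of_connected hconn hn
  have hstar : ∀ p ∈ supports G, p ∈ undominated G →
      (G.neighborFinset p ∩ core G).Nonempty := by
    intro p hp hu
    by_contra he
    obtain ⟨S, hS, hc⟩ := exists_isTotalDominating_of_star hconn hn hp hu he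
    have := hmin S hS
    lia
  have hle := share_le_charge hconn hn h0 hstar
  obtain ⟨S, hS, hc⟩ := exists_isTotalDominating h0 hstar
  have hS' := hmin S hS
  have h1 : ∑ v, share G v ≤ ∑ v, charge G v := Finset.sum_le_sum fun v _ => (hle v).1
  have hfc := card_forced_le (G := G)
  have heq : ∑ v, share G v = ∑ v, charge G v := by rw [sum_charge] at h1 ⊢; lia
  have hcard : (forced G).card = (forcers G).card := by rw [sum_charge] at h1; lia
  have hpt : ∀ v, share G v = charge G v := fun v =>
    (Finset.sum_eq_sum_iff_of_le fun v _ => (hle v).1).1 heq v (Finset.mem_univ v)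
  have hcls := fun v => (hle v).2 (hpt v)
  -- membership facts
  have hrem : ∀ v, v ∈ remaining G → v ∈ undominated G ∧ ∀ x ∈ forced G, ¬ G.Adj v x := fun v h => by
    simpa only [remaining, Finset.mem_filter, Finset.mem_univ, true_and] using h
  have hund : ∀ v, v ∈ undominated G → ∀ y, G.Adj v y → y ∉ supports G := fun v h => by
    simpa only [undominated, Finset.mem_filter, Finset.mem_univ, true_and] using h
  have hforced : ∀ v, v ∈ forced G ↔ v ∈ core G ∧ ∃ p ∈ forcers G, G.Adj p v := fun v => by
    simp only [forced, Finset.mem_filter, Finset.mem_univ, true_and]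
  have hforcers : ∀ v, v ∈ forcers G →
      v ∈ supports G ∧ v ∈ undominated G ∧ (G.neighborFinset v ∩ core G).card = 1 := fun v h => by
    simpa only [forcers, Finset.mem_filter, Finset.mem_univ, true_and] using h
  have hcore : ∀ v, v ∈ core G ↔ v ∉ leaves G ∧ v ∉ supports G := fun v => by
    simp only [core, Finset.mem_filter, Finset.mem_univ, true_and]
  have hleaves : ∀ v, v ∈ leaves G ↔ G.degree v = 1 := fun v => by simp [leaves]
  have hlsup : ∀ v, v ∈ leaves G → v ∉ supports G := fun v => notMem_supports_of_leaf hconn hn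
  have hlund : ∀ v, v ∈ leaves G → v ∉ undominated G := fun v => notMem_undominated_of_leaf
  have hlnb : ∀ l v, l ∈ leaves G → G.Adj l v → v ∈ supports G := fun l v hl h =>
    mem_supports.2 ⟨l, h.symm, (hleaves l).1 hl⟩
  have hcorenb : ∀ v y, v ∈ core G → G.Adj v y → y ∉ leaves G := fun v y hv h hy =>
    ((hcore v).1 hv).2 (hlnb y v hy h.symm)
  -- no support is a remaining vertex
  have hsr : ∀ v, v ∈ supports G → v ∉ remaining G := fun v hv hr => by
    have h2 := two_le_of_remaining hstar h0 hr
    obtain ⟨x, hx⟩ := Finset.card_pos.1 (by lia :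
      0 < (G.neighborFinset v ∩ (core G \ forced G)).card)
    simp only [Finset.mem_inter, SimpleGraph.mem_neighborFinset, Finset.mem_sdiff] at hx
    obtain ⟨hvx, hxc, hxf⟩ := hx
    have hc := (hcore x).1 hxc
    rcases hcls x with h | ⟨h, -⟩ | ⟨h, -⟩ | ⟨h, -⟩ | ⟨h, -⟩
    · exact hc.1 h
    · exact hc.2 (hforcers x h).1
    · exact hc.2 h
    · exact hxf h
    · exact hund x (hrem x h).1 v hvx.symm hv
  -- every vertex is a leaf, a forcer or forced
  have hcls' : ∀ v, v ∈ leaves G ∨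
      (v ∈ forcers G ∧ G.degree v = 2 ∧ (G.neighborFinset v ∩ leaves G).card = 1) ∨
      (v ∈ forced G ∧ G.degree v = 3) := by
    have hcl : ∀ v, ¬ (v ∈ remaining G ∧ v ∈ core G) := by
      intro v hv
      obtain ⟨q, hq⟩ := (G.degree_pos_iff_exists_adj l₀).1 (by lia)
      have := hconn.mem_of_closed (A := {v | v ∈ remaining G ∧ v ∈ core G}) hv (by
        rintro u ⟨hu, huc⟩ y huy
        have hys := hund u (hrem u hu).1 y huy
        rcases hcls y with h | ⟨h, -⟩ | ⟨h, -⟩ | ⟨h, -⟩ | h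
        · exact absurd h (hcorenb u y huc huy)
        · exact absurd (hforcers y h).1 hys
        · exact absurd h hys
        · exact absurd huy ((hrem u hu).2 y h)
        · exact h) l₀
      exact ((hcore l₀).1 this.2).1 ((hleaves l₀).2 hl₀)
    intro v
    rcases hcls v with h | h | ⟨h, h'⟩ | ⟨h, -, h'⟩ | h
    · exact Or.inl h
    · exact Or.inr (Or.inl h)
    · exact absurd h' (hsr v h)
    · exact Or.inr (Or.inr ⟨h, le_antisymm (h3 v) h'⟩)
    · exact absurd h (hcl v)
  have hQ : ∀ v, G.degree v = 2 → v ∈ forcers G ∧ (G.neighborFinset v ∩ leaves G).card = 1 := by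
    intro v hv
    rcases hcls' v with h | h | h
    · rw [hleaves] at h; lia
    · exact ⟨h.1, h.2.2⟩
    · lia
  have hQ' : ∀ v, v ∈ forcers G → G.degree v = 2 := by
    intro v hv
    have hs := (hforcers v hv).1
    rcases hcls' v with h | h | h
    · exact absurd hs (hlsup v h)
    · exact h.2.1
    · exact absurd hs ((hcore v).1 ((hforced v).1 h.1).1).2
  have hX : ∀ v, G.degree v = 3 → v ∈ forced G := by
    intro v hv
    rcases hcls' v with h | h | h
    · rw [hleaves] at h; lia
    · lia
    · exact h.1
  have hX' : ∀ v, v ∈ forced G → G.degree v = 3 := by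
    intro v hv
    have hc := (hforced v).1 hv
    rcases hcls' v with h | h | h
    · exact absurd h ((hcore v).1 hc.1).1
    · exact absurd (hforcers v h.1).1 ((hcore v).1 hc.1).2
    · exact h.2
  refine ⟨?_, ?_, ?_, ?_⟩
  · intro x hx
    have hxf := hX x hx
    obtain ⟨hxc, p, hp, hpx⟩ := (hforced x).1 hxf
    refine ⟨p, hpx.symm, hQ' p hp, fun y hxy => ?_⟩
    rcases hcls' y with h | ⟨h, -⟩ | h
    · exact absurd h (hcorenb x y hxc hxy)
    · left
      -- the map from forced vertices to forcers is injective on forcers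
      have hch : ∀ q ∈ forcers G, ∃ z ∈ forced G, G.Adj q z := fun q hq => by
        obtain ⟨z, hz⟩ := Finset.card_eq_one.1 (hforcers q hq).2.2
        have hz' : z ∈ G.neighborFinset q ∩ core G := by simp [hz]
        simp only [Finset.mem_inter, SimpleGraph.mem_neighborFinset] at hz'
        exact ⟨z, (hforced z).2 ⟨hz'.2, q, hq, hz'.1⟩, hz'.1⟩
      have huq : ∀ q ∈ forcers G, ∀ z ∈ forced G, ∀ w ∈ forced G, G.Adj q z → G.Adj q w → z = w := by
        intro q hq z hz w hw hqz hqw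
        obtain ⟨t, ht⟩ := Finset.card_eq_one.1 (hforcers q hq).2.2
        have hz' : z ∈ G.neighborFinset q ∩ core G := by simp [hqz, ((hforced z).1 hz).1]
        have hw' : w ∈ G.neighborFinset q ∩ core G := by simp [hqw, ((hforced w).1 hw).1]
        rw [ht, Finset.mem_singleton] at hz' hw'
        rw [hz', hw']
      choose! φ hφ hφ' using hch
      have hinj := Finset.inj_on_of_surj_on_of_card_le (s := forcers G) (t := forced G)
        (fun q _ => φ q) (fun q hq => hφ q hq) (fun z hz => by
          obtain ⟨-, q, hq, hqz⟩ := (hforced z).1 hz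
          exact ⟨q, hq, (huq q hq _ (hφ q hq) z hz (hφ' q hq) hqz)⟩) hcard.ge
      exact hinj h hp (by
        rw [huq y h _ (hφ y h) x hxf (hφ' y h) hxy.symm, huq p hp _ (hφ p hp) x hxf (hφ' p hp) hpx])
    · exact Or.inr h.2
  · intro p hp
    obtain ⟨hq, hl⟩ := hQ p hp
    obtain ⟨z, hz⟩ := Finset.card_eq_one.1 (hforcers p hq).2.2
    have hz' : z ∈ G.neighborFinset p ∩ core G := by simp [hz]
    obtain ⟨l, hl⟩ := Finset.card_eq_one.1 hl
    have hl' : l ∈ G.neighborFinset p ∩ leaves G := by simp [hl]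
    simp only [Finset.mem_inter, SimpleGraph.mem_neighborFinset] at hz' hl'
    exact ⟨z, l, hz'.1, hl'.1, hX' z ((hforced z).2 ⟨hz'.2, p, hq, hz'.1⟩), (hleaves l).1 hl'.2⟩
  · intro l hl
    obtain ⟨p, hp⟩ := (G.degree_pos_iff_exists_adj l).1 (by lia)
    refine ⟨p, hp, ?_⟩
    have hps := hlnb l p ((hleaves l).2 hl) hp
    rcases hcls' p with h | h | h
    · exact absurd hps (hlsup p h)
    · exact h.2.1
    · exact absurd hps ((hcore p).1 ((hforced p).1 h.1).1).2
  · intro v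
    rcases hcls' v with h | h | h
    · exact Or.inl ((hleaves v).1 h)
    · exact Or.inr (Or.inl h.2.1)
    · exact Or.inr (Or.inr h.2)

end PendantBound

section Corona

variable {V : Type*} [Fintype V] [DecidableEq V] {G : SimpleGraph V} [DecidableRel G.Adj]

theorem exists_of_degree_three {x p : V} (h : G.degree x = 3) (hp : G.Adj x p) :
    ∃ y z, y ≠ z ∧ y ≠ p ∧ z ≠ p ∧ G.Adj x y ∧ G.Adj x z ∧
      ∀ w, G.Adj x w → w = p ∨ w = y ∨ w = z := by
  have h1 : ((G.neighborFinset x).erase p).card = 2 := by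
    rw [Finset.card_erase_of_mem (by simpa using hp), SimpleGraph.card_neighborFinset_eq_degree, h]
  obtain ⟨y, z, hyz, he⟩ := Finset.card_eq_two.1 h1
  have hm : ∀ w, (w ≠ p ∧ G.Adj x w) ↔ (w = y ∨ w = z) := fun w => by
    have : w ∈ (G.neighborFinset x).erase p ↔ w ∈ ({y, z} : Finset V) := by rw [he]
    simpa using this
  have hy := (hm y).2 (Or.inl rfl)
  have hz := (hm z).2 (Or.inr rfl)
  refine ⟨y, z, hyz, hy.1, hz.1, hy.2, hz.2, fun w hw => ?_⟩
  by_cases hwp : w = p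
  · exact Or.inl hwp
  · exact Or.inr ((hm w).1 ⟨hwp, hw⟩)

theorem exists_of_degree_two {x p : V} (h : G.degree x = 2) (hp : G.Adj x p) :
    ∃ y, y ≠ p ∧ G.Adj x y ∧ ∀ w, G.Adj x w → w = p ∨ w = y := by
  have h1 : ((G.neighborFinset x).erase p).card = 1 := by
    rw [Finset.card_erase_of_mem (by simpa using hp), SimpleGraph.card_neighborFinset_eq_degree, h]
  obtain ⟨y, he⟩ := Finset.card_eq_one.1 h1
  have hm : ∀ w, (w ≠ p ∧ G.Adj x w) ↔ w = y := fun w => by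
    have : w ∈ (G.neighborFinset x).erase p ↔ w ∈ ({y} : Finset V) := by rw [he]
    simpa using this
  have hy := (hm y).2 rfl
  refine ⟨y, hy.1, hy.2, fun w hw => ?_⟩
  by_cases hwp : w = p
  · exact Or.inl hwp
  · exact Or.inr ((hm w).1 ⟨hwp, hw⟩)

/-- An injective homomorphism to a connected graph which is surjective on neighborhoods is an
isomorphism. -/
theorem nonempty_iso_of_injective {W : Type*} [Nonempty W] {K : SimpleGraph W}
    (hconn : G.Connected) (f : W → V) (hf : Function.Injective f)
    (hK : ∀ w w', K.Adj w w' → G.Adj (f w) (f w'))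
    (hG : ∀ w v, G.Adj (f w) v → ∃ w', K.Adj w w' ∧ f w' = v) : Nonempty (G ≃g K) := by
  have hs : Function.Surjective f := fun v => by
    obtain ⟨w⟩ := ‹Nonempty W›
    have := hconn.mem_of_closed (A := Set.range f) (a := f w) ⟨w, rfl⟩ (by
      rintro _ ⟨u, rfl⟩ v huv
      obtain ⟨w', -, h⟩ := hG u v huv
      exact ⟨w', h⟩) v
    exact this
  refine ⟨(⟨Equiv.ofBijective f ⟨hf, hs⟩, fun {a b} => ⟨fun h => ?_, fun h => hK _ _ h⟩⟩ :
    K ≃g G).symm⟩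
  obtain ⟨w', h1, h2⟩ := hG a _ h
  rw [← hf h2]
  exact h1

/-- A property of natural numbers that can always be increased, unless some conclusion holds, and
is bounded, leads to the conclusion. -/
theorem of_extend {P : ℕ → Prop} {Q : Prop} (N : ℕ) (hN : ∀ k, P k → k ≤ N)
    (h : ∀ k, P k → Q ∨ P (k + 1)) {k : ℕ} (hk : P k) : Q := by
  induction hd : N + 1 - k generalizing k with
  | zero => have := hN k hk; lia
  | succ d ih =>
    rcases h k hk with hq | hq
    · exact hq
    · exact ih hq (by lia)

theorem le_card_of_injOn {k : ℕ} {a : ℕ → V} (h : ∀ i < k, ∀ j < k, a i = a j → i = j) :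
    k ≤ Fintype.card V := by
  have := Fintype.card_le_of_injective (fun i : Fin k => a i)
    fun i j hij => Fin.ext (h i i.2 j j.2 hij)
  simpa using this

/-- A `2`-regular induced subgraph contains a cycle. -/
theorem exists_cycle {A : Set V} {x₀ : V} (hx₀ : x₀ ∈ A)
    (hA : ∀ x ∈ A, ∃ y ∈ A, ∃ z ∈ A, y ≠ z ∧ G.Adj x y ∧ G.Adj x z ∧
      ∀ w ∈ A, G.Adj x w → w = y ∨ w = z) :
    ∃ k, 3 ≤ k ∧ ∃ a : ℕ → V, (∀ i < k, a i ∈ A) ∧ (∀ i < k, ∀ j < k, a i = a j → i = j) ∧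
      ∀ i < k, G.Adj (a i) (a ((i + 1) % k)) := by
  have hthree : ∀ x ∈ A, ∀ u ∈ A, ∀ v ∈ A, ∀ w ∈ A, G.Adj x u → G.Adj x v → G.Adj x w → u ≠ v →
      u ≠ w → v ≠ w → False := by
    intro x hx u hu v hv w hw h1 h2 h3 huv huw hvw
    obtain ⟨y, -, z, -, hyz, -, -, hall⟩ := hA x hx
    rcases hall u hu h1 with rfl | rfl <;> rcases hall v hv h2 with rfl | rfl <;>
      rcases hall w hw h3 with rfl | rfl <;> contradiction
  let P : ℕ → Prop := fun k => 2 ≤ k ∧ ∃ a : ℕ → V, (∀ i < k, a i ∈ A) ∧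
    (∀ i < k, ∀ j < k, a i = a j → i = j) ∧ ∀ i, i + 1 < k → G.Adj (a i) (a (i + 1))
  obtain ⟨y₀, hy₀, -, -, -, hxy, -⟩ := hA x₀ hx₀
  have hP : P 2 := by
    refine ⟨le_rfl, fun i => if i = 0 then x₀ else y₀, ?_, ?_, ?_⟩
    · intro i hi; simp only; split_ifs <;> assumption
    · intro i hi j hj h
      have := hxy.ne
      simp only at h
      split_ifs at h with h1 h2
      all_goals lia
    · intro i hi
      have : i = 0 := by lia
      subst this
      simpa using hxy
  refine of_extend (P := P) (Fintype.card V) (fun k ⟨_, a, _, h, _⟩ => le_card_of_injOn h) ?_ hP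
  rintro k ⟨hk, a, haA, hinj, hadj⟩
  have hprev : G.Adj (a (k - 1)) (a (k - 2)) := by
    have := hadj (k - 2) (by lia)
    rw [show k - 2 + 1 = k - 1 by lia] at this
    exact this.symm
  obtain ⟨z, hz, hlz, hzk⟩ : ∃ z ∈ A, G.Adj (a (k - 1)) z ∧ z ≠ a (k - 2) := by
    obtain ⟨y, hy, z, hz, hyz, h1, h2, -⟩ := hA _ (haA (k - 1) (by lia))
    by_cases h : y = a (k - 2)
    · exact ⟨z, hz, h2, fun h' => hyz (h.trans h'.symm)⟩
    · exact ⟨y, hy, h1, h⟩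
  by_cases hin : ∃ j < k, a j = z
  · left
    obtain ⟨j, hj, rfl⟩ := hin
    have hj0 : j = 0 := by
      by_contra hj0
      have hj1 : j ≠ k - 1 := fun h => by subst h; exact hlz.ne rfl
      have hj2 : j ≠ k - 2 := fun h => hzk (by rw [h])
      have h1 : G.Adj (a j) (a (j - 1)) := by
        have := hadj (j - 1) (by lia)
        rw [show j - 1 + 1 = j by lia] at this
        exact this.symm
      refine hthree (a j) (haA j hj) _ (haA (j - 1) (by lia)) _ (haA (j + 1) (by lia)) _
        (haA (k - 1) (by lia)) h1 (hadj j (by lia)) hlz.symm ?_ ?_ ?_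
      · intro h; have := hinj _ (by lia) _ (by lia) h; lia
      · intro h; have := hinj _ (by lia) _ (by lia) h; lia
      · intro h; have := hinj _ (by lia) _ (by lia) h; lia
    subst hj0
    refine ⟨k, ?_, a, haA, hinj, ?_⟩
    · by_contra hlt
      have : k = 2 := by lia
      subst this
      exact hzk rfl
    · intro i hi
      by_cases h : i + 1 < k
      · rw [Nat.mod_eq_of_lt h]; exact hadj i h
      · have h1 : i = k - 1 := by lia
        have h2 : i + 1 = k := by lia
        rw [h2, Nat.mod_self, h1]
        exact hlz
  · right
    push Not at hin
    refine ⟨by lia, fun i => if i < k then a i else z, ?_, ?_, ?_⟩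
    · intro i hi; simp only; split_ifs with h
      · exact haA i h
      · exact hz
    · intro i hi j hj h
      simp only at h
      split_ifs at h with h1 h2 h2
      · exact hinj i h1 j h2 h
      · exact absurd h (hin i h1)
      · exact absurd h.symm (hin j h2)
      · lia
    · intro i hi
      simp only
      rw [if_pos (by lia)]
      split_ifs with h
      · exact hadj i h
      · rw [show i = k - 1 by lia]; exact hlz

theorem IsCorona.exists_iso (hC : IsCorona G) (hconn : G.Connected) {x₀ : V}
    (hx₀ : G.degree x₀ = 3) : ∃ k, 3 ≤ k ∧ Nonempty (G ≃g coronaGraph k) := by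
  choose! p hp hp2 hpall using hC.three
  choose! x l hx hl hx3 hl1 using hC.two
  have hnb : ∀ v, G.degree v = 3 → ∃ y z, y ≠ z ∧ y ≠ p v ∧ z ≠ p v ∧ G.Adj v y ∧ G.Adj v z ∧
      (∀ w, G.Adj v w → w = p v ∨ w = y ∨ w = z) ∧ G.degree y = 3 ∧ G.degree z = 3 := by
    intro v hv
    obtain ⟨y, z, h1, h2, h3, h4, h5, h6⟩ := exists_of_degree_three hv (hp v hv)
    exact ⟨y, z, h1, h2, h3, h4, h5, h6, (hpall v hv y h4).resolve_left h2,
      (hpall v hv z h5).resolve_left h3⟩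
  obtain ⟨k, hk, a, haA, hinj, hadj⟩ := exists_cycle (G := G) (A := {v | G.degree v = 3}) hx₀ (by
    intro v hv
    obtain ⟨y, z, h1, h2, h3, h4, h5, h6, h7, h8⟩ := hnb v hv
    refine ⟨y, h7, z, h8, h1, h4, h5, fun w hw hvw => (h6 w hvw).resolve_left ?_⟩
    rintro rfl
    have := hp2 v hv
    simp at hw
    lia)
  have hxp : ∀ v, G.degree v = 3 → x (p v) = v := by
    intro v hv
    have h2 := hp2 v hv
    obtain ⟨y, -, -, hall⟩ := exists_of_degree_two h2 (hl _ h2)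
    have h1 : ∀ w, G.Adj (p v) w → G.degree w = 3 → w = y := fun w hw h3 => by
      rcases hall w hw with rfl | h
      · have := hl1 _ h2; lia
      · exact h
    rw [h1 _ (hx _ h2) (hx3 _ h2), h1 _ (hp v hv).symm hv]
  have hpl : ∀ v, G.degree v = 3 → ∀ w, G.Adj (p v) w → w = v ∨ w = l (p v) := by
    intro v hv w hw
    have h2 := hp2 v hv
    obtain ⟨y, hy, hy', hall⟩ := exists_of_degree_two h2 (hl _ h2)
    have h1 : v = y := by
      rcases hall v (hp v hv).symm with h | h
      · have := hl1 _ h2; rw [← h] at this; lia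
      · exact h
    rcases hall w hw with h | h
    · exact Or.inr h
    · exact Or.inl (h.trans h1.symm)
  refine ⟨k, hk, ?_⟩
  have : Nonempty (Fin 3 × Fin k) := ⟨(0, ⟨0, by lia⟩)⟩
  let f : Fin 3 × Fin k → V := fun q => ![a q.2, p (a q.2), l (p (a q.2))] q.1
  have d0 : ∀ i : Fin k, G.degree (a i) = 3 := fun i => haA i i.2
  have d1 : ∀ i : Fin k, G.degree (p (a i)) = 2 := fun i => hp2 _ (d0 i)
  have d2 : ∀ i : Fin k, G.degree (l (p (a i))) = 1 := fun i => hl1 _ (d1 i)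
  have f0 : ∀ i : Fin k, f (0, i) = a i := fun _ => rfl
  have f1 : ∀ i : Fin k, f (1, i) = p (a i) := fun _ => rfl
  have f2 : ∀ i : Fin k, f (2, i) = l (p (a i)) := fun _ => rfl
  have inj1 : ∀ i j : Fin k, p (a i) = p (a j) → i = j := fun i j h => by
    have := congrArg x h
    rw [hxp _ (d0 i), hxp _ (d0 j)] at this
    exact Fin.ext (hinj _ i.2 _ j.2 this)
  refine nonempty_iso_of_injective hconn f ?_ ?_ ?_
  · rintro ⟨s, i⟩ ⟨t, j⟩ h
    have hd : ∀ i, G.degree (f (s, i)) = 3 - s := by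
      intro i
      fin_cases s
      · exact d0 i
      · exact d1 i
      · exact d2 i
    have hd' : ∀ i, G.degree (f (t, i)) = 3 - t := by
      intro i
      fin_cases t
      · exact d0 i
      · exact d1 i
      · exact d2 i
    have hst : s = t := by
      have h1 := hd i
      rw [h, hd' j] at h1
      have := s.2; have := t.2
      exact Fin.ext (by lia)
    subst hst
    congr 1
    fin_cases s
    · exact Fin.ext (hinj _ i.2 _ j.2 h)
    · exact inj1 i j h
    · change l (p (a i)) = l (p (a j)) at h
      refine inj1 i j ?_
      refine degree_eq_one_unique (d2 i) (hl _ (d1 i)).symm ?_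
      rw [h]
      exact (hl _ (d1 j)).symm
  · have key : ∀ w w', coronaRel k w w' → G.Adj (f w) (f w') := by
      rintro ⟨s, i⟩ ⟨t, j⟩ (⟨h1, h2, h3⟩ | ⟨h1, h2, h3⟩ | ⟨h1, h2, h3⟩)
      · simp only at h1 h2 h3
        subst h1 h2
        rw [f0, f0, h3]
        exact hadj i i.2
      · simp only at h1 h2 h3
        subst h1 h2 h3
        exact hp _ (d0 i)
      · simp only at h1 h2 h3
        subst h1 h2 h3
        exact hl _ (d1 i)
    rintro w w' ⟨-, h | h⟩
    · exact key w w' h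
    · exact (key w' w h).symm
  · have hrel : ∀ w w', coronaRel k w w' → f w ≠ f w' → (coronaGraph k).Adj w w' := fun w w' h hne =>
      ⟨fun h' => hne (by rw [h']), Or.inl h⟩
    rintro ⟨s, i⟩ v hv
    fin_cases s
    · change G.Adj (a i) v at hv
      let n : Fin k := ⟨(i + 1) % k, Nat.mod_lt _ (by lia)⟩
      let m : Fin k := ⟨(i + (k - 1)) % k, Nat.mod_lt _ (by lia)⟩
      have hm : (m + 1) % k = (i : ℕ) := by
        simp only [m, Nat.mod_add_mod]
        rw [show (i : ℕ) + (k - 1) + 1 = i + k by lia, Nat.add_mod_right, Nat.mod_eq_of_lt i.2]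
      have hn : (coronaGraph k).Adj (0, i) (0, n) :=
        hrel _ _ (Or.inl ⟨rfl, rfl, rfl⟩) (hadj i i.2).ne
      have hmi : G.Adj (a m) (a i) := by
        have := hadj m m.2
        rwa [hm] at this
      have hm' : (coronaGraph k).Adj (0, m) (0, i) :=
        hrel _ _ (Or.inl ⟨rfl, rfl, hm.symm⟩) hmi.ne
      have hnm : a n ≠ a m := fun h => by
        have h' := hinj n n.2 m m.2 h
        have h1 : (n : ℕ) = (i + 1) % k := rfl
        have h2 : (n : ℕ) < k := n.2
        rw [← h'] at hm
        have hi := i.2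
        by_cases hc : (i : ℕ) + 1 < k
        · rw [Nat.mod_eq_of_lt hc] at h1
          by_cases hc' : (n : ℕ) + 1 < k
          · rw [Nat.mod_eq_of_lt hc'] at hm; lia
          · rw [show (n : ℕ) + 1 = k by lia, Nat.mod_self] at hm; lia
        · rw [show (i : ℕ) + 1 = k by lia, Nat.mod_self] at h1
          rw [Nat.mod_eq_of_lt (by lia)] at hm
          lia
      obtain ⟨y, z, hyz, -, -, -, -, hall, -, -⟩ := hnb _ (d0 i)
      have hpi : (coronaGraph k).Adj (0, i) (1, i) :=
        hrel _ _ (Or.inr (Or.inl ⟨rfl, rfl, rfl⟩)) (hp _ (d0 i)).ne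
      have hnp : ∀ j : Fin k, a j ≠ p (a i) := fun j h => by
        have h1 := d0 j; have h2 := d1 i; rw [h] at h1; lia
      have c1 := (hall _ (hadj i i.2)).resolve_left (hnp n)
      have c2 := (hall _ hmi.symm).resolve_left (hnp m)
      change a n = y ∨ a n = z at c1
      rcases hall v hv with rfl | hv
      · exact ⟨_, hpi, rfl⟩
      · have : v = a n ∨ v = a m := by
          rcases c1 with c1 | c1 <;> rcases c2 with c2 | c2 <;> rcases hv with hv | hv
          all_goals first
            | exact absurd (c1.trans c2.symm) hnm
            | exact Or.inl (hv.trans c1.symm)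
            | exact Or.inr (hv.trans c2.symm)
        rcases this with rfl | rfl
        · exact ⟨_, hn, rfl⟩
        · exact ⟨_, hm'.symm, rfl⟩
    · change G.Adj (p (a i)) v at hv
      rcases hpl _ (d0 i) v hv with rfl | rfl
      · exact ⟨_, (hrel (0, i) (1, i) (Or.inr (Or.inl ⟨rfl, rfl, rfl⟩)) (hp _ (d0 i)).ne).symm, rfl⟩
      · exact ⟨_, hrel (1, i) (2, i) (Or.inr (Or.inr ⟨rfl, rfl, rfl⟩)) (hl _ (d1 i)).ne, rfl⟩
    · change G.Adj (l (p (a i))) v at hv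
      rw [degree_eq_one_unique (d2 i) hv (hl _ (d1 i)).symm]
      exact ⟨_, (hrel (1, i) (2, i) (Or.inr (Or.inr ⟨rfl, rfl, rfl⟩)) (hl _ (d1 i)).ne).symm, rfl⟩

end Corona

section Equality

variable {V : Type*} [Fintype V] [DecidableEq V] {G : SimpleGraph V} [DecidableRel G.Adj]

theorem totalDominationNumber_le {S : Finset V} (hS : IsTotalDominating G S) :
    totalDominationNumber G ≤ S.card := Nat.sInf_le ⟨S, rfl, hS⟩

theorem exists_card_eq_totalDominationNumber {S : Finset V} (hS : IsTotalDominating G S) :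
    ∃ T, IsTotalDominating G T ∧ T.card = totalDominationNumber G := by
  obtain ⟨T, h1, h2⟩ := Nat.sInf_mem (s := {n | ∃ S : Finset V, S.card = n ∧
    ∀ v : V, ∃ u ∈ S, G.Adj v u}) ⟨_, S, rfl, hS⟩
  exact ⟨T, h2, h1⟩

theorem three_mul_degree_le {d Δ : ℕ} (h0 : 0 < d) (hd : d ≤ Δ) (hΔ : 3 ≤ Δ) :
    3 * (d : ℤ) ≤ Δ * (6 - degreeWeight d) ∧
      (3 * (d : ℤ) = Δ * (6 - degreeWeight d) → 4 ≤ Δ → d = Δ) := by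
  simp only [degreeWeight]
  split_ifs <;> constructor <;> lia

theorem two_le_maxDegree (hconn : G.Connected) (hn : 3 ≤ Fintype.card V) : 2 ≤ G.maxDegree := by
  have h0 := degree_pos_of_connected hconn hn
  have : Nonempty V := Fintype.card_pos_iff.1 (by lia)
  obtain ⟨v⟩ := this
  obtain ⟨u, huv⟩ := (G.degree_pos_iff_exists_adj v).1 (h0 v)
  by_cases hv : G.degree v = 1
  · have := two_le_degree_of_mem_supports hconn hn (mem_supports.2 ⟨v, huv.symm, hv⟩)
    exact this.trans (G.degree_le_maxDegree u)
  · have := h0 v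
    have := G.degree_le_maxDegree v
    lia

theorem six_mul_totalDominationNumber_le (hconn : G.Connected) (hn : 3 ≤ Fintype.card V) :
    6 * (totalDominationNumber G : ℤ) ≤ ∑ v, degreeWeight (G.degree v) := by
  obtain ⟨S, hS, hle⟩ := exists_isTotalDominating_le hconn hn
  have := totalDominationNumber_le hS
  lia

theorem totalDominationNumber_le_card (hconn : G.Connected) (hn : 3 ≤ Fintype.card V) :
    totalDominationNumber G ≤ Fintype.card V := by
  obtain ⟨S, hS, hle⟩ := exists_isTotalDominating_le hconn hn
  exact (totalDominationNumber_le hS).trans (Finset.card_le_univ _)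

theorem six_mul_card_edgeFinset :
    6 * (G.edgeFinset.card : ℤ) = ∑ v, 3 * (G.degree v : ℤ) := by
  have := G.sum_degrees_eq_twice_card_edges
  rw [← Finset.mul_sum, ← Nat.cast_sum, this]
  push_cast
  ring

theorem sum_delta_mul (Δ : ℕ) : ∑ v, (Δ : ℤ) * (6 - degreeWeight (G.degree v)) =
    Δ * (6 * Fintype.card V - ∑ v, degreeWeight (G.degree v)) := by
  rw [← Finset.mul_sum, Finset.sum_sub_distrib]
  simp
  left
  ring

theorem card_edgeFinset_le (hconn : G.Connected) (hn : 3 ≤ Fintype.card V) {Δ : ℕ}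
    (hΔ : 3 ≤ Δ) (hmax : G.maxDegree ≤ Δ) :
    G.edgeFinset.card ≤ Δ * (Fintype.card V - totalDominationNumber G) := by
  have h0 := degree_pos_of_connected hconn hn
  have h1 : ∑ v, 3 * (G.degree v : ℤ) ≤ ∑ v, (Δ : ℤ) * (6 - degreeWeight (G.degree v)) :=
    Finset.sum_le_sum fun v _ =>
      (three_mul_degree_le (h0 v) ((G.degree_le_maxDegree v).trans hmax) hΔ).1
  rw [← six_mul_card_edgeFinset, sum_delta_mul] at h1
  have h2 := six_mul_totalDominationNumber_le hconn hn
  have h3 := totalDominationNumber_le_card hconn hn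
  zify [h3]
  nlinarith

theorem eq_of_card_edgeFinset_eq (hconn : G.Connected) (hn : 3 ≤ Fintype.card V) {Δ : ℕ}
    (hΔ : 3 ≤ Δ) (hmax : G.maxDegree ≤ Δ)
    (heq : G.edgeFinset.card = Δ * (Fintype.card V - totalDominationNumber G)) :
    6 * (totalDominationNumber G : ℤ) = ∑ v, degreeWeight (G.degree v) ∧
      ∀ v, 4 ≤ Δ → G.degree v = Δ := by
  have h0 := degree_pos_of_connected hconn hn
  have hp := fun v => three_mul_degree_le (h0 v) ((G.degree_le_maxDegree v).trans hmax) hΔ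
  have h1 : ∑ v, 3 * (G.degree v : ℤ) ≤ ∑ v, (Δ : ℤ) * (6 - degreeWeight (G.degree v)) :=
    Finset.sum_le_sum fun v _ => (hp v).1
  have h1' := h1
  rw [← six_mul_card_edgeFinset, sum_delta_mul] at h1'
  have h2 := six_mul_totalDominationNumber_le hconn hn
  have h3 := totalDominationNumber_le_card hconn hn
  zify [h3] at heq
  have h4 : 6 * (totalDominationNumber G : ℤ) = ∑ v, degreeWeight (G.degree v) := by
    nlinarith
  refine ⟨h4, fun v => (hp v).2 ?_⟩
  have h5 : ∑ v, 3 * (G.degree v : ℤ) = ∑ v, (Δ : ℤ) * (6 - degreeWeight (G.degree v)) := by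
    rw [← six_mul_card_edgeFinset, sum_delta_mul, heq, ← h4]
    ring
  exact (Finset.sum_eq_sum_iff_of_le fun v _ => (hp v).1).1 h5 v (Finset.mem_univ v)

theorem IsCover.isTotalDominating {S : Finset V}
    (h : IsCover (G.neighborFinset ·) Finset.univ Finset.univ S) : IsTotalDominating G S :=
  fun v => by
    obtain ⟨x, hx, hv⟩ := h.2 v (Finset.mem_univ v)
    exact ⟨x, hx, by simpa using hv⟩

theorem card_neighborFinset_inter (v : V) :
    (G.neighborFinset v ∩ Finset.univ).card = G.degree v := by simp

theorem filter_mem_neighborFinset (v : V) :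
    (Finset.univ.filter (v ∈ G.neighborFinset ·)) = G.neighborFinset v := by
  ext u; simp [G.adj_comm]

theorem corona_or_tight (hconn : G.Connected) (hn : 3 ≤ Fintype.card V) {Δ : ℕ}
    (hΔ : 3 ≤ Δ) (hmax : G.maxDegree ≤ Δ)
    (heq : G.edgeFinset.card = Δ * (Fintype.card V - totalDominationNumber G)) :
    (∃ k, 3 ≤ k ∧ Nonempty (G ≃g coronaGraph k)) ∨
      Tight (G.neighborFinset ·) Finset.univ Finset.univ := by
  obtain ⟨h1, h2⟩ := eq_of_card_edgeFinset_eq hconn hn hΔ hmax heq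
  have h0 := degree_pos_of_connected hconn hn
  have hV : Nonempty V := Fintype.card_pos_iff.1 (by lia)
  have hΔ3 : Δ = 3 := by
    by_contra hne
    have hreg := fun v => h2 v (by lia)
    obtain ⟨S, hS, hc⟩ := exists_cover_of_four_le (F := (G.neighborFinset ·))
      (X := Finset.univ) (E := Finset.univ) (fun e _ => by
        rw [card_neighborFinset_inter, hreg]; lia) Finset.univ_nonempty
    have h3 := totalDominationNumber_le hS.isTotalDominating
    have h4 : ∑ v, degreeWeight (G.degree v) = 3 * Fintype.card V := by
      rw [Finset.sum_congr rfl fun v _ => show degreeWeight (G.degree v) = 3 by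
        rw [hreg, degreeWeight, if_neg (by lia), if_neg (by lia)]]
      simp [mul_comm]
    rw [Finset.card_univ] at hc
    lia
  have hd3 : ∀ v, G.degree v ≤ 3 := fun v => hΔ3 ▸ (G.degree_le_maxDegree v).trans hmax
  have hmin : ∀ S, IsTotalDominating G S →
      ∑ v, degreeWeight (G.degree v) ≤ 6 * (S.card : ℤ) := fun S hS => by
    have := totalDominationNumber_le hS
    lia
  by_cases hl : ∃ l, G.degree l = 1
  · left
    obtain ⟨l, hl⟩ := hl
    have hC := isCorona_of_le hconn hn hmin hd3 hl
    obtain ⟨p, -, hp⟩ := hC.one l hl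
    obtain ⟨x, -, -, -, hx, -⟩ := hC.two p hp
    exact hC.exists_iso hconn hx
  · right
    push Not at hl
    have h2 : ∀ v, G.degree v = 2 ∨ G.degree v = 3 := fun v => by
      have := h0 v; have := hl v; have := hd3 v; lia
    refine ⟨?_, ?_, ?_⟩
    · intro e _
      rw [card_neighborFinset_inter]
      exact h2 e
    · intro x _
      rw [filter_mem_neighborFinset, SimpleGraph.card_neighborFinset_eq_degree]
      exact hd3 x
    · intro S hS
      have h3 := hmin S hS.isTotalDominating
      have h4 : ∑ v, degreeWeight (G.degree v) =
          ∑ v, (2 + edgeWeight (G.neighborFinset ·) Finset.univ v) := by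
        refine Finset.sum_congr rfl fun v _ => ?_
        rcases h2 v with h | h
        · rw [edgeWeight_of_two (by rw [card_neighborFinset_inter, h]), h]; rfl
        · rw [edgeWeight_of_three (by rw [card_neighborFinset_inter, h]), h]; rfl
      rw [h4, Finset.sum_add_distrib] at h3
      simp only [Finset.sum_const, nsmul_eq_mul] at h3
      linarith

end Equality

section Chains

variable {V : Type*} [Fintype V] [DecidableEq V] {G : SimpleGraph V} [DecidableRel G.Adj]

theorem eq_of_degree_three {v a b c w : V} (h : G.degree v = 3) (ha : G.Adj v a)
    (hb : G.Adj v b) (hc : G.Adj v c) (hab : a ≠ b) (hac : a ≠ c) (hbc : b ≠ c)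
    (hw : G.Adj v w) : w = a ∨ w = b ∨ w = c := by
  have h1 : ({a, b, c} : Finset V) = G.neighborFinset v := by
    refine Finset.eq_of_subset_of_card_le ?_ ?_
    · intro x hx
      simp only [Finset.mem_insert, Finset.mem_singleton] at hx
      rcases hx with rfl | rfl | rfl <;> simpa
    · rw [SimpleGraph.card_neighborFinset_eq_degree, h, Finset.card_eq_three.2
        ⟨a, b, c, hab, hac, hbc, rfl⟩]
  have h2 : w ∈ ({a, b, c} : Finset V) := by rw [h1]; simpa
  simpa using h2

theorem eq_of_degree_two {v a b w : V} (h : G.degree v = 2) (ha : G.Adj v a)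
    (hb : G.Adj v b) (hab : a ≠ b) (hw : G.Adj v w) : w = a ∨ w = b := by
  have h1 : ({a, b} : Finset V) = G.neighborFinset v := by
    refine Finset.eq_of_subset_of_card_le ?_ ?_
    · intro x hx
      simp only [Finset.mem_insert, Finset.mem_singleton] at hx
      rcases hx with rfl | rfl <;> simpa
    · rw [SimpleGraph.card_neighborFinset_eq_degree, h, Finset.card_pair hab]
  have h2 : w ∈ ({a, b} : Finset V) := by rw [h1]; simpa
  simpa using h2

/-- The tight state given by the open neighborhoods of a graph. -/
abbrev TightGraph (G : SimpleGraph V) [DecidableRel G.Adj] : Prop :=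
  Tight (G.neighborFinset ·) Finset.univ Finset.univ

theorem TightGraph.degree_eq (hT : TightGraph G) (v : V) : G.degree v = 2 ∨ G.degree v = 3 := by
  have := hT.sized v (Finset.mem_univ v)
  simpa using this

/-- A vertex of degree two has a neighbor of degree two. -/
theorem TightGraph.false_of_degree (hT : TightGraph G) {v x y : V} (hv : G.degree v = 2)
    (hx : G.Adj v x) (hy : G.Adj v y) (hxy : x ≠ y) (hx3 : G.degree x = 3)
    (hy3 : G.degree y = 3) : False := by
  obtain ⟨u, w, huw, huv, hwv, hu, hw, -⟩ := exists_of_degree_three hx3 hx.symm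
  obtain ⟨u', w', huw', huv', hwv', hu', hw', -⟩ := exists_of_degree_three hy3 hy.symm
  refine hT.not_nontail (d := v) (x := x) (y := y) (u := u) (w := w) (u' := u') (w' := w') ?_
  constructor
  all_goals first | exact Finset.mem_univ _ | assumption | skip
  all_goals first | (simp only [SimpleGraph.mem_neighborFinset]; first | assumption | (apply SimpleGraph.Adj.symm; assumption)) | skip
  simpa using hv

theorem TightGraph.twoInTwoEdge (hT : TightGraph G) :
    TwoInTwoEdge (G.neighborFinset ·) Finset.univ Finset.univ := by
  intro z _ e _ f _ hef hze hzf he hf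
  simp only [SimpleGraph.mem_neighborFinset, Finset.inter_univ,
    SimpleGraph.card_neighborFinset_eq_degree] at hze hzf he hf
  rcases TightGraph.degree_eq hT z with h | h
  · exact (TightGraph.false_of_degree hT h hze.symm hzf.symm hef he hf).elim
  · obtain ⟨y, w, hyw, hy, hw, h1, h2, -⟩ := exists_of_degree_three h hze.symm
    by_cases hyf : y = f
    · exact ⟨w, Finset.mem_univ _, hw, fun h' => hyw (hyf.trans h'.symm), by simpa using h2.symm⟩
    · exact ⟨y, Finset.mem_univ _, hy, hyf, by simpa using h1.symm⟩

/-- The graph underlying `G_k`, `H_k`, `F_k` and `L_k`. -/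
structure Chain (G : SimpleGraph V) [DecidableRel G.Adj] (k : ℕ) (s : Fin 4 → ℕ → V) : Prop where
  pos : 0 < k
  deg : ∀ j, ∀ i < k, G.degree (s j i) = 3
  inj : ∀ j, ∀ i < k, ∀ j', ∀ i' < k, s j i = s j' i' → j = j' ∧ i = i'
  ab : ∀ i < k, G.Adj (s 0 i) (s 1 i)
  ad : ∀ i < k, G.Adj (s 0 i) (s 3 i)
  cb : ∀ i < k, G.Adj (s 2 i) (s 1 i)
  cd : ∀ i < k, G.Adj (s 2 i) (s 3 i)
  ba : ∀ i, i + 1 < k → G.Adj (s 1 i) (s 0 (i + 1))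
  dc : ∀ i, i + 1 < k → G.Adj (s 3 i) (s 2 (i + 1))

namespace Chain

variable {k : ℕ} {s : Fin 4 → ℕ → V}

theorem symm (h : Chain G k s) : Chain G k (fun j => s (j + 2)) where
  pos := h.pos
  deg := fun j => h.deg _
  inj := fun j i hi j' i' hi' he => by
    have := h.inj _ i hi _ i' hi' he
    simpa using this
  ab := h.cd
  ad := h.cb
  cb := h.ad
  cd := h.ab
  ba := h.dc
  dc := h.ba

theorem ne (h : Chain G k s) {j j' : Fin 4} {i i' : ℕ} (hi : i < k) (hi' : i' < k)
    (hne : j ≠ j') : s j i ≠ s j' i' := fun he => hne (h.inj j i hi j' i' hi' he).1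

theorem ne' (h : Chain G k s) {j j' : Fin 4} {i i' : ℕ} (hi : i < k) (hi' : i' < k)
    (hne : i ≠ i') : s j i ≠ s j' i' := fun he => hne (h.inj j i hi j' i' hi' he).2

theorem nb_a (h : Chain G k s) {i : ℕ} (hi : i + 1 < k) {w : V} (hw : G.Adj (s 0 (i + 1)) w) :
    w = s 1 (i + 1) ∨ w = s 3 (i + 1) ∨ w = s 1 i :=
  eq_of_degree_three (h.deg _ _ hi) (h.ab _ hi) (h.ad _ hi) (h.ba _ hi).symm
    (h.ne hi hi (by decide)) (h.ne' hi (by lia) (by lia)) (h.ne' hi (by lia) (by lia)) hw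

theorem nb_b (h : Chain G k s) {i : ℕ} (hi : i + 1 < k) {w : V} (hw : G.Adj (s 1 i) w) :
    w = s 0 i ∨ w = s 2 i ∨ w = s 0 (i + 1) := by
  have hi' : i < k := by lia
  exact eq_of_degree_three (h.deg _ _ hi') (h.ab _ hi').symm (h.cb _ hi').symm (h.ba _ hi)
    (h.ne hi' hi' (by decide)) (h.ne' hi' hi (by lia)) (h.ne' hi' hi (by lia)) hw

theorem nb_c (h : Chain G k s) {i : ℕ} (hi : i + 1 < k) {w : V} (hw : G.Adj (s 2 (i + 1)) w) :
    w = s 3 (i + 1) ∨ w = s 1 (i + 1) ∨ w = s 3 i := h.symm.nb_a hi hw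

theorem nb_d (h : Chain G k s) {i : ℕ} (hi : i + 1 < k) {w : V} (hw : G.Adj (s 3 i) w) :
    w = s 2 i ∨ w = s 0 i ∨ w = s 2 (i + 1) := h.symm.nb_b hi hw

/-- Two neighbors of a chain vertex are chain vertices. -/
theorem exists_two_adj (h : Chain G k s) (j : Fin 4) {i : ℕ} (hi : i < k) :
    ∃ j₁ j₂, j₁ ≠ j₂ ∧ G.Adj (s j i) (s j₁ i) ∧ G.Adj (s j i) (s j₂ i) := by
  fin_cases j
  · exact ⟨1, 3, by decide, h.ab i hi, h.ad i hi⟩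
  · exact ⟨0, 2, by decide, (h.ab i hi).symm, (h.cb i hi).symm⟩
  · exact ⟨1, 3, by decide, h.cb i hi, h.cd i hi⟩
  · exact ⟨0, 2, by decide, (h.ad i hi).symm, (h.cd i hi).symm⟩

/-- A chain vertex has at most one neighbor outside the chain. -/
theorem eq_of_outside (h : Chain G k s) {j : Fin 4} {i : ℕ} (hi : i < k) {f g : V}
    (hf : G.Adj (s j i) f) (hg : G.Adj (s j i) g) (hf' : ∀ j, ∀ i < k, f ≠ s j i)
    (hg' : ∀ j, ∀ i < k, g ≠ s j i) : f = g := by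
  obtain ⟨j₁, j₂, hne, h1, h2⟩ := h.exists_two_adj j hi
  rcases eq_of_degree_three (h.deg j i hi) h1 h2 hf (h.ne hi hi hne) (hf' _ _ hi).symm
    (hf' _ _ hi).symm hg with h' | h' | h'
  · exact absurd h' (hg' _ _ hi)
  · exact absurd h' (hg' _ _ hi)
  · exact h'.symm

/-- The chain vertices to which `b_{k-1}` can be joined. -/
theorem mem_of_adj_last (h : Chain G k s) {j : Fin 4} {i : ℕ} (hi : i < k)
    (hadj : G.Adj (s 1 (k - 1)) (s j i)) : (i = k - 1 ∧ (j = 0 ∨ j = 2 ∨ j = 3)) ∨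
      (i = 0 ∧ (j = 0 ∨ j = 2)) := by
  have hk := h.pos
  have hk1 : k - 1 < k := by lia
  by_cases hik : i = k - 1
  · left
    refine ⟨hik, ?_⟩
    subst hik
    fin_cases j
    · simp
    · exact absurd rfl hadj.ne
    · simp
    · simp
  · right
    fin_cases j
    · rcases Nat.eq_zero_or_eq_succ_pred i with h0 | h0
      · simp [h0]
      · rw [h0] at hadj hi hik
        rcases h.nb_a hi hadj.symm with h' | h' | h'
        · exact absurd h' (h.ne' hk1 hi (by lia))
        · exact absurd h' (h.ne' hk1 hi (by lia))
        · exact absurd h' (h.ne' hk1 (by lia) (by lia))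
    · rcases h.nb_b (by lia) hadj.symm with h' | h' | h'
      · exact absurd h' (h.ne hk1 hi (by decide))
      · exact absurd h' (h.ne hk1 hi (by decide))
      · exact absurd h' (h.ne hk1 (by lia) (by decide))
    · rcases Nat.eq_zero_or_eq_succ_pred i with h0 | h0
      · simp [h0]
      · rw [h0] at hadj hi hik
        rcases h.nb_c hi hadj.symm with h' | h' | h'
        · exact absurd h' (h.ne' hk1 hi (by lia))
        · exact absurd h' (h.ne' hk1 hi (by lia))
        · exact absurd h' (h.ne' hk1 (by lia) (by lia))
    · rcases h.nb_d (by lia) hadj.symm with h' | h' | h'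
      · exact absurd h' (h.ne hk1 hi (by decide))
      · exact absurd h' (h.ne hk1 hi (by decide))
      · exact absurd h' (h.ne hk1 (by lia) (by decide))

theorem one (a b c d : V) (ha : G.degree a = 3) (hb : G.degree b = 3) (hc : G.degree c = 3)
    (hd : G.degree d = 3) (hab : G.Adj a b) (had : G.Adj a d) (hcb : G.Adj c b)
    (hcd : G.Adj c d) (hac : a ≠ c) (hbd : b ≠ d) : Chain G 1 (fun j _ => ![a, b, c, d] j) where
  pos := one_pos
  deg := fun j i _ => by fin_cases j <;> assumption
  inj := fun j i hi j' i' hi' he => by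
    refine ⟨?_, by lia⟩
    have h1 := hab.ne; have h2 := had.ne; have h3 := hcb.ne; have h4 := hcd.ne
    fin_cases j <;> fin_cases j'
    all_goals first | rfl | (exfalso; simp at he; first | contradiction | (exact absurd he.symm ‹_›))
  ab := fun _ _ => hab
  ad := fun _ _ => had
  cb := fun _ _ => hcb
  cd := fun _ _ => hcd
  ba := fun i hi => by lia
  dc := fun i hi => by lia

theorem extend (h : Chain G k s) {a b c d : V} (ha : G.degree a = 3) (hb : G.degree b = 3)
    (hc : G.degree c = 3)
    (hd : G.degree d = 3) (hab : G.Adj a b) (had : G.Adj a d) (hcb : G.Adj c b)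
    (hcd : G.Adj c d) (hac : a ≠ c) (hbd : b ≠ d) (hba : G.Adj (s 1 (k - 1)) a)
    (hdc : G.Adj (s 3 (k - 1)) c) (hout : ∀ j, ∀ j', ∀ i < k, ![a, b, c, d] j ≠ s j' i) :
    Chain G (k + 1) (fun j i => if i < k then s j i else ![a, b, c, d] j) := by
  have h1 := one a b c d ha hb hc hd hab had hcb hcd hac hbd
  have hk := h.pos
  refine ⟨by lia, ?_, ?_, ?_, ?_, ?_, ?_, ?_, ?_⟩
  · intro j i hi
    by_cases hik : i < k
    · rw [if_pos hik]; exact h.deg j i hik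
    · rw [if_neg hik]; exact h1.deg j 0 one_pos
  · intro j i hi j' i' hi' he
    split_ifs at he with h2 h3 h3
    · exact h.inj j i h2 j' i' h3 he
    · exact absurd he.symm (hout _ _ _ h2)
    · exact absurd he (hout _ _ _ h3)
    · exact ⟨(h1.inj j 0 one_pos j' 0 one_pos he).1, by lia⟩
  · intro i hi; split_ifs with hik
    · exact h.ab i hik
    · exact hab
  · intro i hi; split_ifs with hik
    · exact h.ad i hik
    · exact had
  · intro i hi; split_ifs with hik
    · exact h.cb i hik
    · exact hcb
  · intro i hi; split_ifs with hik
    · exact h.cd i hik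
    · exact hcd
  · intro i hi
    rw [if_pos (by lia)]
    split_ifs with hik
    · exact h.ba i hik
    · rw [show i = k - 1 by lia]; exact hba
  · intro i hi
    rw [if_pos (by lia)]
    split_ifs with hik
    · exact h.dc i hik
    · rw [show i = k - 1 by lia]; exact hdc

/-- The last two vertices of the chain are joined by a path of three vertices of degree two. -/
def EndsInPath (G : SimpleGraph V) [DecidableRel G.Adj] (k : ℕ) (s : Fin 4 → ℕ → V) : Prop :=
  ∃ f r g, f ≠ g ∧ G.degree f = 2 ∧ G.degree r = 2 ∧ G.degree g = 2 ∧ G.Adj (s 1 (k - 1)) f ∧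
    G.Adj (s 3 (k - 1)) g ∧ G.Adj f r ∧ G.Adj r g

/-- The last two vertices of the chain are joined to the first two vertices. -/
def EndsInRing (G : SimpleGraph V) (k : ℕ) (s : Fin 4 → ℕ → V) : Prop :=
  2 ≤ k ∧ ((G.Adj (s 1 (k - 1)) (s 0 0) ∧ G.Adj (s 3 (k - 1)) (s 2 0)) ∨
    (G.Adj (s 1 (k - 1)) (s 2 0) ∧ G.Adj (s 3 (k - 1)) (s 0 0)))

/-- The third neighbor `g` of `d_{k-1}` if that of `b_{k-1}` is `f = a_0`. -/
theorem endsInRing_of_adj (h : Chain G k s) {g : V}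
    (hk2 : 2 ≤ k) (hfg : g ≠ s 0 0) (hpf : G.Adj (s 1 (k - 1)) (s 0 0)) 
    (hqg : G.Adj (s 3 (k - 1)) g)
    {c d : V} (hcd : c ≠ d) (hcp : c ≠ s 1 (k - 1)) (hdp : d ≠ s 1 (k - 1))
    (hfc : G.Adj (s 0 0) c) (hfd : G.Adj (s 0 0) d) (hgc : G.Adj g c) (hgd : G.Adj g d) :
    EndsInRing G k s := by
  have h0 := h.pos
  have hnb := fun w (hw : G.Adj (s 0 0) w) => eq_of_degree_three (h.deg 0 0 h0) (h.ab 0 h0)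
    (h.ad 0 h0) hpf.symm (h.ne h0 h0 (by decide)) (h.ne' h0 (by lia) (by lia))
    (h.ne' h0 (by lia) (by lia)) hw
  have hbd : G.Adj g (s 1 0) ∧ G.Adj g (s 3 0) := by
    rcases hnb c hfc with rfl | rfl | rfl <;> rcases hnb d hfd with rfl | rfl | rfl <;>
      first | contradiction | exact ⟨hgc, hgd⟩ | exact ⟨hgd, hgc⟩
  refine ⟨hk2, Or.inl ⟨hpf, ?_⟩⟩
  rcases h.nb_b (by lia) hbd.1.symm with rfl | rfl | rfl
  · contradiction
  · exact hqg
  · rcases h.nb_d (by lia) hbd.2.symm with h' | h' | h'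
    · exact absurd h' (h.ne' hk2 h0 (by lia))
    · exact absurd h' (h.ne' hk2 h0 (by lia))
    · exact absurd h' (h.ne hk2 hk2 (by decide))

/-- The third neighbor `g` of `d_{k-1}` if that of `b_{k-1}` is `f = c_0`. -/
theorem endsInRing_of_adj' (h : Chain G k s) {g : V}
    (hk2 : 2 ≤ k) (hfg : g ≠ s 2 0) (hpf : G.Adj (s 1 (k - 1)) (s 2 0))
    (hqg : G.Adj (s 3 (k - 1)) g)
    {c d : V} (hcd : c ≠ d) (hcp : c ≠ s 1 (k - 1)) (hdp : d ≠ s 1 (k - 1))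
    (hfc : G.Adj (s 2 0) c) (hfd : G.Adj (s 2 0) d) (hgc : G.Adj g c) (hgd : G.Adj g d) :
    EndsInRing G k s := by
  have h0 := h.pos
  have hnb := fun w (hw : G.Adj (s 2 0) w) => eq_of_degree_three (h.deg 2 0 h0) (h.cb 0 h0)
    (h.cd 0 h0) hpf.symm (h.ne h0 h0 (by decide)) (h.ne' h0 (by lia) (by lia))
    (h.ne' h0 (by lia) (by lia)) hw
  have hbd : G.Adj g (s 1 0) ∧ G.Adj g (s 3 0) := by
    rcases hnb c hfc with rfl | rfl | rfl <;> rcases hnb d hfd with rfl | rfl | rfl <;>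
      first | contradiction | exact ⟨hgc, hgd⟩ | exact ⟨hgd, hgc⟩
  refine ⟨hk2, Or.inr ⟨hpf, ?_⟩⟩
  rcases h.nb_b (by lia) hbd.1.symm with rfl | rfl | rfl
  · exact hqg
  · contradiction
  · rcases h.nb_d (by lia) hbd.2.symm with h' | h' | h'
    · exact absurd h' (h.ne' hk2 h0 (by lia))
    · exact absurd h' (h.ne' hk2 h0 (by lia))
    · exact absurd h' (h.ne hk2 hk2 (by decide))

/-- A neighbor of `d_{k-1}` is outside the chain if the neighbor `f` of `b_{k-1}` is. -/
theorem outside_of_outside (h : Chain G k s) {f g : V} (hga : g ≠ s 0 (k - 1))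
    (hgc : g ≠ s 2 (k - 1)) (hpq : ¬ G.Adj (s 1 (k - 1)) (s 3 (k - 1)))
    (hqg : G.Adj (s 3 (k - 1)) g) {c d : V} (hcd : c ≠ d) (hcq : c ≠ s 3 (k - 1))
    (hdq : d ≠ s 3 (k - 1)) (hfc : G.Adj f c) (hfd : G.Adj f d) (hcg : G.Adj g c)
    (hdg : G.Adj g d) (hf : ∀ j, ∀ i < k, f ≠ s j i) : ∀ j, ∀ i < k, g ≠ s j i := by
  rintro j i hi rfl
  have h0 := h.pos
  have key : G.Adj f (s 1 0) → 2 ≤ k → False := fun hfb hk2 => by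
    rcases h.nb_b (by lia) hfb.symm with h' | h' | h'
    · exact hf _ _ h0 h'
    · exact hf _ _ h0 h'
    · exact hf _ _ hk2 h'
  have hnb : ∀ j, j = 0 ∨ j = 2 → s j 0 ≠ s 0 (k - 1) → s j 0 ≠ s 2 (k - 1) →
      G.Adj (s 3 (k - 1)) (s j 0) → G.Adj (s j 0) c → G.Adj (s j 0) d → False := by
    intro j hj hja hjc hq hc hd
    have hk2 : 2 ≤ k := by
      by_contra hlt
      have : k = 1 := by lia
      subst this
      rcases hj with rfl | rfl <;> contradiction
    have hb : G.Adj (s j 0) (s 1 0) := by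
      rcases hj with rfl | rfl
      · exact h.ab 0 h0
      · exact h.cb 0 h0
    have hd' : G.Adj (s j 0) (s 3 0) := by
      rcases hj with rfl | rfl
      · exact h.ad 0 h0
      · exact h.cd 0 h0
    have hnb := fun w (hw : G.Adj (s j 0) w) => eq_of_degree_three (h.deg j 0 h0) hb
      hd' hq.symm (h.ne h0 h0 (by decide)) (h.ne' h0 (by lia) (by lia))
      (h.ne' h0 (by lia) (by lia)) hw
    refine key ?_ hk2
    rcases hnb c hc with rfl | rfl | rfl <;> rcases hnb d hd with rfl | rfl | rfl <;>
      first | contradiction | assumption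
  rcases h.symm.mem_of_adj_last (j := j + 2) hi (by simpa [add_assoc] using hqg) with
    ⟨rfl, h'⟩ | ⟨rfl, h'⟩
  · fin_cases j <;> simp at h'
    · contradiction
    · exact hpq hqg.symm
    · contradiction
  · fin_cases j <;> simp at h'
    · exact hnb 0 (by simp) hga hgc hqg hcg hdg
    · exact hnb 2 (by simp) hga hgc hqg hcg hdg

theorem exists_extension (h : Chain G k s) (hT : TightGraph G) :
    (EndsInPath G k s ∨ G.Adj (s 1 (k - 1)) (s 3 (k - 1)) ∨ EndsInRing G k s) ∨
      ∃ s', Chain G (k + 1) s' ∧ ∀ j, s' j 0 = s j 0 := by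
  have hk := h.pos
  have hk1 : k - 1 < k := by lia
  obtain ⟨f, hfa, hfc, hpf⟩ : ∃ f, f ≠ s 0 (k - 1) ∧ f ≠ s 2 (k - 1) ∧ G.Adj (s 1 (k - 1)) f := by
    obtain ⟨y, z, hyz, hy, hz, h1, h2, -⟩ := exists_of_degree_three (h.deg 1 _ hk1)
      (h.ab _ hk1).symm
    by_cases hyc : y = s 2 (k - 1)
    · exact ⟨z, hz, fun h' => hyz (hyc.trans h'.symm), h2⟩
    · exact ⟨y, hy, hyc, h1⟩
  obtain ⟨g, hgc, hga, hqg⟩ : ∃ g, g ≠ s 2 (k - 1) ∧ g ≠ s 0 (k - 1) ∧ G.Adj (s 3 (k - 1)) g := by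
    obtain ⟨y, z, hyz, hy, hz, h1, h2, -⟩ := exists_of_degree_three (h.deg 3 _ hk1)
      (h.cd _ hk1).symm
    by_cases hyc : y = s 0 (k - 1)
    · exact ⟨z, hz, fun h' => hyz (hyc.trans h'.symm), h2⟩
    · exact ⟨y, hy, hyc, h1⟩
  by_cases hpq : G.Adj (s 1 (k - 1)) (s 3 (k - 1))
  · exact Or.inl (Or.inr (Or.inl hpq))
  have hB : Block (G.neighborFinset ·) Finset.univ Finset.univ (s 1 (k - 1)) (s 3 (k - 1))
      (s 0 (k - 1)) (s 2 (k - 1)) f g :=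
    { hp := Finset.mem_univ _, hq := Finset.mem_univ _, he := Finset.mem_univ _,
      he' := Finset.mem_univ _, hf := Finset.mem_univ _, hg := Finset.mem_univ _
      pe := by simpa using h.ab _ hk1
      pe' := by simpa using h.cb _ hk1
      qe := by simpa using h.ad _ hk1
      qe' := by simpa using h.cd _ hk1
      pf := by simpa using hpf.symm
      qg := by simpa using hqg.symm
      pq := h.ne hk1 hk1 (by decide)
      ee' := h.ne hk1 hk1 (by decide)
      fe := hfa, fe' := hfc, ge := hga, ge' := hgc
      e3 := by simpa using h.deg _ _ hk1
      e3' := by simpa using h.deg _ _ hk1 }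
  have hfg : f ≠ g := hB.ne hT
  rcases TightGraph.degree_eq hT f with hf2 | hf3
  · left; left
    obtain ⟨hg2, r, -, hrp, hrq, hrf, hrg, hru⟩ := hB.exists_of_two hT (by simpa using hf2)
    simp only [SimpleGraph.mem_neighborFinset, Finset.inter_univ, Finset.mem_univ, true_imp_iff,
      SimpleGraph.card_neighborFinset_eq_degree] at hg2 hrf hrg hru
    refine ⟨f, r, g, hfg, hf2, ?_, hg2, hpf, hqg, hrf, hrg.symm⟩
    refine (TightGraph.degree_eq hT r).resolve_right fun h3 => ?_
    obtain ⟨y, z, hyz, hy, hz, h1, h2, -⟩ := exists_of_degree_three h3 hrf.symm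
    rcases hru y h1.symm with rfl | rfl
    · contradiction
    · rcases hru z h2.symm with rfl | rfl <;> contradiction
  · rcases TightGraph.degree_eq hT g with hg2 | hg3
    · have := (hB.symm.exists_of_two hT (by simpa using hg2)).1
      simp at this
      lia
    · obtain ⟨c, -, d, -, hcd, hcp, hcq, hdp, hdq, hcf, hcg, hdf, hdg⟩ :=
        hB.exists_of_three hT (TightGraph.twoInTwoEdge hT) (by simpa using hf3)
          (by simpa using hg3)
      simp only [SimpleGraph.mem_neighborFinset] at hcf hcg hdf hdg
      by_cases hfin : ∃ j, ∃ i < k, f = s j i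
      · left; right; right
        obtain ⟨j, i, hi, rfl⟩ := hfin
        rcases h.mem_of_adj_last hi hpf with ⟨rfl, rfl | rfl | rfl⟩ | ⟨rfl, rfl | rfl⟩
        · contradiction
        · contradiction
        · contradiction
        · have hk2 : 2 ≤ k := by
            by_contra hlt
            have : k = 1 := by lia
            subst this
            contradiction
          exact h.endsInRing_of_adj hk2 hfg.symm hpf hqg hcd hcp hdp hcf hdf hcg hdg
        · have hk2 : 2 ≤ k := by
            by_contra hlt
            have : k = 1 := by lia
            subst this
            contradiction
          exact h.endsInRing_of_adj' hk2 hfg.symm hpf hqg hcd hcp hdp hcf hdf hcg hdg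
      · right
        have hf : ∀ j, ∀ i < k, f ≠ s j i := fun j i hi he => hfin ⟨j, i, hi, he⟩
        have hg := h.outside_of_outside hga hgc hpq hqg hcd hcq hdq hcf hdf hcg hdg hf
        have hout : ∀ w, G.Adj f w → G.Adj g w → ∀ j, ∀ i < k, w ≠ s j i := by
          rintro w h1 h2 j i hi rfl
          exact hfg (h.eq_of_outside hi h1.symm h2.symm hf hg)
        have hdeg : ∀ w, G.Adj f w → G.Adj g w → G.degree w = 3 := fun w h1 h2 =>
          (TightGraph.degree_eq hT w).resolve_left fun h' =>
            TightGraph.false_of_degree hT h' h1.symm h2.symm hfg hf3 hg3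
        refine ⟨_, h.extend hf3 (hdeg c hcf hcg) hg3 (hdeg d hdf hdg) hcf hdf hcg hdg hfg hcd hpf
          hqg ?_, fun j => if_pos hk⟩
        intro j
        fin_cases j
        · exact hf
        · exact hout c hcf hcg
        · exact hg
        · exact hout d hdf hdg

end Chain

end Chains

section Recognition

variable {V : Type*} [Fintype V] [DecidableEq V] {G : SimpleGraph V} [DecidableRel G.Adj]

theorem nonempty_iso_of_degree {W : Type*} [Nonempty W] [DecidableEq W] {r : W → W → Prop}
    (hconn : G.Connected) (f : W → V) (hf : Function.Injective f)
    (hr : ∀ w w', r w w' → G.Adj (f w) (f w'))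
    (hdeg : ∀ w, ∃ n, G.degree (f w) = n ∧ ∃ L : Finset W,
      (∀ x ∈ L, (SimpleGraph.fromRel r).Adj w x) ∧ n ≤ L.card) :
    Nonempty (G ≃g SimpleGraph.fromRel r) := by
  have hK : ∀ w w', (SimpleGraph.fromRel r).Adj w w' → G.Adj (f w) (f w') := by
    rintro w w' ⟨-, h | h⟩
    · exact hr _ _ h
    · exact (hr _ _ h).symm
  refine nonempty_iso_of_injective hconn f hf hK fun w v hv => ?_
  obtain ⟨_, rfl, L, hL, hcard⟩ := hdeg w
  have h1 : L.image f = G.neighborFinset (f w) := by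
    refine Finset.eq_of_subset_of_card_le ?_ ?_
    · intro y hy
      obtain ⟨x, hx, rfl⟩ := Finset.mem_image.1 hy
      simpa using hK _ _ (hL x hx)
    · rw [SimpleGraph.card_neighborFinset_eq_degree, Finset.card_image_of_injective _ hf]
      exact hcard
  have h2 : v ∈ L.image f := by rw [h1]; simpa
  obtain ⟨x, hx, rfl⟩ := Finset.mem_image.1 h2
  exact ⟨x, hL x hx, rfl⟩

theorem exists_finset_of_three {W : Type*} [DecidableEq W] {K : SimpleGraph W} {w x y z : W}
    (hx : K.Adj w x) (hy : K.Adj w y) (hz : K.Adj w z) (hxy : x ≠ y) (hxz : x ≠ z) (hyz : y ≠ z) :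
    ∃ L : Finset W, (∀ v ∈ L, K.Adj w v) ∧ 3 ≤ L.card := by
  refine ⟨{x, y, z}, ?_, (Finset.card_eq_three.2 ⟨x, y, z, hxy, hxz, hyz, rfl⟩).ge⟩
  intro v hv
  simp only [Finset.mem_insert, Finset.mem_singleton] at hv
  rcases hv with rfl | rfl | rfl <;> assumption

theorem exists_finset_of_two {W : Type*} [DecidableEq W] {K : SimpleGraph W} {w x y : W}
    (hx : K.Adj w x) (hy : K.Adj w y) (hxy : x ≠ y) :
    ∃ L : Finset W, (∀ v ∈ L, K.Adj w v) ∧ 2 ≤ L.card := by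
  refine ⟨{x, y}, ?_, (Finset.card_pair hxy).ge⟩
  intro v hv
  simp only [Finset.mem_insert, Finset.mem_singleton] at hv
  rcases hv with rfl | rfl <;> assumption

/-- A graph containing the chain edges in which the four end vertices have a further neighbor
has minimum degree at least three on the chain vertices. -/
theorem exists_finset_of_gkBase {W : Type*} [DecidableEq W] {K : SimpleGraph W} {k : ℕ}
    (hk : 0 < k) (ι : Fin 4 × Fin k → W) (hι : Function.Injective ι)
    (hK : ∀ p q, gkBase k p q → K.Adj (ι p) (ι q)) (x : Fin 4 → W)
    (h0 : K.Adj (ι (0, ⟨0, hk⟩)) (x 0)) (h1 : K.Adj (ι (1, ⟨k - 1, by lia⟩)) (x 1))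
    (h2 : K.Adj (ι (2, ⟨0, hk⟩)) (x 2)) (h3 : K.Adj (ι (3, ⟨k - 1, by lia⟩)) (x 3))
    (h0' : ι (1, ⟨0, hk⟩) ≠ x 0 ∧ ι (3, ⟨0, hk⟩) ≠ x 0)
    (h1' : ι (0, ⟨k - 1, by lia⟩) ≠ x 1 ∧ ι (2, ⟨k - 1, by lia⟩) ≠ x 1)
    (h2' : ι (1, ⟨0, hk⟩) ≠ x 2 ∧ ι (3, ⟨0, hk⟩) ≠ x 2)
    (h3' : ι (0, ⟨k - 1, by lia⟩) ≠ x 3 ∧ ι (2, ⟨k - 1, by lia⟩) ≠ x 3) (p : Fin 4 × Fin k) :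
    ∃ L : Finset W, (∀ v ∈ L, K.Adj (ι p) v) ∧ 3 ≤ L.card := by
  have ab : ∀ i, K.Adj (ι (0, i)) (ι (1, i)) := fun i => hK _ _ (by simp [gkBase])
  have ad : ∀ i, K.Adj (ι (0, i)) (ι (3, i)) := fun i => hK _ _ (by simp [gkBase])
  have cb : ∀ i, K.Adj (ι (2, i)) (ι (1, i)) := fun i => (hK _ _ (by simp [gkBase])).symm
  have cd : ∀ i, K.Adj (ι (2, i)) (ι (3, i)) := fun i => hK _ _ (by simp [gkBase])
  have hne : ∀ j j' (i i' : Fin k), (j ≠ j' ∨ (i : ℕ) ≠ i') → ι (j, i) ≠ ι (j', i') := by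
    intro j j' i i' h he
    have := hι he
    simp only [Prod.mk.injEq] at this
    rcases h with h | h
    · exact h this.1
    · exact h (congrArg Fin.val this.2)
  obtain ⟨j, i⟩ := p
  have hfirst : (i : ℕ) = 0 → i = ⟨0, hk⟩ := fun h => Fin.ext h
  have hlast : ¬ (i : ℕ) + 1 < k → i = ⟨k - 1, by lia⟩ := fun h => Fin.ext (by
    have := i.2; simp only; lia)
  fin_cases j
  · by_cases hi : (i : ℕ) = 0
    · obtain rfl := hfirst hi
      exact exists_finset_of_three (ab _) (ad _) h0 (hne _ _ _ _ (by simp)) h0'.1 h0'.2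
    · refine exists_finset_of_three (ab i) (ad i) (z := ι (1, ⟨i - 1, by lia⟩))
        (hK _ _ ?_).symm (hne _ _ _ _ (by simp)) (hne _ _ _ _ (Or.inr (by simp only; lia)))
        (hne _ _ _ _ (by simp))
      simp [gkBase]; lia
  · by_cases hi : (i : ℕ) + 1 < k
    · exact exists_finset_of_three (ab i).symm (cb i).symm (z := ι (0, ⟨i + 1, hi⟩))
        (hK _ _ (by simp [gkBase])) (hne _ _ _ _ (by simp)) (hne _ _ _ _ (by simp))
        (hne _ _ _ _ (by simp))
    · obtain rfl := hlast hi
      exact exists_finset_of_three (ab _).symm (cb _).symm h1 (hne _ _ _ _ (by simp)) h1'.1 h1'.2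
  · by_cases hi : (i : ℕ) = 0
    · obtain rfl := hfirst hi
      exact exists_finset_of_three (cb _) (cd _) h2 (hne _ _ _ _ (by simp)) h2'.1 h2'.2
    · refine exists_finset_of_three (cb i) (cd i) (z := ι (3, ⟨i - 1, by lia⟩))
        (hK _ _ ?_).symm (hne _ _ _ _ (by simp)) (hne _ _ _ _ (by simp))
        (hne _ _ _ _ (Or.inr (by simp only; lia)))
      simp [gkBase]; lia
  · by_cases hi : (i : ℕ) + 1 < k
    · exact exists_finset_of_three (ad i).symm (cd i).symm (z := ι (2, ⟨i + 1, hi⟩))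
        (hK _ _ (by simp [gkBase])) (hne _ _ _ _ (by simp)) (hne _ _ _ _ (by simp))
        (hne _ _ _ _ (by simp))
    · obtain rfl := hlast hi
      exact exists_finset_of_three (ad _).symm (cd _).symm h3 (hne _ _ _ _ (by simp)) h3'.1 h3'.2

namespace Chain

variable {k : ℕ} {s : Fin 4 → ℕ → V}

theorem adj_of_gkBase (h : Chain G k s) {p q : Fin 4 × Fin k} (hpq : gkBase k p q) :
    G.Adj (s p.1 p.2) (s q.1 q.2) := by
  obtain ⟨j, i⟩ := p
  obtain ⟨j', i'⟩ := q
  have hi := i.2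
  have hi' := i'.2
  simp only [gkBase] at hpq
  rcases hpq with ⟨rfl, rfl, rfl⟩ | ⟨rfl, rfl, h1⟩ | ⟨rfl, rfl, rfl⟩ | ⟨rfl, rfl, h1⟩ |
    ⟨rfl, rfl, rfl⟩ | ⟨rfl, rfl, rfl⟩
  · exact h.ab _ hi
  · rw [← h1] at hi' ⊢; exact h.ba _ hi'
  · exact h.cd _ hi
  · rw [← h1] at hi' ⊢; exact h.dc _ hi'
  · exact h.ad _ hi
  · exact (h.cb _ hi).symm

theorem injective (h : Chain G k s) :
    Function.Injective fun p : Fin 4 × Fin k => s p.1 p.2 := by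
  rintro ⟨j, i⟩ ⟨j', i'⟩ he
  have := h.inj j i i.2 j' i' i'.2 he
  exact Prod.ext this.1 (Fin.ext this.2)

theorem exists_iso_gk (h : Chain G k s) (hconn : G.Connected) (hac : G.Adj (s 0 0) (s 2 0))
    (hbd : G.Adj (s 1 (k - 1)) (s 3 (k - 1))) : Nonempty (G ≃g GkGraph k) := by
  have hk := h.pos
  have : Nonempty (Fin 4 × Fin k) := ⟨(0, ⟨0, hk⟩)⟩
  refine nonempty_iso_of_degree hconn (fun p => s p.1 p.2) h.injective ?_ ?_
  · rintro p q (hpq | ⟨h1, h2, h3, h4⟩ | ⟨h1, h2, h3, h4⟩)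
    · exact h.adj_of_gkBase hpq
    · simp only [h1, h2, h3, h4]; exact hac
    · simp only [h1, h2, h3, h4]; exact hbd
  · intro p
    refine ⟨3, h.deg _ _ p.2.2, ?_⟩
    refine exists_finset_of_gkBase hk id Function.injective_id ?_
      ![(2, ⟨0, hk⟩), (3, ⟨k - 1, by lia⟩), (0, ⟨0, hk⟩), (1, ⟨k - 1, by lia⟩)]
      ?_ ?_ ?_ ?_ ?_ ?_ ?_ ?_ p
    · intro p q hpq
      exact ⟨fun he => by subst he; exact (h.adj_of_gkBase hpq).ne rfl, Or.inl (Or.inl hpq)⟩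
    all_goals simp [gkRel]

theorem exists_iso_hk (h : Chain G k s) (hconn : G.Connected) (hk2 : 2 ≤ k)
    (hab : G.Adj (s 0 0) (s 1 (k - 1))) (hcd : G.Adj (s 2 0) (s 3 (k - 1))) :
    Nonempty (G ≃g HkGraph k) := by
  have hk := h.pos
  have : Nonempty (Fin 4 × Fin k) := ⟨(0, ⟨0, hk⟩)⟩
  refine nonempty_iso_of_degree hconn (fun p => s p.1 p.2) h.injective ?_ ?_
  · rintro p q (hpq | ⟨h1, h2, h3, h4⟩ | ⟨h1, h2, h3, h4⟩)
    · exact h.adj_of_gkBase hpq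
    · simp only [h1, h2, h3, h4]; exact hab
    · simp only [h1, h2, h3, h4]; exact hcd
  · intro p
    refine ⟨3, h.deg _ _ p.2.2, ?_⟩
    refine exists_finset_of_gkBase hk id Function.injective_id ?_
      ![(1, ⟨k - 1, by lia⟩), (0, ⟨0, hk⟩), (3, ⟨k - 1, by lia⟩), (2, ⟨0, hk⟩)]
      ?_ ?_ ?_ ?_ ?_ ?_ ?_ ?_ p
    · intro p q hpq
      exact ⟨fun he => by subst he; exact (h.adj_of_gkBase hpq).ne rfl, Or.inl (Or.inl hpq)⟩
    all_goals first | (simp [hkRel]; done) | (simp; lia)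

end Chain

end Recognition

section PathEnds

variable {V : Type*} [Fintype V] [DecidableEq V] {G : SimpleGraph V} [DecidableRel G.Adj]

/-- `v` is a path of three vertices of degree two from a neighbor of `a` to a neighbor of `c`. -/
structure TwoPath (G : SimpleGraph V) [DecidableRel G.Adj] (v : Fin 3 → V) (a c : V) : Prop where
  deg : ∀ j, G.degree (v j) = 2
  inj : Function.Injective v
  start : G.Adj a (v 0)
  finish : G.Adj c (v 2)
  fst : G.Adj (v 0) (v 1)
  snd : G.Adj (v 1) (v 2)

namespace TwoPath

variable {v : Fin 3 → V} {a c : V}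

theorem mk' {x y z : V} (hx : G.degree x = 2) (hy : G.degree y = 2) (hz : G.degree z = 2)
    (hxz : x ≠ z) (ha : G.Adj a x) (hc : G.Adj c z) (hxy : G.Adj x y) (hyz : G.Adj y z) :
    TwoPath G ![x, y, z] a c where
  deg := fun j => by fin_cases j <;> assumption
  inj := fun j j' he => by
    have h1 := hxy.ne; have h2 := hyz.ne
    fin_cases j <;> fin_cases j'
    all_goals first | rfl | (exfalso; simp at he; first | contradiction | (exact absurd he.symm ‹_›))
  start := ha
  finish := hc
  fst := hxy
  snd := hyz

theorem adj_of_succ (h : TwoPath G v a c) {i j : Fin 3} (hij : (j : ℕ) = i + 1) :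
    G.Adj (v i) (v j) := by
  have h1 := h.fst
  have h2 := h.snd
  fin_cases i <;> fin_cases j <;> simp at hij <;> assumption

theorem symm (h : TwoPath G v a c) : TwoPath G (fun j => v (Fin.rev j)) c a where
  deg := fun _ => h.deg _
  inj := h.inj.comp Fin.rev_injective
  start := h.finish
  finish := h.start
  fst := h.snd.symm
  snd := h.fst.symm

theorem nb_zero (h : TwoPath G v a c) (ha : G.degree a = 3) {w : V} (hw : G.Adj (v 0) w) :
    w = a ∨ w = v 1 :=
  eq_of_degree_two (h.deg 0) h.start.symm h.fst (fun he => by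
    have := h.deg 1; rw [← he] at this; lia) hw

theorem nb_one (h : TwoPath G v a c) {w : V} (hw : G.Adj (v 1) w) : w = v 0 ∨ w = v 2 :=
  eq_of_degree_two (h.deg 1) h.fst.symm h.snd (fun he => by
    have := h.inj he; simp at this) hw

/-- Paths of this kind with different ends are disjoint. -/
theorem ne (h : TwoPath G v a c) {u : Fin 3 → V} {b d : V} (h' : TwoPath G u b d)
    (ha : G.degree a = 3) (hc : G.degree c = 3) (hb : G.degree b = 3) (hd : G.degree d = 3)
    (hab : a ≠ b) (had : a ≠ d) (hcb : c ≠ b) (hcd : c ≠ d) (i j : Fin 3) : v i ≠ u j := by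
  have key1 : ∀ {v u : Fin 3 → V} {a b c d : V}, TwoPath G v a c → TwoPath G u b d →
      G.degree a = 3 → G.degree b = 3 → a ≠ b → v 0 ≠ u 0 := by
    intro v u a b c d h h' ha hb hab he
    rcases h.nb_zero ha (by rw [he]; exact h'.start.symm : G.Adj (v 0) b) with rfl | rfl
    · exact hab rfl
    · have := h.deg 1; lia
  have key2 : ∀ {v u : Fin 3 → V} {a b c d : V}, TwoPath G v a c → TwoPath G u b d →
      G.degree a = 3 → v 0 ≠ u 1 := by
    intro v u a b c d h h' ha he
    have h2 := h.start.symm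
    rw [he] at h2
    rcases h'.nb_one h2 with rfl | rfl
    · have := h'.deg 0; lia
    · have := h'.deg 2; lia
  have k1 : v 0 ≠ u 0 := key1 h h' ha hb hab
  have k2 : v 0 ≠ u 2 := key1 h h'.symm ha hd had
  have k3 : v 2 ≠ u 0 := key1 h.symm h' hc hb hcb
  have k4 : v 2 ≠ u 2 := key1 h.symm h'.symm hc hd hcd
  have k5 : v 0 ≠ u 1 := key2 h h' ha
  have k6 : v 2 ≠ u 1 := key2 h.symm h' hc
  have k7 : u 0 ≠ v 1 := key2 h' h hb
  have k8 : u 2 ≠ v 1 := key2 h'.symm h hd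
  have k9 : v 1 ≠ u 1 := fun he => by
    have h2 := h.fst.symm
    rw [he] at h2
    rcases h'.nb_one h2 with h3 | h3
    · exact k1 h3
    · exact k2 h3
  fin_cases i <;> fin_cases j <;> first | assumption | (apply Ne.symm; assumption)

end TwoPath

namespace Chain

variable {k : ℕ} {s : Fin 4 → ℕ → V}

theorem exists_iso_fk (h : Chain G k s) (hconn : G.Connected) {v : Fin 3 → V}
    (hv : TwoPath G v (s 0 0) (s 2 0)) (hbd : G.Adj (s 1 (k - 1)) (s 3 (k - 1))) :
    Nonempty (G ≃g FkGraph k) := by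
  have hk := h.pos
  have : Nonempty (FkVert k) := ⟨Sum.inl (0, ⟨0, hk⟩)⟩
  refine nonempty_iso_of_degree hconn (Sum.elim (fun p => s p.1 p.2) v) ?_ ?_ ?_
  · refine h.injective.sumElim hv.inj fun p j he => ?_
    have h1 : G.degree (s p.1 p.2) = 3 := h.deg p.1 p.2 p.2.2
    have h2 := hv.deg j
    rw [show s p.1 p.2 = _ from he] at h1
    lia
  · rintro (p | i) (q | j) hpq
    · rcases hpq with hpq | ⟨h1, h2, h3, h4⟩
      · exact h.adj_of_gkBase hpq
      · simp only [Sum.elim_inl, h1, h2, h3, h4]; exact hbd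
    · rcases hpq with ⟨h1, h2, rfl⟩ | ⟨h1, h2, rfl⟩
      · simp only [Sum.elim_inl, Sum.elim_inr, h1, h2]; exact hv.start
      · simp only [Sum.elim_inl, Sum.elim_inr, h1, h2]; exact hv.finish
    · exact hpq.elim
    · exact hv.adj_of_succ hpq
  · rintro (p | i)
    · refine ⟨3, h.deg _ _ p.2.2, ?_⟩
      refine exists_finset_of_gkBase hk Sum.inl Sum.inl_injective ?_
        ![Sum.inr 0, Sum.inl (3, ⟨k - 1, by lia⟩), Sum.inr 2, Sum.inl (1, ⟨k - 1, by lia⟩)]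
        ?_ ?_ ?_ ?_ ?_ ?_ ?_ ?_ p
      · intro p q hpq
        refine ⟨fun he => ?_, Or.inl (Or.inl hpq)⟩
        obtain rfl := Sum.inl_injective he
        exact (h.adj_of_gkBase hpq).ne rfl
      all_goals simp [fkRel]
    · refine ⟨2, hv.deg i, ?_⟩
      fin_cases i
      · exact exists_finset_of_two (x := Sum.inl (0, ⟨0, hk⟩)) (y := Sum.inr 1)
          (by simp [fkRel]) (by simp [fkRel]) (by simp)
      · exact exists_finset_of_two (x := Sum.inr 0) (y := Sum.inr 2)
          (by simp [fkRel]) (by simp [fkRel]) (by simp)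
      · exact exists_finset_of_two (x := Sum.inl (2, ⟨0, hk⟩)) (y := Sum.inr 1)
          (by simp [fkRel]) (by simp [fkRel]) (by simp)

theorem exists_iso_lk (h : Chain G k s) (hconn : G.Connected) {v u : Fin 3 → V}
    (hv : TwoPath G v (s 0 0) (s 2 0)) (hu : TwoPath G u (s 1 (k - 1)) (s 3 (k - 1))) :
    Nonempty (G ≃g LkGraph k) := by
  have hk := h.pos
  have hk1 : k - 1 < k := by lia
  have hne := hv.ne hu (h.deg _ _ hk) (h.deg _ _ hk) (h.deg _ _ hk1) (h.deg _ _ hk1)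
    (h.ne hk hk1 (by decide)) (h.ne hk hk1 (by decide)) (h.ne hk hk1 (by decide))
    (h.ne hk hk1 (by decide))
  have : Nonempty (LkVert k) := ⟨Sum.inl (0, ⟨0, hk⟩)⟩
  have hd : ∀ q : Fin 2 × Fin 3, G.degree (![v, u] q.1 q.2) = 2 := by
    rintro ⟨i, j⟩
    fin_cases i
    · exact hv.deg j
    · exact hu.deg j
  refine nonempty_iso_of_degree hconn (Sum.elim (fun p => s p.1 p.2) fun q => ![v, u] q.1 q.2)
    ?_ ?_ ?_
  · refine h.injective.sumElim ?_ fun p j he => ?_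
    · rintro ⟨i, j⟩ ⟨i', j'⟩ he
      fin_cases i <;> fin_cases i'
      · exact Prod.ext rfl (hv.inj he)
      · exact absurd he (hne _ _)
      · exact absurd he.symm (hne _ _)
      · exact Prod.ext rfl (hu.inj he)
    have h1 : G.degree (s p.1 p.2) = 3 := h.deg p.1 p.2 p.2.2
    have h2 := hd j
    rw [show s p.1 p.2 = _ from he] at h1
    lia
  · rintro (p | ⟨i, i'⟩) (q | ⟨j, j'⟩) hpq
    · exact h.adj_of_gkBase hpq
    · simp only [Sum.elim_inl, Sum.elim_inr]
      rcases hpq with ⟨h1, h2, h3⟩ | ⟨h1, h2, h3⟩ | ⟨h1, h2, h3⟩ | ⟨h1, h2, h3⟩ <;> cases h3 <;>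
        rw [h1, h2]
      · exact hv.start
      · exact hv.finish
      · exact hu.start
      · exact hu.finish
    · exact hpq.elim
    · obtain ⟨rfl, h2⟩ : i = j ∧ (j' : ℕ) = i' + 1 := hpq
      fin_cases i
      · exact hv.adj_of_succ h2
      · exact hu.adj_of_succ h2
  · rintro (p | q)
    · refine ⟨3, h.deg _ _ p.2.2, ?_⟩
      refine exists_finset_of_gkBase hk Sum.inl Sum.inl_injective ?_
        ![Sum.inr (0, 0), Sum.inr (1, 0), Sum.inr (0, 2), Sum.inr (1, 2)]
        ?_ ?_ ?_ ?_ ?_ ?_ ?_ ?_ p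
      · intro p q hpq
        refine ⟨fun he => ?_, Or.inl hpq⟩
        obtain rfl := Sum.inl_injective he
        exact (h.adj_of_gkBase hpq).ne rfl
      all_goals simp [lkRel]
    · refine ⟨2, hd q, ?_⟩
      obtain ⟨i, j⟩ := q
      have hmid : ∃ L : Finset (LkVert k), (∀ v ∈ L, (SimpleGraph.fromRel (lkRel k)).Adj
          (Sum.inr (i, 1)) v) ∧ 2 ≤ L.card :=
        exists_finset_of_two (x := Sum.inr (i, 0)) (y := Sum.inr (i, 2))
          (by simp [lkRel]) (by simp [lkRel]) (by simp)
      fin_cases j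
      · fin_cases i
        · exact exists_finset_of_two (x := Sum.inl (0, ⟨0, hk⟩)) (y := Sum.inr (0, 1))
            (by simp [lkRel]) (by simp [lkRel]) (by simp)
        · exact exists_finset_of_two (x := Sum.inl (1, ⟨k - 1, hk1⟩)) (y := Sum.inr (1, 1))
            (by simp [lkRel]) (by simp [lkRel]) (by simp)
      · exact hmid
      · fin_cases i
        · exact exists_finset_of_two (x := Sum.inl (2, ⟨0, hk⟩)) (y := Sum.inr (0, 1))
            (by simp [lkRel]) (by simp [lkRel]) (by simp)
        · exact exists_finset_of_two (x := Sum.inl (3, ⟨k - 1, hk1⟩)) (y := Sum.inr (1, 1))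
            (by simp [lkRel]) (by simp [lkRel]) (by simp)

end Chain

end PathEnds

section Classification

variable {V : Type*} [Fintype V] [DecidableEq V] {G : SimpleGraph V} [DecidableRel G.Adj]

namespace Chain

variable {k : ℕ} {s : Fin 4 → ℕ → V}

theorem exists_end (h : Chain G k s) (hT : TightGraph G) :
    ∃ k s', Chain G k s' ∧ (∀ j, s' j 0 = s j 0) ∧
      (EndsInPath G k s' ∨ G.Adj (s' 1 (k - 1)) (s' 3 (k - 1)) ∨ EndsInRing G k s') := by
  refine of_extend (P := fun k => ∃ s', Chain G k s' ∧ ∀ j, s' j 0 = s j 0) (Fintype.card V)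
    ?_ ?_ ⟨s, h, fun _ => rfl⟩
  · rintro k ⟨s', h', -⟩
    exact le_card_of_injOn (a := s' 0) fun i hi j hj he => (h'.inj 0 i hi 0 j hj he).2
  · rintro k ⟨s', h', h0⟩
    rcases h'.exists_extension hT with hend | ⟨s'', h'', h0'⟩
    · exact Or.inl ⟨k, s', h', h0, hend⟩
    · exact Or.inr ⟨s'', h'', fun j => (h0' j).trans (h0 j)⟩

/-- If the third neighbor of `a_0` is not a chain vertex different from `c_0`, then the chain is
not closed to a ring. -/
theorem not_endsInRing (h : Chain G k s) {x : V} (hx : G.Adj (s 0 0) x) (hxb : x ≠ s 1 0)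
    (hxd : x ≠ s 3 0) (hx1 : x ≠ s 1 (k - 1)) (hx3 : x ≠ s 3 (k - 1)) : ¬ EndsInRing G k s := by
  rintro ⟨hk2, hring⟩
  have hk := h.pos
  have hnb := fun w (hw : G.Adj (s 0 0) w) => eq_of_degree_three (h.deg 0 0 hk) (h.ab 0 hk)
    (h.ad 0 hk) hx (h.ne hk hk (by decide)) hxb.symm hxd.symm hw
  rcases hring with ⟨h1, -⟩ | ⟨-, h1⟩
  · rcases hnb _ h1.symm with h2 | h2 | h2
    · exact h.ne' (by lia) (by lia) (by lia) h2
    · exact h.ne' (by lia) (by lia) (by lia) h2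
    · exact hx1 h2.symm
  · rcases hnb _ h1.symm with h2 | h2 | h2
    · exact h.ne' (by lia) (by lia) (by lia) h2
    · exact h.ne' (by lia) (by lia) (by lia) h2
    · exact hx3 h2.symm

theorem swap_first (h : Chain G k s) :
    Chain G k (fun j i => if i = 0 ∧ (j = 0 ∨ j = 2) then s (j + 2) i else s j i) where
  pos := h.pos
  deg := fun j i hi => by
    by_cases hc : i = 0 ∧ (j = 0 ∨ j = 2)
    · rw [if_pos hc]; exact h.deg _ _ hi
    · rw [if_neg hc]; exact h.deg _ _ hi
  inj := fun j i hi j' i' hi' he => by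
    split_ifs at he with h1 h2 h2
    all_goals
      have h3 := h.inj _ _ hi _ _ hi' he
    · exact ⟨add_right_cancel h3.1, h3.2⟩
    · rcases h1.2 with rfl | rfl <;> simp [← h3.1, ← h3.2, h1.1] at h2
    · rcases h2.2 with rfl | rfl <;> simp [h3.1, h3.2, h2.1] at h1
    · exact h3
  ab := fun i hi => by
    by_cases hi0 : i = 0
    · simpa [hi0] using h.cb 0 h.pos
    · simpa [hi0] using h.ab i hi
  ad := fun i hi => by
    by_cases hi0 : i = 0
    · simpa [hi0] using h.cd 0 h.pos
    · simpa [hi0] using h.ad i hi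
  cb := fun i hi => by
    by_cases hi0 : i = 0
    · simpa [hi0] using h.ab 0 h.pos
    · simpa [hi0] using h.cb i hi
  cd := fun i hi => by
    by_cases hi0 : i = 0
    · simpa [hi0] using h.ad 0 h.pos
    · simpa [hi0] using h.cd i hi
  ba := fun i hi => by simpa using h.ba i hi
  dc := fun i hi => by simpa using h.dc i hi

end Chain

theorem TightGraph.exists_iso_of_mixed (hT : TightGraph G) (hconn : G.Connected) {v₂ v₃ : V}
    (h₂ : G.degree v₂ = 2) (h₃ : G.degree v₃ = 3) :
    (∃ k, 1 ≤ k ∧ Nonempty (G ≃g FkGraph k)) ∨ ∃ k, 1 ≤ k ∧ Nonempty (G ≃g LkGraph k) := by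
  obtain ⟨u, x, hu3, hux, hx2⟩ : ∃ u x, G.degree u = 3 ∧ G.Adj u x ∧ G.degree x = 2 := by
    by_contra! hno
    have := hconn.mem_of_closed (A := {v | G.degree v = 3}) h₃ (fun u hu v huv =>
      (TightGraph.degree_eq hT v).resolve_left (hno u v hu huv)) v₂
    simp only [Set.mem_ofPred_eq] at this
    lia
  obtain ⟨v, hvu, hxv, hxall⟩ := exists_of_degree_two hx2 hux.symm
  have hv2 : G.degree v = 2 := (TightGraph.degree_eq hT v).resolve_right fun hv3 =>
    TightGraph.false_of_degree hT hx2 hux.symm hxv hvu.symm hu3 hv3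
  obtain ⟨x', hx_x, hvx', -⟩ := exists_of_degree_two hv2 hxv.symm
  obtain ⟨u', -, c, -, d, -, hu_3, hx_u', hxu', hx_u, hcd, hcu, hcu', hdu, hdu', hx_all⟩ :=
    Tight.exists_pair hT (TightGraph.twoInTwoEdge hT) (x := x) (x' := x') (ε := v) (e := u)
      (Finset.mem_univ _) (Finset.mem_univ _) (Finset.mem_univ _) (Finset.mem_univ _)
      (by simpa using hxv.symm) (by simpa using hux) (by simpa using hvx') hx_x
      (by simpa using hv2) (by simpa using hu3)
      (fun f _ hf => (hxall f (by simpa using SimpleGraph.Adj.symm (by simpa using hf))).symm)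
  simp only [SimpleGraph.mem_neighborFinset, Finset.inter_univ, Finset.mem_univ, true_imp_iff,
    SimpleGraph.card_neighborFinset_eq_degree] at hu_3 hx_u' hxu' hx_u hcu hcu' hdu hdu' hx_all
  have huu' : u ≠ u' := by rintro rfl; exact hxu' hux
  have hx_2 : G.degree x' = 2 := by
    refine (TightGraph.degree_eq hT x').resolve_right fun h3 => ?_
    obtain ⟨y, z, hyz, hy, hz, h1, h2, -⟩ := exists_of_degree_three h3 hvx'.symm
    exact hyz (((hx_all y h1.symm).resolve_left hy).trans ((hx_all z h2.symm).resolve_left hz).symm)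
  have hdeg : ∀ w, G.Adj u w → G.Adj u' w → G.degree w = 3 := fun w h1 h2 =>
    (TightGraph.degree_eq hT w).resolve_left fun h' =>
      TightGraph.false_of_degree hT h' h1.symm h2.symm huu' hu3 hu_3
  have hc := Chain.one u c u' d hu3 (hdeg c hcu hcu') hu_3 (hdeg d hdu hdu') hcu hdu hcu' hdu'
    huu' hcd
  obtain ⟨k, s, hs, hs0, hend⟩ := hc.exists_end hT
  have hsa : s 0 0 = u := hs0 0
  have hsc : s 2 0 = u' := hs0 2
  have hk := hs.pos
  have hv : TwoPath G ![x, v, x'] (s 0 0) (s 2 0) := by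
    rw [hsa, hsc]
    exact TwoPath.mk' hx2 hv2 hx_2 hx_x.symm hux hx_u' hxv hvx'
  rcases hend with ⟨f, r, g, hfg, hf, hr, hg, hbf, hdg, hfr, hrg⟩ | hbd | hring
  · exact Or.inr ⟨k, hk, hs.exists_iso_lk hconn hv (TwoPath.mk' hf hr hg hfg hbf hdg hfr hrg)⟩
  · exact Or.inl ⟨k, hk, hs.exists_iso_fk hconn hv hbd⟩
  · have hne : ∀ j, ∀ i < k, x ≠ s j i := by
      rintro j i hi rfl
      have := hs.deg j i hi
      lia
    exact absurd hring (hs.not_endsInRing (hsa ▸ hux) (hne _ _ hk) (hne _ _ hk)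
      (hne _ _ (by lia)) (hne _ _ (by lia)))

theorem TightGraph.exists_iso_of_two (hT : TightGraph G) (hconn : G.Connected)
    (h2 : ∀ v, G.degree v = 2) : Nonempty (G ≃g cycleG 3) ∨ Nonempty (G ≃g cycleG 6) := by
  obtain ⟨x⟩ := hconn.nonempty
  obtain ⟨e, hxe⟩ : ∃ e, G.Adj x e := by
    have := h2 x
    rw [← SimpleGraph.card_neighborFinset_eq_degree] at this
    obtain ⟨e, he⟩ := Finset.card_pos.1 (by lia : 0 < (G.neighborFinset x).card)
    exact ⟨e, by simpa using he⟩
  obtain ⟨f, hfe, hxf, hxall⟩ := exists_of_degree_two (h2 x) hxe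
  obtain ⟨p, hpx, hep, heall⟩ := exists_of_degree_two (h2 e) hxe.symm
  obtain ⟨q, hqx, hfq, hfall⟩ := exists_of_degree_two (h2 f) hxf.symm
  obtain ⟨hpq, ⟨g, -, -, hgp, hgq, hge, hgf, hpall, hqall⟩ | ⟨u, -, -, -, -, hu, -⟩⟩ :=
    hT.two_two (x := x) (p := p) (q := q) (e := e) (f := f) (Finset.mem_univ _)
    (Finset.mem_univ _) (Finset.mem_univ _) (Finset.mem_univ _) (Finset.mem_univ _)
    (by simpa using hxe.symm) (by simpa using hxf.symm) (by simpa using hep) (by simpa using hfq)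
    hfe.symm hpx hqx (by simpa using h2 e) (by simpa using h2 f)
  swap
  · simp [h2] at hu
  simp only [SimpleGraph.mem_neighborFinset, Finset.mem_univ, true_imp_iff]
    at hgp hgq hpall hqall
  by_cases hpf : p = f
  · left
    subst hpf
    have : Nonempty (Fin 3) := ⟨0⟩
    have n1 := hxe.ne
    have n2 := hxf.ne
    refine nonempty_iso_of_degree hconn ![x, e, p] ?_ ?_ ?_
    · intro i j he
      fin_cases i <;> fin_cases j
      all_goals first | rfl | (exfalso; simp at he; first | contradiction | (exact absurd he.symm ‹_›))
    · intro i j he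
      fin_cases i <;> fin_cases j <;> simp at he
      · exact hxe
      · exact hep
      · exact hxf.symm
    · intro i
      refine ⟨2, h2 _, ?_⟩
      refine exists_finset_of_two (x := i + 1) (y := i + 2) ?_ ?_ ?_
      all_goals fin_cases i <;> simp
  · right
    have hgx : g ≠ x := by
      rintro rfl
      rcases hxall p hgp with rfl | rfl
      · exact hep.ne rfl
      · exact hpf rfl
    have hqe : q ≠ e := by
      rintro rfl
      rcases hqall x hxe with rfl | rfl
      · exact hxf.ne rfl
      · exact hgx rfl
    have n1 := hxe.ne
    have n2 := hxf.ne
    have n3 := hep.ne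
    have n4 := hfq.ne
    have n5 := hgp.ne
    have n6 := hgq.ne
    have : Nonempty (Fin 6) := ⟨0⟩
    refine nonempty_iso_of_degree hconn ![x, e, p, g, q, f] ?_ ?_ ?_
    · intro i j he
      fin_cases i <;> fin_cases j
      all_goals first | rfl | (exfalso; simp at he; first | contradiction | (exact absurd he.symm ‹_›))
    · intro i j he
      fin_cases i <;> fin_cases j <;> simp at he
      · exact hxe
      · exact hep
      · exact hgp.symm
      · exact hgq
      · exact hfq.symm
      · exact hxf.symm
    · intro i
      refine ⟨2, h2 _, ?_⟩
      refine exists_finset_of_two (x := i + 1) (y := i + 5) ?_ ?_ ?_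
      all_goals fin_cases i <;> simp

theorem TightGraph.exists_iso_gk (hT : TightGraph G) (hconn : G.Connected)
    (h3 : ∀ v, G.degree v = 3) {p q e e' : V} (hpq : G.Adj p q) (hee' : e ≠ e')
    (hpe : G.Adj p e) (hpe' : G.Adj p e') (hqe : G.Adj q e) (hqe' : G.Adj q e') :
    ∃ k, 1 ≤ k ∧ Nonempty (G ≃g GkGraph k) := by
  have hc := Chain.one p e q e' (h3 _) (h3 _) (h3 _) (h3 _) hpe hpe' hqe hqe' hpq.ne hee'
  obtain ⟨k, s, hs, hs0, hend⟩ := hc.exists_end hT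
  have hsa : s 0 0 = p := hs0 0
  have hsc : s 2 0 = q := hs0 2
  have hk := hs.pos
  have hac : G.Adj (s 0 0) (s 2 0) := by rw [hsa, hsc]; exact hpq
  rcases hend with ⟨f, r, g, hfg, hf, -⟩ | hbd | hring
  · have := h3 f
    lia
  · exact ⟨k, hk, hs.exists_iso_gk hconn hac hbd⟩
  · exact absurd hring (hs.not_endsInRing hac (hs.ne hk hk (by decide)) (hs.ne hk hk (by decide))
      (hs.ne hk (by lia) (by decide)) (hs.ne hk (by lia) (by decide)))

theorem TightGraph.exists_iso_of_square (hT : TightGraph G) (hconn : G.Connected)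
    (h3 : ∀ v, G.degree v = 3) {p q e e' : V} (hpq : p ≠ q) (hee' : e ≠ e')
    (hpe : G.Adj p e) (hpe' : G.Adj p e') (hqe : G.Adj q e) (hqe' : G.Adj q e') :
    (∃ k, 1 ≤ k ∧ Nonempty (G ≃g GkGraph k)) ∨ ∃ k, 2 ≤ k ∧ Nonempty (G ≃g HkGraph k) := by
  have hc := Chain.one p e q e' (h3 _) (h3 _) (h3 _) (h3 _) hpe hpe' hqe hqe' hpq hee'
  obtain ⟨k, s, hs, hs0, hend⟩ := hc.exists_end hT
  have hk := hs.pos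
  have hk1 : k - 1 < k := by lia
  rcases hend with ⟨f, r, g, hfg, hf, -⟩ | hbd | ⟨hk2, ⟨h1, h2⟩ | ⟨h1, h2⟩⟩
  · have := h3 f
    lia
  · exact Or.inl (TightGraph.exists_iso_gk hT hconn h3 hbd (hs.ne hk1 hk1 (by decide))
      (hs.ab _ hk1).symm (hs.cb _ hk1).symm (hs.ad _ hk1).symm (hs.cd _ hk1).symm)
  · exact Or.inr ⟨k, hk2, hs.exists_iso_hk hconn hk2 h1.symm h2.symm⟩
  · refine Or.inr ⟨k, hk2, hs.swap_first.exists_iso_hk hconn hk2 ?_ ?_⟩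
    · simpa using h1.symm
    · simpa using h2.symm

end Classification

section MobiusKantor

variable {V : Type*} [Fintype V] [DecidableEq V] {G : SimpleGraph V} [DecidableRel G.Adj]

/-- `p` and `l` are the points and lines of a Möbius–Kantor configuration whose flags are edges
of `G`. -/
structure MobiusKantor (G : SimpleGraph V) (p l : Fin 8 → V) : Prop where
  inj : Function.Injective p
  zero : ∀ j, G.Adj (p j) (l j)
  one : ∀ j, G.Adj (p (j + 1)) (l j)
  three : ∀ j, G.Adj (p (j + 3)) (l j)

namespace MobiusKantor

variable {p l : Fin 8 → V}

theorem nb_line (h : MobiusKantor G p l) (h3 : ∀ v, G.degree v = 3) {j : Fin 8} {w : V}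
    (hw : G.Adj (l j) w) : ∃ i, w = p i ∧ (i = j ∨ i = j + 1 ∨ i = j + 3) := by
  rcases eq_of_degree_three (h3 _) (h.zero j).symm (h.one j).symm (h.three j).symm
    (fun he => by simpa using h.inj he) (fun he => by simpa using h.inj he)
    (fun he => by simpa using h.inj he) hw with he | he | he
  · exact ⟨_, he, by simp⟩
  · exact ⟨_, he, by simp⟩
  · exact ⟨_, he, by simp⟩

theorem inj_line (h : MobiusKantor G p l) (h3 : ∀ v, G.degree v = 3) :
    Function.Injective l := by
  intro j j' he
  have key : ∀ x, G.Adj (p x) (l j') → x = j ∨ x = j + 1 ∨ x = j + 3 := fun x hx => by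
    rw [← he] at hx
    obtain ⟨i, hi, hij⟩ := h.nb_line h3 hx.symm
    rwa [h.inj hi]
  have key' : ∀ j j' : Fin 8, (j' = j ∨ j' = j + 1 ∨ j' = j + 3) →
      (j' + 1 = j ∨ j' + 1 = j + 1 ∨ j' + 1 = j + 3) →
      (j' + 3 = j ∨ j' + 3 = j + 1 ∨ j' + 3 = j + 3) → j = j' := by decide
  exact key' j j' (key _ (h.zero _)) (key _ (h.one _)) (key _ (h.three _))

theorem adj_sub_one (h : MobiusKantor G p l) (i : Fin 8) : G.Adj (p i) (l (i - 1)) := by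
  simpa using h.one (i - 1)

theorem adj_sub_three (h : MobiusKantor G p l) (i : Fin 8) : G.Adj (p i) (l (i - 3)) := by
  simpa using h.three (i - 3)

theorem nb_point (h : MobiusKantor G p l) (h3 : ∀ v, G.degree v = 3) {i : Fin 8} {w : V}
    (hw : G.Adj (p i) w) : ∃ j, w = l j := by
  have key : ∀ i : Fin 8, i ≠ i - 1 ∧ i ≠ i - 3 ∧ i - 1 ≠ i - 3 := by decide
  have hl := h.inj_line h3
  rcases eq_of_degree_three (h3 _) (h.zero i) (h.adj_sub_one i) (h.adj_sub_three i)
    (fun he => (key i).1 (hl he)) (fun he => (key i).2.1 (hl he))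
    (fun he => (key i).2.2 (hl he)) hw with he | he | he
  · exact ⟨_, he⟩
  · exact ⟨_, he⟩
  · exact ⟨_, he⟩

theorem exists_iso (h : MobiusKantor G p l) (hconn : G.Connected) (h3 : ∀ v, G.degree v = 3)
    (hpl : ∀ i j, p i ≠ l j) : Nonempty (G ≃g GP16) := by
  have : Nonempty (Fin 2 × Fin 8) := ⟨(0, 0)⟩
  have hl := h.inj_line h3
  let φ : Fin 2 × Fin 8 → Fin 8 ⊕ Fin 8 := fun q =>
    ![![.inl 0, .inr 0, .inl 1, .inr 1, .inl 4, .inr 4, .inl 5, .inr 5],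
      ![.inr 7, .inl 3, .inr 6, .inl 2, .inr 3, .inl 7, .inr 2, .inl 6]] q.1 q.2
  have hφ : Function.Injective φ := by decide
  have hflag : ∀ i j : Fin 8, (i = j ∨ i = j + 1 ∨ i = j + 3) → G.Adj (p i) (l j) := by
    rintro i j (rfl | rfl | rfl)
    · exact h.zero _
    · exact h.one _
    · exact h.three _
  have hφr : ∀ q q', gpRel q q' → (∃ i j, φ q = .inl i ∧ φ q' = .inr j ∧
      (i = j ∨ i = j + 1 ∨ i = j + 3)) ∨ (∃ i j, φ q' = .inl i ∧ φ q = .inr j ∧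
      (i = j ∨ i = j + 1 ∨ i = j + 3)) := by
    unfold gpRel
    decide
  refine nonempty_iso_of_degree hconn (fun q => Sum.elim p l (φ q)) ?_ ?_ ?_
  · exact (h.inj.sumElim hl hpl).comp hφ
  · intro q q' hq
    rcases hφr q q' hq with ⟨i, j, h1, h2, h3⟩ | ⟨i, j, h1, h2, h3⟩
    · simp only [h1, h2]; exact hflag i j h3
    · simp only [h1, h2]; exact (hflag i j h3).symm
  · intro q
    refine ⟨3, h3 _, ?_⟩
    obtain ⟨a, i⟩ := q
    fin_cases a
    · refine exists_finset_of_three (x := (0, i + 1)) (y := (0, i - 1)) (z := (1, i))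
        ?_ ?_ ?_ ?_ ?_ ?_
      all_goals revert i; (try simp only [SimpleGraph.fromRel_adj, gpRel]); decide
    · refine exists_finset_of_three (x := (1, i + 3)) (y := (1, i - 3)) (z := (0, i))
        ?_ ?_ ?_ ?_ ?_ ?_
      all_goals revert i; (try simp only [SimpleGraph.fromRel_adj, gpRel]); decide

/-- The points and lines of the configuration are different vertices. -/
theorem ne_line (h : MobiusKantor G p l) (hconn : G.Connected) (h3 : ∀ v, G.degree v = 3)
    (hC : ∀ x y e f, x ≠ y → G.Adj x e → G.Adj x f → G.Adj y e → G.Adj y f → e = f)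
    (i₀ j₀ : Fin 8) : p i₀ ≠ l j₀ := by
  intro he
  have hall := hconn.mem_of_closed (A := Set.range p ∩ Set.range l) (a := p i₀)
    ⟨⟨i₀, rfl⟩, ⟨j₀, he.symm⟩⟩ (by
      rintro _ ⟨⟨i, rfl⟩, ⟨j, hj⟩⟩ v hv
      constructor
      · rw [← hj] at hv
        obtain ⟨i', hi', -⟩ := h.nb_line h3 hv
        exact ⟨i', hi'.symm⟩
      · obtain ⟨j', hj'⟩ := h.nb_point h3 hv
        exact ⟨j', hj'.symm⟩)
  have hcard : Fintype.card V = 8 := by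
    have := Fintype.card_of_bijective (f := p) ⟨h.inj, fun v => (hall v).1⟩
    simpa using this.symm
  have hanti : ∀ v, ∃ v', ∀ w, w ≠ v → w ≠ v' → ∃ m, G.Adj v m ∧ G.Adj w m := by
    intro v
    obtain ⟨i, rfl⟩ := (hall v).1
    refine ⟨p (i + 4), fun w hw hw' => ?_⟩
    obtain ⟨j, rfl⟩ := (hall w).1
    have key : ∀ i j : Fin 8, j ≠ i → j ≠ i + 4 → ∃ m,
        (i = m ∨ i = m + 1 ∨ i = m + 3) ∧ (j = m ∨ j = m + 1 ∨ j = m + 3) := by decide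
    have hflag : ∀ i j : Fin 8, (i = j ∨ i = j + 1 ∨ i = j + 3) → G.Adj (p i) (l j) := by
      rintro i j (rfl | rfl | rfl)
      · exact h.zero _
      · exact h.one _
      · exact h.three _
    obtain ⟨m, h1, h2⟩ := key i j (fun h' => hw (congrArg p h')) fun h' => hw' (congrArg p h')
    exact ⟨l m, hflag _ _ h1, hflag _ _ h2⟩
  have htri : ∀ v, ∃ x y, G.Adj v x ∧ G.Adj v y ∧ G.Adj x y := by
    intro v
    obtain ⟨v', hv'⟩ := hanti v
    obtain ⟨x, hx, hxv⟩ : ∃ x, G.Adj v x ∧ x ≠ v' := by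
      have h2 : 1 < (G.neighborFinset v).card := by
        rw [SimpleGraph.card_neighborFinset_eq_degree, h3]; lia
      obtain ⟨x, hx, hxv⟩ := Finset.exists_mem_ne h2 v'
      exact ⟨x, by simpa using hx, hxv⟩
    obtain ⟨m, h1, h2⟩ := hv' x hx.ne.symm hxv
    exact ⟨x, m, hx, h1, h2⟩
  have hcount := Finset.card_mul_eq_card_mul (s := (Finset.univ : Finset V))
    (t := G.cliqueFinset 3) (m := 1) (n := 3) (fun v c => v ∈ c) ?_ ?_
  · rw [Finset.card_univ, hcard] at hcount
    lia
  · intro v _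
    obtain ⟨x, y, hx, hy, hxy⟩ := htri v
    rw [Finset.card_eq_one]
    refine ⟨{v, x, y}, ?_⟩
    ext c
    simp only [Finset.bipartiteAbove, Finset.mem_filter, SimpleGraph.mem_cliqueFinset_iff,
      Finset.mem_singleton]
    constructor
    · rintro ⟨hc, hvc⟩
      have hsub : c ⊆ {v, x, y} := by
        intro w hw
        by_contra hno
        simp only [Finset.mem_insert, Finset.mem_singleton, not_or] at hno
        obtain ⟨q, hq, hqvw⟩ : ∃ q ∈ c, q ∉ ({v, w} : Finset V) := by
          refine Finset.exists_mem_notMem_of_card_lt_card ?_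
          rw [hc.card_eq]
          exact lt_of_le_of_lt Finset.card_le_two (by lia)
        simp only [Finset.mem_insert, Finset.mem_singleton, not_or] at hqvw
        have a1 : G.Adj v w := hc.isClique (by simpa using hvc) (by simpa using hw) (Ne.symm hno.1)
        have a2 : G.Adj v q := hc.isClique (by simpa using hvc) (by simpa using hq)
          (Ne.symm hqvw.1)
        have a3 : G.Adj q w := hc.isClique (by simpa using hq) (by simpa using hw) hqvw.2
        rcases eq_of_degree_three (h3 v) hx hy a1 hxy.ne (Ne.symm hno.2.1) (Ne.symm hno.2.2) a2 with
          rfl | rfl | rfl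
        · exact hno.2.2 (hC v q w y hx.ne a1 hy a3 hxy)
        · exact hno.2.1 (hC v q w x hy.ne a1 hx a3 hxy.symm)
        · exact a3.ne rfl
      refine Finset.eq_of_subset_of_card_le hsub ?_
      rw [hc.card_eq]
      exact Finset.card_le_three
    · rintro rfl
      exact ⟨SimpleGraph.is3Clique_triple_iff.2 ⟨hx, hy, hxy⟩, by simp⟩
  · intro c hc
    rw [SimpleGraph.mem_cliqueFinset_iff] at hc
    rw [← hc.card_eq]
    congr 1
    ext v
    simp [Finset.bipartiteBelow]

end MobiusKantor

end MobiusKantor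

section TightCubic

variable {V : Type*} [Fintype V] [DecidableEq V] {G : SimpleGraph V} [DecidableRel G.Adj]

/-- Cubic graphs without 4-cycles whose open neighborhood hypergraph is tight. -/
structure TightCubic (G : SimpleGraph V) [DecidableRel G.Adj] : Prop where
  degree : ∀ v, G.degree v = 3
  slack : SlackU (G.neighborFinset ·) 0 Finset.univ Finset.univ
  eq : ∀ {x y e f}, x ≠ y → G.Adj x e → G.Adj x f → G.Adj y e → G.Adj y f → e = f

theorem TightGraph.tightCubic (hT : TightGraph G) (h3 : ∀ v, G.degree v = 3)
    (hC : ∀ x y e f, x ≠ y → G.Adj x e → G.Adj x f → G.Adj y e → G.Adj y f → e = f) :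
    TightCubic G :=
  ⟨h3, (hT.slack.regular_of_uniform (fun e _ => by rw [card_neighborFinset_inter, h3])
    hT.degree).2, @hC⟩

/-- Vertices with a common neighbor. -/
def CommonNeighbor (G : SimpleGraph V) (x y : V) : Prop :=
  ∃ m, G.Adj x m ∧ G.Adj y m

theorem CommonNeighbor.symm {x y : V} (h : CommonNeighbor G x y) : CommonNeighbor G y x :=
  h.imp fun _ hm => ⟨hm.2, hm.1⟩

namespace TightCubic

theorem uniform (h : TightCubic G) :
    Uniform3 (G.neighborFinset ·) Finset.univ Finset.univ := fun e _ => by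
  rw [card_neighborFinset_inter, h.degree]

theorem linear (h : TightCubic G) : Linear (G.neighborFinset ·) Finset.univ Finset.univ := by
  intro e _ f _ hef x _ y _ h1 h2 h3 h4
  simp only [SimpleGraph.mem_neighborFinset] at h1 h2 h3 h4
  by_contra hxy
  exact hef (h.eq hxy h1.symm h2.symm h3.symm h4.symm)

theorem not_adj (h : TightCubic G) {u a l k : V} (hul : G.Adj u l) (huk : G.Adj u k)
    (hlk : l ≠ k) (hal : G.Adj a l) (hau : a ≠ u) : ¬ G.Adj a k :=
  fun hak => hlk (h.eq hau hal hak hul huk)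

theorem exists_third (h : TightCubic G) {v x y : V} (hx : G.Adj v x) (hy : G.Adj v y)
    (hxy : x ≠ y) :
    ∃ z, z ≠ x ∧ z ≠ y ∧ G.Adj v z ∧ ∀ w, G.Adj v w → w = x ∨ w = y ∨ w = z := by
  obtain ⟨p, q, hpq, hpx, hqx, hp, hq, hall⟩ := exists_of_degree_three (h.degree v) hx
  rcases hall y hy with rfl | rfl | rfl
  · exact absurd rfl hxy
  · exact ⟨q, hqx, hpq.symm, hq, hall⟩
  · exact ⟨p, hpx, hpq, hp, fun w hw => (hall w hw).imp_right Or.symm⟩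

theorem slack_pick_three (h : TightCubic G) {s : ℤ} {X E : Finset V}
    (hs : SlackU (G.neighborFinset ·) s X E) {x : V} (hx : x ∈ X)
    (hE : ∀ e, G.Adj x e → e ∈ E) :
    SlackU (G.neighborFinset ·) s (X.erase x) (E.filter (x ∉ G.neighborFinset ·)) := by
  obtain ⟨e, he⟩ := (G.degree_pos_iff_exists_adj x).1 (by rw [h.degree]; lia)
  obtain ⟨f, g, hfg, hfe, hge, hf, hg, -⟩ := exists_of_degree_three (h.degree x) he
  exact hs.pick_three hx (hE e he) (hE f hf) (hE g hg) hfe.symm hge.symm hfg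
    (by simpa using he.symm) (by simpa using hf.symm) (by simpa using hg.symm)

theorem collinear_of_star (h : TightCubic G) {u l₁ l₂ l₃ a b s : V} (h₁ : G.Adj u l₁)
    (h₂ : G.Adj u l₂) (h₃ : G.Adj u l₃) (h₁₂ : l₁ ≠ l₂) (h₁₃ : l₁ ≠ l₃) (h₂₃ : l₂ ≠ l₃)
    (ha : G.Adj a l₁) (hau : a ≠ u) (hb : G.Adj b l₂) (hbu : b ≠ u) (hab : ¬ CommonNeighbor G a b)
    (hs : G.Adj s l₃) : CommonNeighbor G s a ∧ CommonNeighbor G s b := by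
  have ha3 := h.not_adj h₁ h₃ h₁₃ ha hau
  have hb3 := h.not_adj h₂ h₃ h₂₃ hb hbu
  have hne : b ≠ a := by rintro rfl; exact hab ⟨_, ha, ha⟩
  have hsa : s ≠ a := by rintro rfl; exact ha3 hs
  have hsb : s ≠ b := by rintro rfl; exact hb3 hs
  have hs1 := h.slack_pick_three h.slack (Finset.mem_univ a) (fun e _ => Finset.mem_univ e)
  have hU1 := h.uniform.pick a
  have hs2 := h.slack_pick_three hs1 (x := b) (by simpa using hne) (fun e he => by
    simp only [Finset.mem_filter, Finset.mem_univ, true_and, SimpleGraph.mem_neighborFinset]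
    exact fun hea => hab ⟨e, hea.symm, he⟩)
  have hU2 := hU1.pick b
  have hL2 := h.linear.mono (X' := (Finset.univ.erase a).erase b) (Finset.subset_univ _)
    (Finset.subset_univ ((Finset.univ.filter (a ∉ G.neighborFinset ·)).filter
      (b ∉ G.neighborFinset ·)))
  have key := fun f hf hsf => hs2.eq_of_linear hU2 hL2 (z := u) (e := l₃) (by simp [hau.symm,
    hbu.symm]) (by simp [G.adj_comm l₃, ha3, hb3]) (by simpa using h₃.symm) (fun f hf huf => by
      simp only [Finset.mem_filter, Finset.mem_univ, true_and,
        SimpleGraph.mem_neighborFinset] at hf huf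
      rcases eq_of_degree_three (h.degree u) h₁ h₂ h₃ h₁₂ h₁₃ h₂₃ huf.symm with rfl | rfl | rfl
      · exact absurd ha.symm hf.1
      · exact absurd hb.symm hf.2
      · rfl) (x := s) (by simp [hsa, hsb]) (by simpa using hs.symm) (f := f) hf hsf
  have key' : ∀ f, G.Adj s f → f ≠ l₃ → G.Adj a f ∨ G.Adj b f := by
    intro f hf hfl
    by_contra! hno
    exact hfl (key f (by simp [G.adj_comm f, hno]) (by simpa using hf.symm))
  obtain ⟨m, n, hmn, hm3, hn3, hm, hn, -⟩ := exists_of_degree_three (h.degree s) hs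
  rcases key' m hm hm3 with ham | hbm <;> rcases key' n hn hn3 with han | hbn
  · exact absurd (h.eq hsa hm hn ham han) hmn
  · exact ⟨⟨m, hm, ham⟩, ⟨n, hn, hbn⟩⟩
  · exact ⟨⟨n, hn, han⟩, ⟨m, hm, hbm⟩⟩
  · exact absurd (h.eq hsb hm hn hbm hbn) hmn

theorem collinear_of_not (h : TightCubic G) {u l₁ l₂ l₃ a a' b : V} (h₁ : G.Adj u l₁)
    (h₂ : G.Adj u l₂) (h₃ : G.Adj u l₃) (h₁₂ : l₁ ≠ l₂) (h₁₃ : l₁ ≠ l₃) (h₂₃ : l₂ ≠ l₃)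
    (ha : G.Adj a l₁) (hau : a ≠ u) (ha' : G.Adj a' l₁) (hau' : a' ≠ u) (haa' : a ≠ a')
    (hb : G.Adj b l₂) (hbu : b ≠ u) (hab : ¬ CommonNeighbor G a b) : CommonNeighbor G a' b := by
  by_contra hab'
  obtain ⟨s, -, -, hsu, -, hs, -, -⟩ := exists_of_degree_three (h.degree l₃) h₃.symm
  obtain ⟨⟨m, hsm, ham⟩, ⟨n, hsn, hbn⟩⟩ :=
    h.collinear_of_star h₁ h₂ h₃ h₁₂ h₁₃ h₂₃ ha hau hb hbu hab hs.symm
  obtain ⟨⟨m', hsm', ham'⟩, -⟩ :=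
    h.collinear_of_star h₁ h₂ h₃ h₁₂ h₁₃ h₂₃ ha' hau' hb hbu hab' hs.symm
  have hs1 := h.not_adj h₃ h₁ h₁₃.symm hs.symm hsu
  have h1 : l₃ ≠ m := by rintro rfl; exact h.not_adj h₁ h₃ h₁₃ ha hau ham
  have h2 : l₃ ≠ m' := by rintro rfl; exact h.not_adj h₁ h₃ h₁₃ ha' hau' ham'
  have h3 : l₃ ≠ n := by rintro rfl; exact h.not_adj h₂ h₃ h₂₃ hb hbu hbn
  have h4 : m ≠ m' := by
    rintro rfl
    rw [h.eq haa' ham ha ham' ha'] at hsm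
    exact hs1 hsm
  rcases eq_of_degree_three (h.degree s) hs.symm hsm hsm' h1 h2 h4 hsn with rfl | rfl | rfl
  · exact h3 rfl
  · exact hab ⟨_, ham, hbn⟩
  · exact hab' ⟨_, ham', hbn⟩

theorem exists_not_collinear (h : TightCubic G) (u : V) : ∃ l₁ l₂ l₃ a b, G.Adj u l₁ ∧
    G.Adj u l₂ ∧ G.Adj u l₃ ∧ l₁ ≠ l₂ ∧ l₁ ≠ l₃ ∧ l₂ ≠ l₃ ∧ G.Adj a l₁ ∧ a ≠ u ∧
    G.Adj b l₂ ∧ b ≠ u ∧ ¬ CommonNeighbor G a b := by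
  by_contra! hall
  obtain ⟨l₁, h₁⟩ := (G.degree_pos_iff_exists_adj u).1 (by rw [h.degree]; lia)
  obtain ⟨l₂, l₃, h₂₃, h₁₂, h₁₃, h₂, h₃, hlu⟩ := exists_of_degree_three (h.degree u) h₁
  obtain ⟨x, x', hxx', hxu, hxu', hx, hx', -⟩ := exists_of_degree_three (h.degree l₁) h₁.symm
  obtain ⟨y, y', hyy', hyu, hyu', hy, hy', -⟩ := exists_of_degree_three (h.degree l₂) h₂.symm
  obtain ⟨z, -, -, hzu, -, hz, -, -⟩ := exists_of_degree_three (h.degree l₃) h₃.symm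
  have hs1 := h.slack_pick_three h.slack (Finset.mem_univ u) (fun e _ => Finset.mem_univ e)
  obtain ⟨m, n, hmn, hm1, hn1, hm, hn, -⟩ := exists_of_degree_three (h.degree x) hx.symm
  obtain ⟨m', n', hmn', hm1', hn1', hm', hn', -⟩ := exists_of_degree_three (h.degree x') hx'.symm
  have hu : ∀ {e w}, G.Adj w l₁ → w ≠ u → G.Adj w e → e ≠ l₁ → ¬ G.Adj e u :=
    fun h1 h2 h3 h4 h5 => h4 (h.eq h2 h3 h1 h5.symm h₁)
  have hxe : ∀ {e}, G.Adj x' e → e ≠ l₁ → ¬ G.Adj e x :=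
    fun h3 h4 h5 => h4 (h.eq hxx'.symm h3 hx'.symm h5.symm hx.symm)
  have hs2 := hs1.pick_two (x := x) (e := m) (f := n) (by simpa using hxu)
    (by simpa using hu hx.symm hxu hm hm1) (by simpa using hu hx.symm hxu hn hn1) hmn
    (by simpa using hm.symm) (by simpa using hn.symm)
  have hs3 := hs2.pick_two (x := x') (e := m') (f := n') (by simp [hxx'.symm, hxu'])
    (by simp [hu hx'.symm hxu' hm' hm1', hxe hm' hm1'])
    (by simp [hu hx'.symm hxu' hn' hn1', hxe hn' hn1']) hmn'
    (by simpa using hm'.symm) (by simpa using hn'.symm)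
  have hU3 := ((h.uniform.pick u).pick x).pick x'
  have hne : ∀ {l w}, G.Adj u l → l ≠ l₁ → G.Adj l w → w ≠ u → ¬ G.Adj w l₁ :=
    fun h1 h2 h3 h4 => h.not_adj h1 h₁ h2 h3.symm h4
  have hout : ∀ {l k w}, G.Adj u l → G.Adj u k → l ≠ l₁ → l ≠ k → l₁ ≠ k → G.Adj l w → w ≠ u →
      ∀ e, G.Adj w e → G.Adj e u ∨ G.Adj e x ∨ G.Adj e x' := by
    intro l k w h1 h1k h2 hlk hk1 h3 h4 e he
    have hwn := hne h1 h2 h3 h4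
    obtain ⟨c, hxc, hwc⟩ := hall l₁ l k x w h₁ h1 h1k h2.symm hk1 hlk hx.symm hxu h3.symm h4
    obtain ⟨d, hxd, hwd⟩ := hall l₁ l k x' w h₁ h1 h1k h2.symm hk1 hlk hx'.symm hxu' h3.symm h4
    have hcl : l ≠ c := by
      rintro rfl
      exact hxu (by_contra fun hxu => h2 (h.eq hxu hxc hx.symm h1 h₁))
    have hdl : l ≠ d := by
      rintro rfl
      exact hxu' (by_contra fun hxu => h2 (h.eq hxu hxd hx'.symm h1 h₁))
    have hcd : c ≠ d := by
      rintro rfl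
      rw [h.eq hxx' hxc hx.symm hxd hx'.symm] at hwc
      exact hwn hwc
    rcases eq_of_degree_three (h.degree w) h3.symm hwc hwd hcl hdl hcd he with rfl | rfl | rfl
    · exact Or.inl h1.symm
    · exact Or.inr (Or.inl hxc.symm)
    · exact Or.inr (Or.inr hxd.symm)
  have hmem : ∀ {l w}, G.Adj u l → l ≠ l₁ → G.Adj l w → w ≠ u → w ≠ x ∧ w ≠ x' :=
    fun h1 h2 h3 h4 => ⟨by rintro rfl; exact hne h1 h2 h3 h4 hx.symm,
      by rintro rfl; exact hne h1 h2 h3 h4 hx'.symm⟩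
  have hy1 := hmem h₂ h₁₂ hy hyu
  have hy1' := hmem h₂ h₁₂ hy' hyu'
  have hz1 := hmem h₃ h₁₃ hz hzu
  have hzl : ¬ G.Adj z l₂ := h.not_adj h₃ h₂ h₂₃.symm hz.symm hzu
  have hzy : z ≠ y := by rintro rfl; exact hzl hy.symm
  have hzy' : z ≠ y' := by rintro rfl; exact hzl hy'.symm
  have hdrop : ∀ {l k w}, G.Adj u l → G.Adj u k → l ≠ l₁ → l ≠ k → l₁ ≠ k → G.Adj l w → w ≠ u →
      ∀ e ∈ ((Finset.univ.filter (u ∉ G.neighborFinset ·)).filter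
        (x ∉ G.neighborFinset ·)).filter (x' ∉ G.neighborFinset ·),
        w ∉ G.neighborFinset e := by
    intro l k w h1 h1k h2 hlk hk1 h3 h4 e he hwe
    simp only [Finset.mem_filter, Finset.mem_univ, true_and,
      SimpleGraph.mem_neighborFinset] at he hwe
    rcases hout h1 h1k h2 hlk hk1 h3 h4 e hwe.symm with hh | hh | hh
    · exact he.1.1 hh
    · exact he.1.2 hh
    · exact he.2 hh
  have hU := ((hU3.drop (hdrop h₂ h₃ h₁₂ h₂₃ h₁₃.symm hy hyu)).drop
    (hdrop h₂ h₃ h₁₂ h₂₃ h₁₃.symm hy' hyu')).drop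
    (hdrop h₃ h₂ h₁₃ h₂₃.symm h₁₂.symm hz hzu)
  have hs := ((hs3.drop (z := y) (by simp [hyu, hy1])).drop (z := y')
    (by simp [hyu', hy1', hyy'.symm])).drop (z := z) (by simp [hzu, hz1, hzy, hzy'])
  have := hs.nonneg hU
  lia

/-- Given two vertices without common neighbor, reconstruct the Möbius–Kantor configuration. -/
theorem exists_mobiusKantor_of_spread (h : TightCubic G) {u l₁ l₂ l₃ a b a' z s t As At Bs Bt : V}
    (h₁ : G.Adj u l₁) (h₂ : G.Adj u l₂) (h₃ : G.Adj u l₃) (h₁₂ : l₁ ≠ l₂) (h₁₃ : l₁ ≠ l₃)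
    (h₂₃ : l₂ ≠ l₃) (ha : G.Adj a l₁) (hau : a ≠ u) (hb : G.Adj b l₂) (hbu : b ≠ u)
    (hab : ¬ CommonNeighbor G a b) (ha' : G.Adj a' l₁) (hau' : a' ≠ u) (haa' : a' ≠ a)
    (hz : G.Adj z l₂) (hzu : z ≠ u) (hzb : z ≠ b) (hs : G.Adj s l₃) (hsu : s ≠ u)
    (ht : G.Adj t l₃) (htu : t ≠ u) (hst : s ≠ t) (hsA : G.Adj s As) (haAs : G.Adj a As)
    (htA : G.Adj t At) (haAt : G.Adj a At) (hsB : G.Adj s Bs) (hbBs : G.Adj b Bs)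
    (htB : G.Adj t Bt) (hbBt : G.Adj b Bt) (hzA : G.Adj z As) (haB' : CommonNeighbor G a' b) :
    ∃ p l : Fin 8 → V, MobiusKantor G p l := by
  have ha2 := h.not_adj h₁ h₂ h₁₂ ha hau
  have ha3 := h.not_adj h₁ h₃ h₁₃ ha hau
  have ha2' := h.not_adj h₁ h₂ h₁₂ ha' hau'
  have ha3' := h.not_adj h₁ h₃ h₁₃ ha' hau'
  have hb1 := h.not_adj h₂ h₁ h₁₂.symm hb hbu
  have hb3 := h.not_adj h₂ h₃ h₂₃ hb hbu
  have hz1 := h.not_adj h₂ h₁ h₁₂.symm hz hzu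
  have hz3 := h.not_adj h₂ h₃ h₂₃ hz hzu
  have hs1 := h.not_adj h₃ h₁ h₁₃.symm hs hsu
  have hs2 := h.not_adj h₃ h₂ h₂₃.symm hs hsu
  have ht1 := h.not_adj h₃ h₁ h₁₃.symm ht htu
  have ht2 := h.not_adj h₃ h₂ h₂₃.symm ht htu
  have hAs1 : As ≠ l₁ := by rintro rfl; exact hs1 hsA
  have hAt1 : At ≠ l₁ := by rintro rfl; exact ht1 htA
  have hBs2 : Bs ≠ l₂ := by rintro rfl; exact hs2 hsB
  have hBt2 : Bt ≠ l₂ := by rintro rfl; exact ht2 htB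
  have hAt3 : At ≠ l₃ := by rintro rfl; exact ha3 haAt
  have hBt3 : Bt ≠ l₃ := by rintro rfl; exact hb3 hbBt
  have hBs3 : Bs ≠ l₃ := by rintro rfl; exact hb3 hbBs
  have hAA : As ≠ At := by
    rintro rfl
    exact hAt3 (h.eq hst hsA hs htA ht)
  have hBB : Bs ≠ Bt := by
    rintro rfl
    exact hBt3 (h.eq hst hsB hs htB ht)
  have hAtBt : At ≠ Bt := by rintro rfl; exact hab ⟨_, haAt, hbBt⟩
  have hab_ne : a ≠ b := by rintro rfl; exact ha2 hb
  have haz : a ≠ z := by rintro rfl; exact ha2 hz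
  have has : a ≠ s := by rintro rfl; exact ha3 hs
  have hat : a ≠ t := by rintro rfl; exact ha3 ht
  have ha_b : a' ≠ b := by rintro rfl; exact ha2' hb
  have ha_z : a' ≠ z := by rintro rfl; exact ha2' hz
  have ha_s : a' ≠ s := by rintro rfl; exact ha3' hs
  have ha_t : a' ≠ t := by rintro rfl; exact ha3' ht
  have hbs : b ≠ s := by rintro rfl; exact hb3 hs
  have hbt : b ≠ t := by rintro rfl; exact hb3 ht
  have hzs : z ≠ s := by rintro rfl; exact hz3 hs
  have hzt : z ≠ t := by rintro rfl; exact hz3 ht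
  obtain ⟨w, hwa, hwt, hwA, -⟩ := h.exists_third haAt.symm htA.symm hat
  have hwA := hwA.symm
  have hwu : w ≠ u := by
    rintro rfl
    exact hAt1 (h.eq hau.symm hwA h₁ haAt ha)
  have hwb : w ≠ b := by rintro rfl; exact hab ⟨_, haAt, hwA⟩
  have hwz : w ≠ z := by
    rintro rfl
    exact hAA (h.eq hwa hzA hwA haAs haAt)
  have hws : w ≠ s := by
    rintro rfl
    exact hAA (h.eq hwa hsA hwA haAs haAt)
  have hwa' : w ≠ a' := by
    rintro rfl
    exact hAt1 (h.eq hwa hwA ha' haAt ha)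
  have hw1 : ¬ G.Adj w l₁ := fun hw => hAt1 (h.eq hwa hwA hw haAt ha)
  have hw2 : ¬ G.Adj w l₂ := by
    intro hw
    rcases eq_of_degree_three (h.degree l₂) h₂.symm hb.symm hz.symm hbu.symm hzu.symm hzb.symm
      hw.symm with rfl | rfl | rfl
    · exact hwu rfl
    · exact hwb rfl
    · exact hwz rfl
  have hwBt : ¬ G.Adj w Bt := fun hw => hAtBt (h.eq hwt hwA hw htA htB)
  have hwBs : G.Adj w Bs := by
    obtain ⟨m, hwm, hbm⟩ := h.collinear_of_not htA htB ht hAtBt hAt3 hBt3 haAt hat hwA hwt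
      hwa.symm hbBt hbt hab
    rcases eq_of_degree_three (h.degree b) hb hbBs hbBt hBs2.symm hBt2.symm hBB hbm with
      rfl | rfl | rfl
    · exact absurd hwm hw2
    · exact hwm
    · exact absurd hwm hwBt
  have ha_As : ¬ G.Adj a' As := fun hh => hAs1 (h.eq haa' hh ha' haAs ha)
  have ha_Bs : ¬ G.Adj a' Bs := by
    intro hh
    rcases eq_of_degree_three (h.degree Bs) hbBs.symm hsB.symm hwBs.symm hbs hwb.symm hws.symm
      hh.symm with rfl | rfl | rfl
    · exact ha_b rfl
    · exact ha_s rfl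
    · exact hwa' rfl
  have ha_Bt : G.Adj a' Bt := by
    obtain ⟨m, ham, hbm⟩ := haB'
    rcases eq_of_degree_three (h.degree b) hb hbBs hbBt hBs2.symm hBt2.symm hBB hbm with
      rfl | rfl | rfl
    · exact absurd ham ha2'
    · exact absurd ham ha_Bs
    · exact ham
  have hAsBs : As ≠ Bs := by rintro rfl; exact hab ⟨_, haAs, hbBs⟩
  have hAs3 : As ≠ l₃ := by rintro rfl; exact ha3 haAs
  have hsa' : ¬ CommonNeighbor G s a' := by
    rintro ⟨m, hsm, ham⟩
    rcases eq_of_degree_three (h.degree s) hs hsA hsB hAs3.symm hBs3.symm hAsBs hsm with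
      rfl | rfl | rfl
    · exact ha3' ham
    · exact ha_As ham
    · exact ha_Bs ham
  have hBt1 : l₁ ≠ Bt := by rintro rfl; exact ht1 htB
  obtain ⟨M, hM1, hMB, hM, ha_M⟩ := h.exists_third ha' ha_Bt hBt1
  have hzM : G.Adj z M := by
    obtain ⟨m, hzm, ham⟩ := (h.collinear_of_star h₃ h₁ h₂ h₁₃.symm h₂₃.symm h₁₂ hs hsu ha' hau' hsa'
      hz).2
    rcases ha_M m ham with rfl | rfl | rfl
    · exact absurd hzm hz1
    · exact absurd (h.eq hzb hzm hz hbBt hb) hBt2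
    · exact hzm
  have hwM : G.Adj w M := by
    obtain ⟨m, hwm, ham⟩ := h.collinear_of_not hbBs hbBt hb hBB hBs2 hBt2 hsB hbs.symm hwBs hwb
      hws.symm ha_Bt ha_b hsa'
    rcases ha_M m ham with rfl | rfl | rfl
    · exact absurd hwm hw1
    · exact absurd hwm hwBt
    · exact hwm
  refine ⟨![u, a, t, a', w, b, z, s], ![l₁, At, Bt, M, Bs, l₂, As, l₃], ⟨?_, ?_, ?_, ?_⟩⟩
  · have key : ([u, a, t, a', w, b, z, s] : List V).Nodup := by
      simp [hau.symm, htu.symm, hau'.symm, hwu.symm, hbu.symm, hzu.symm, hsu.symm, hat, haa'.symm,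
        hwa.symm, hab_ne, haz, has, ha_t.symm, hwt.symm, hbt.symm, hzt.symm, hst.symm, hwa'.symm,
        ha_b, ha_z, ha_s, hwb, hwz, hws, hzb.symm, hbs, hzs]
    have := List.nodup_iff_injective_get.1 key
    intro i j hij
    refine this ?_
    fin_cases i <;> fin_cases j <;> first | rfl | exact hij
  · simp [Fin.forall_fin_succ, h₁, haAt, htB, hM, hwBs, hb, hzA, hs]
  · simp [Fin.forall_fin_succ, ha, htA, ha_Bt, hwM, hbBs, hz, hsA, h₃]
  · simp [Fin.forall_fin_succ, ha', hwA, hbBt, hzM, hsB, h₂, haAs, ht]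

theorem exists_mobiusKantor (h : TightCubic G) (u : V) :
    ∃ p l : Fin 8 → V, MobiusKantor G p l := by
  obtain ⟨l₁, l₂, l₃, a, b, h₁, h₂, h₃, h₁₂, h₁₃, h₂₃, ha, hau, hb, hbu, hab⟩ :=
    h.exists_not_collinear u
  obtain ⟨a', hau', haa', ha', -⟩ := h.exists_third h₁.symm ha.symm hau.symm
  obtain ⟨z, hzu, hzb, hz, -⟩ := h.exists_third h₂.symm hb.symm hbu.symm
  obtain ⟨s, t, hst, hsu, htu, hs, ht, -⟩ := exists_of_degree_three (h.degree l₃) h₃.symm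
  obtain ⟨⟨As, hsA, haAs⟩, ⟨Bs, hsB, hbBs⟩⟩ :=
    h.collinear_of_star h₁ h₂ h₃ h₁₂ h₁₃ h₂₃ ha hau hb hbu hab hs.symm
  obtain ⟨⟨At, htA, haAt⟩, ⟨Bt, htB, hbBt⟩⟩ :=
    h.collinear_of_star h₁ h₂ h₃ h₁₂ h₁₃ h₂₃ ha hau hb hbu hab ht.symm
  have haB' := h.collinear_of_not h₁ h₂ h₃ h₁₂ h₁₃ h₂₃ ha hau ha'.symm hau' haa'.symm hb hbu hab
  obtain ⟨m, hzm, ham⟩ := h.collinear_of_not h₂ h₁ h₃ h₁₂.symm h₂₃ h₁₃ hb hbu hz.symm hzu hzb.symm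
    ha hau (fun hh => hab hh.symm)
  have hz1 := h.not_adj h₂ h₁ h₁₂.symm hz.symm hzu
  have hs1 := h.not_adj h₃ h₁ h₁₃.symm hs.symm hsu
  have ht1 := h.not_adj h₃ h₁ h₁₃.symm ht.symm htu
  have ha3 := h.not_adj h₁ h₃ h₁₃ ha hau
  have hAs1 : l₁ ≠ As := by rintro rfl; exact hs1 hsA
  have hAt1 : l₁ ≠ At := by rintro rfl; exact ht1 htA
  have hAA : As ≠ At := by
    rintro rfl
    rw [h.eq hst hsA hs.symm htA ht.symm] at haAs
    exact ha3 haAs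
  rcases eq_of_degree_three (h.degree a) ha haAs haAt hAs1 hAt1 hAA ham with rfl | rfl | rfl
  · exact absurd hzm hz1
  · exact h.exists_mobiusKantor_of_spread h₁ h₂ h₃ h₁₂ h₁₃ h₂₃ ha hau hb hbu hab ha'.symm hau' haa'
      hz.symm hzu hzb hs.symm hsu ht.symm htu hst hsA haAs htA haAt hsB hbBs htB hbBt hzm haB'
  · exact h.exists_mobiusKantor_of_spread h₁ h₂ h₃ h₁₂ h₁₃ h₂₃ ha hau hb hbu hab ha'.symm hau' haa'
      hz.symm hzu hzb ht.symm htu hs.symm hsu hst.symm htA haAt hsA haAs htB hbBt hsB hbBs hzm haB'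

end TightCubic

theorem TightGraph.exists_iso_of_not_square (hT : TightGraph G) (hconn : G.Connected)
    (h3 : ∀ v, G.degree v = 3)
    (hC : ∀ x y e f, x ≠ y → G.Adj x e → G.Adj x f → G.Adj y e → G.Adj y f → e = f) :
    Nonempty (G ≃g GP16) := by
  obtain ⟨u⟩ := hconn.nonempty
  obtain ⟨p, l, h⟩ := (hT.tightCubic h3 hC).exists_mobiusKantor u
  exact h.exists_iso hconn h3 (h.ne_line hconn h3 hC)

end TightCubic

section Converse

variable {V : Type*} [Fintype V] [DecidableEq V] {G : SimpleGraph V} [DecidableRel G.Adj]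

/-- A criterion for equality in terms of a table of degrees of an isomorphic graph. -/
theorem card_edgeFinset_eq_of_iso {W : Type*} [Fintype W] [DecidableEq W] {K : SimpleGraph W}
    (e : G ≃g K) (hconn : G.Connected) (hn : 3 ≤ Fintype.card V) {Δ : ℕ}
    (hΔ2 : G.maxDegree = 2 → Δ = 3) (hΔ3 : 3 ≤ G.maxDegree → Δ = G.maxDegree) (d : W → ℕ)
    (hle : ∀ w, ∃ x y z, ∀ v, K.Adj w v → v = x ∨ v = y ∨ v = z)
    (hge : ∀ w, ∃ L : Finset W, (∀ v ∈ L, K.Adj w v) ∧ d w ≤ L.card)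
    (hdom : ∀ c : W → ℕ, (∀ w, ∃ u, K.Adj w u ∧ 0 < c u) →
      6 * Fintype.card W ≤ ∑ w, d w + 6 * ∑ w, c w) :
    G.edgeFinset.card = Δ * (Fintype.card V - totalDominationNumber G) := by
  have hmax : G.maxDegree ≤ 3 := by
    refine G.maxDegree_le_of_forall_degree_le 3 fun v => ?_
    obtain ⟨x, y, z, h⟩ := hle (e v)
    rw [← SimpleGraph.card_neighborFinset_eq_degree,
      ← Finset.card_image_of_injective _ e.injective]
    refine (Finset.card_le_card (t := {x, y, z}) fun u hu => ?_).trans Finset.card_le_three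
    obtain ⟨u, hu, rfl⟩ := Finset.mem_image.1 hu
    simpa using h _ (e.map_adj_iff.2 (by simpa using hu))
  have hmin := two_le_maxDegree hconn hn
  have hΔ : Δ = 3 := by
    rcases Nat.lt_or_ge G.maxDegree 3 with h | h
    · exact hΔ2 (by lia)
    · rw [hΔ3 h]; lia
  subst hΔ
  refine le_antisymm (card_edgeFinset_le hconn hn le_rfl hmax) ?_
  have h0 : IsTotalDominating G Finset.univ := fun v => by
    obtain ⟨u, hu⟩ := (G.degree_pos_iff_exists_adj v).1 (degree_pos_of_connected hconn hn v)
    exact ⟨u, Finset.mem_univ u, hu⟩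
  obtain ⟨S, hS, hcard⟩ := exists_card_eq_totalDominationNumber h0
  have h1 := hdom (fun w => if e.symm w ∈ S then 1 else 0) fun w => by
    obtain ⟨u, hu, hwu⟩ := hS (e.symm w)
    refine ⟨e u, ?_, by simp [hu]⟩
    simpa using e.map_adj_iff.2 hwu
  have h2 : ∑ w, (if e.symm w ∈ S then 1 else 0) = S.card := by
    refine (e.symm.toEquiv.sum_comp (fun v => if v ∈ S then 1 else 0)).trans ?_
    simp
  have h3 : ∑ w, d w ≤ ∑ w, G.degree (e.symm w) := by
    refine Finset.sum_le_sum fun w _ => ?_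
    obtain ⟨L, hL, hd⟩ := hge w
    rw [← SimpleGraph.card_neighborFinset_eq_degree]
    refine hd.trans ?_
    rw [← Finset.card_image_of_injective L e.symm.injective]
    refine Finset.card_le_card fun v hv => ?_
    obtain ⟨u, hu, rfl⟩ := Finset.mem_image.1 hv
    simpa using e.symm.map_adj_iff.2 (hL u hu)
  have h4 : ∑ w, G.degree (e.symm w) = 2 * G.edgeFinset.card := by
    rw [← G.sum_degrees_eq_twice_card_edges]
    exact e.symm.toEquiv.sum_comp (fun v => G.degree v)
  have h5 := Fintype.card_congr e.toEquiv
  rw [h2] at h1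
  lia

theorem add_one_le_sum_of_two_le (t : ℕ → ℕ) (n : ℕ) (h : ∀ i < n, 2 ≤ 2 * t (i + 1) + t i) :
    n + 1 + (if 2 ≤ t n then 1 else 0) ≤ ∑ i ∈ Finset.range (n + 1), t i +
      (if t 0 = 0 then 1 else 0) := by
  induction n with
  | zero => simp; split_ifs <;> lia
  | succ n ih =>
    have h1 := ih fun i hi => h i (by lia)
    have h2 := h n (by lia)
    rw [Finset.sum_range_succ]
    split_ifs at h1 ⊢ <;> lia

theorem card_edgeFinset_eq_of_iso_corona {k : ℕ} (hk : 3 ≤ k) (e : G ≃g coronaGraph k)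
    (hconn : G.Connected) (hn : 3 ≤ Fintype.card V) {Δ : ℕ}
    (hΔ2 : G.maxDegree = 2 → Δ = 3) (hΔ3 : 3 ≤ G.maxDegree → Δ = G.maxDegree) :
    G.edgeFinset.card = Δ * (Fintype.card V - totalDominationNumber G) := by
  have hnext : ∀ i : Fin k, ((i : ℕ) + 1) % k < k := fun i => Nat.mod_lt _ (by lia)
  have hprev : ∀ i : Fin k, ((i : ℕ) + (k - 1)) % k < k := fun i => Nat.mod_lt _ (by lia)
  have hnp : ∀ i : Fin k, (((i : ℕ) + (k - 1)) % k + 1) % k = i := fun i => by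
    have := i.2
    rw [Nat.mod_add_mod, show (i : ℕ) + (k - 1) + 1 = i + k by lia, Nat.add_mod_right,
      Nat.mod_eq_of_lt this]
  have hpn : ∀ i j : Fin k, (i : ℕ) = (j + 1) % k → (j : ℕ) = (i + (k - 1)) % k := fun i j h => by
    have := j.2
    rw [h, Nat.mod_add_mod, show (j : ℕ) + 1 + (k - 1) = j + k by lia, Nat.add_mod_right,
      Nat.mod_eq_of_lt this]
  have hadj : ∀ w v : Fin 3 × Fin k, (coronaGraph k).Adj w v →
      (w.1 = 0 ∧ (v = (1, w.2) ∨ v = (0, ⟨_, hnext w.2⟩) ∨ v = (0, ⟨_, hprev w.2⟩))) ∨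
      (w.1 = 1 ∧ (v = (0, w.2) ∨ v = (2, w.2))) ∨ (w.1 = 2 ∧ v = (1, w.2)) := by
    rintro ⟨a, i⟩ ⟨b, j⟩ ⟨-, (⟨rfl, rfl, h⟩ | ⟨rfl, rfl, rfl⟩ | ⟨rfl, rfl, rfl⟩) |
      (⟨rfl, rfl, h⟩ | ⟨rfl, rfl, rfl⟩ | ⟨rfl, rfl, rfl⟩)⟩
    · exact Or.inl ⟨rfl, Or.inr (Or.inl (Prod.ext rfl (Fin.ext h)))⟩
    · exact Or.inl ⟨rfl, Or.inl rfl⟩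
    · exact Or.inr (Or.inl ⟨rfl, Or.inr rfl⟩)
    · exact Or.inl ⟨rfl, Or.inr (Or.inr (Prod.ext rfl (Fin.ext (hpn _ _ h))))⟩
    · exact Or.inr (Or.inl ⟨rfl, Or.inl rfl⟩)
    · exact Or.inr (Or.inr ⟨rfl, rfl⟩)
  have h01 : ∀ i : Fin k, (coronaGraph k).Adj (0, i) (1, i) := fun i =>
    ⟨by simp, Or.inl (Or.inr (Or.inl ⟨rfl, rfl, rfl⟩))⟩
  have h12 : ∀ i : Fin k, (coronaGraph k).Adj (1, i) (2, i) := fun i =>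
    ⟨by simp, Or.inl (Or.inr (Or.inr ⟨rfl, rfl, rfl⟩))⟩
  have hcyc : ∀ i j : Fin k, (j : ℕ) = (i + 1) % k → (coronaGraph k).Adj (0, i) (0, j) := by
    intro i j h
    refine ⟨fun he => ?_, Or.inl (Or.inl ⟨rfl, rfl, h⟩)⟩
    obtain rfl := (Prod.ext_iff.1 he).2
    have := i.2
    rcases Nat.lt_or_ge ((i : ℕ) + 1) k with hlt | hge
    · rw [Nat.mod_eq_of_lt hlt] at h
      lia
    · rw [show (i : ℕ) + 1 = k by lia, Nat.mod_self] at h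
      lia
  have hsum : ∀ f : Fin 3 × Fin k → ℕ, ∑ w, f w = ∑ i : Fin k, (f (0, i) + f (1, i) + f (2, i)) := by
    intro f
    rw [Fintype.sum_prod_type_right]
    exact Finset.sum_congr rfl fun i _ => Fin.sum_univ_three _
  refine card_edgeFinset_eq_of_iso e hconn hn hΔ2 hΔ3 (fun w => 3 - w.1) ?_ ?_ ?_
  · intro w
    obtain ⟨a, i⟩ := w
    fin_cases a
    · refine ⟨(1, i), (0, ⟨_, hnext i⟩), (0, ⟨_, hprev i⟩), fun v hv => ?_⟩
      rcases hadj _ _ hv with h | h | h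
      · exact h.2
      · exact absurd h.1 (by simp)
      · exact absurd h.1 (by simp)
    · refine ⟨(0, i), (2, i), (2, i), fun v hv => ?_⟩
      rcases hadj _ _ hv with h | h | h
      · exact absurd h.1 (by simp)
      · exact h.2.imp_right Or.inl
      · exact absurd h.1 (by simp)
    · refine ⟨(1, i), (1, i), (1, i), fun v hv => ?_⟩
      rcases hadj _ _ hv with h | h | h
      · exact absurd h.1 (by simp)
      · exact absurd h.1 (by simp)
      · exact Or.inl h.2
  · rintro ⟨a, i⟩
    fin_cases a
    · refine exists_finset_of_three (h01 i) (hcyc i ⟨_, hnext i⟩ rfl)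
        (hcyc ⟨_, hprev i⟩ i (hnp i).symm).symm (by simp) (by simp) ?_
      simp only [ne_eq, Prod.mk.injEq, true_and, Fin.mk.injEq]
      have := i.2
      rcases Nat.lt_or_ge ((i : ℕ) + 1) k with hlt | hge
      · rw [Nat.mod_eq_of_lt hlt]
        rcases Nat.eq_zero_or_pos (i : ℕ) with h0 | h0
        · rw [h0, Nat.mod_eq_of_lt (by lia)]
          lia
        · rw [show (i : ℕ) + (k - 1) = (i - 1) + k by lia, Nat.add_mod_right,
            Nat.mod_eq_of_lt (by lia)]
          lia
      · rw [show (i : ℕ) + 1 = k by lia, Nat.mod_self,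
          show (i : ℕ) + (k - 1) = (k - 2) + k by lia, Nat.add_mod_right,
            Nat.mod_eq_of_lt (by lia)]
        lia
    · exact exists_finset_of_two (h01 i).symm (h12 i) (by simp)
    · exact ⟨{(1, i)}, by simpa using (h12 i).symm, by simp⟩
  · intro c hc
    rw [hsum, hsum]
    simp only [Fintype.card_prod, Fintype.card_fin]
    have h2 : ∑ i : Fin k, 2 ≤ ∑ i : Fin k, (c (0, i) + c (1, i) + c (2, i)) := by
      refine Finset.sum_le_sum fun i _ => ?_
      obtain ⟨u, hu, hu0⟩ := hc (2, i)
      obtain ⟨v, hv, hv0⟩ := hc (1, i)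
      rcases hadj _ _ hu with h | h | ⟨-, rfl⟩
      · exact absurd h.1 (by simp)
      · exact absurd h.1 (by simp)
      simp only at hu0
      rcases hadj _ _ hv with h | ⟨-, rfl | rfl⟩ | h
      · exact absurd h.1 (by simp)
      · simp only at hv0; lia
      · simp only at hv0; lia
      · exact absurd h.1 (by simp)
    simp at h2 ⊢
    lia

end Converse

section ChainConverse

variable {W : Type*} [Fintype W] [DecidableEq W] {K : SimpleGraph W} {k : ℕ}
  {ι : Fin 4 × Fin k → W} {x : Fin 4 → W}

theorem gkBase_ne {p q : Fin 4 × Fin k} (h : gkBase k p q) : p ≠ q := by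
  rintro rfl
  rcases h with h | h | h | h | h | h
  all_goals
    have h1 := h.1.symm.trans h.2.1
    exact absurd h1 (by decide)

theorem eq_of_gkBase_zero {i : Fin k} {q : Fin 4 × Fin k}
    (h : gkBase k (0, i) q ∨ gkBase k q (0, i)) :
    q = (1, i) ∨ q = (3, i) ∨ (q.1 = 1 ∧ (q.2 : ℕ) + 1 = i) := by
  obtain ⟨j, i'⟩ := q
  rcases h with h | h <;> simp [gkBase] at h ⊢ <;> lia

theorem eq_of_gkBase_one {i : Fin k} {q : Fin 4 × Fin k}
    (h : gkBase k (1, i) q ∨ gkBase k q (1, i)) :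
    q = (0, i) ∨ q = (2, i) ∨ (q.1 = 0 ∧ (i : ℕ) + 1 = q.2) := by
  obtain ⟨j, i'⟩ := q
  rcases h with h | h <;> simp [gkBase] at h ⊢ <;> lia

theorem eq_of_gkBase_two {i : Fin k} {q : Fin 4 × Fin k}
    (h : gkBase k (2, i) q ∨ gkBase k q (2, i)) :
    q = (3, i) ∨ q = (1, i) ∨ (q.1 = 3 ∧ (q.2 : ℕ) + 1 = i) := by
  obtain ⟨j, i'⟩ := q
  rcases h with h | h <;> simp [gkBase] at h ⊢ <;> lia

theorem eq_of_gkBase_three {i : Fin k} {q : Fin 4 × Fin k}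
    (h : gkBase k (3, i) q ∨ gkBase k q (3, i)) :
    q = (2, i) ∨ q = (0, i) ∨ (q.1 = 2 ∧ (i : ℕ) + 1 = q.2) := by
  obtain ⟨j, i'⟩ := q
  rcases h with h | h <;> simp [gkBase] at h ⊢ <;> lia

/-- The four end vertices of the chain of blocks. -/
def gkEnd (k : ℕ) (p : Fin 4 × Fin k) : Prop :=
  ((p.1 = 0 ∨ p.1 = 2) ∧ (p.2 : ℕ) = 0) ∨ ((p.1 = 1 ∨ p.1 = 3) ∧ (p.2 : ℕ) = k - 1)

/-- The end vertices of the chain `ι` have the further neighbors `x`, and there are no other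
edges at the chain. -/
def IsChainGraph (K : SimpleGraph W) (ι : Fin 4 × Fin k → W) (x : Fin 4 → W) : Prop :=
  ∀ p w, K.Adj (ι p) w →
    (∃ q, w = ι q ∧ (gkBase k p q ∨ gkBase k q p)) ∨ (gkEnd k p ∧ w = x p.1)

namespace IsChainGraph

theorem eq_zero (h : IsChainGraph K ι x) {i : Fin k} {w : W} (hw : K.Adj (ι (0, i)) w) :
    w = ι (1, i) ∨ w = ι (3, i) ∨ ((i : ℕ) = 0 ∧ w = x 0) ∨
      ∃ i' : Fin k, (i' : ℕ) + 1 = i ∧ w = ι (1, i') := by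
  rcases h _ _ hw with ⟨⟨j, i'⟩, rfl, hq⟩ | ⟨he, hx⟩
  · rcases eq_of_gkBase_zero hq with hq | hq | ⟨rfl, hq⟩
    · exact Or.inl (congrArg ι hq)
    · exact Or.inr (Or.inl (congrArg ι hq))
    · exact Or.inr (Or.inr (Or.inr ⟨i', hq, rfl⟩))
  · exact Or.inr (Or.inr (Or.inl ⟨by simpa [gkEnd] using he, hx⟩))

theorem eq_one (h : IsChainGraph K ι x) {i : Fin k} {w : W} (hw : K.Adj (ι (1, i)) w) :
    w = ι (0, i) ∨ w = ι (2, i) ∨ ((i : ℕ) = k - 1 ∧ w = x 1) ∨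
      ∃ i' : Fin k, (i : ℕ) + 1 = i' ∧ w = ι (0, i') := by
  rcases h _ _ hw with ⟨⟨j, i'⟩, rfl, hq⟩ | ⟨he, hx⟩
  · rcases eq_of_gkBase_one hq with hq | hq | ⟨rfl, hq⟩
    · exact Or.inl (congrArg ι hq)
    · exact Or.inr (Or.inl (congrArg ι hq))
    · exact Or.inr (Or.inr (Or.inr ⟨i', hq, rfl⟩))
  · exact Or.inr (Or.inr (Or.inl ⟨by simpa [gkEnd] using he, hx⟩))

theorem eq_two (h : IsChainGraph K ι x) {i : Fin k} {w : W} (hw : K.Adj (ι (2, i)) w) :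
    w = ι (3, i) ∨ w = ι (1, i) ∨ ((i : ℕ) = 0 ∧ w = x 2) ∨
      ∃ i' : Fin k, (i' : ℕ) + 1 = i ∧ w = ι (3, i') := by
  rcases h _ _ hw with ⟨⟨j, i'⟩, rfl, hq⟩ | ⟨he, hx⟩
  · rcases eq_of_gkBase_two hq with hq | hq | ⟨rfl, hq⟩
    · exact Or.inl (congrArg ι hq)
    · exact Or.inr (Or.inl (congrArg ι hq))
    · exact Or.inr (Or.inr (Or.inr ⟨i', hq, rfl⟩))
  · exact Or.inr (Or.inr (Or.inl ⟨by simpa [gkEnd] using he, hx⟩))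

theorem eq_three (h : IsChainGraph K ι x) {i : Fin k} {w : W} (hw : K.Adj (ι (3, i)) w) :
    w = ι (2, i) ∨ w = ι (0, i) ∨ ((i : ℕ) = k - 1 ∧ w = x 3) ∨
      ∃ i' : Fin k, (i : ℕ) + 1 = i' ∧ w = ι (2, i') := by
  rcases h _ _ hw with ⟨⟨j, i'⟩, rfl, hq⟩ | ⟨he, hx⟩
  · rcases eq_of_gkBase_three hq with hq | hq | ⟨rfl, hq⟩
    · exact Or.inl (congrArg ι hq)
    · exact Or.inr (Or.inl (congrArg ι hq))
    · exact Or.inr (Or.inr (Or.inr ⟨i', hq, rfl⟩))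
  · exact Or.inr (Or.inr (Or.inl ⟨by simpa [gkEnd] using he, hx⟩))

/-- The third neighbor below. -/
theorem exists_left {j : Fin 4} {y : W} (i : Fin k) : ∃ t, ∀ w, (((i : ℕ) = 0 ∧ w = y) ∨
    ∃ i' : Fin k, (i' : ℕ) + 1 = i ∧ w = ι (j, i')) → w = t := by
  by_cases hi : (i : ℕ) = 0
  · refine ⟨y, ?_⟩
    rintro w (⟨-, rfl⟩ | ⟨i', h, -⟩)
    · rfl
    · lia
  · refine ⟨ι (j, ⟨i - 1, by lia⟩), ?_⟩
    rintro w (⟨h, -⟩ | ⟨i', h, rfl⟩)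
    · exact absurd h hi
    · exact congrArg (fun a => ι (j, a)) (Fin.ext (by simp only; lia))

/-- The third neighbor above. -/
theorem exists_right {j : Fin 4} {y : W} (i : Fin k) : ∃ t, ∀ w, (((i : ℕ) = k - 1 ∧ w = y) ∨
    ∃ i' : Fin k, (i : ℕ) + 1 = i' ∧ w = ι (j, i')) → w = t := by
  by_cases hi : (i : ℕ) = k - 1
  · refine ⟨y, ?_⟩
    rintro w (⟨-, rfl⟩ | ⟨i', h, -⟩)
    · rfl
    · lia
  · refine ⟨ι (j, ⟨i + 1, by lia⟩), ?_⟩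
    rintro w (⟨h, -⟩ | ⟨i', h, rfl⟩)
    · exact absurd h hi
    · exact congrArg (fun a => ι (j, a)) (Fin.ext (by simp only; lia))

theorem exists_three (h : IsChainGraph K ι x) (p : Fin 4 × Fin k) :
    ∃ y z t, ∀ w, K.Adj (ι p) w → w = y ∨ w = z ∨ w = t := by
  obtain ⟨j, i⟩ := p
  fin_cases j
  · obtain ⟨t, ht⟩ := exists_left (ι := ι) (j := 1) (y := x 0) i
    exact ⟨_, _, t, fun w hw => (h.eq_zero hw).imp_right fun h' => h'.imp_right (ht w)⟩
  · obtain ⟨t, ht⟩ := exists_right (ι := ι) (j := 0) (y := x 1) i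
    exact ⟨_, _, t, fun w hw => (h.eq_one hw).imp_right fun h' => h'.imp_right (ht w)⟩
  · obtain ⟨t, ht⟩ := exists_left (ι := ι) (j := 3) (y := x 2) i
    exact ⟨_, _, t, fun w hw => (h.eq_two hw).imp_right fun h' => h'.imp_right (ht w)⟩
  · obtain ⟨t, ht⟩ := exists_right (ι := ι) (j := 2) (y := x 3) i
    exact ⟨_, _, t, fun w hw => (h.eq_three hw).imp_right fun h' => h'.imp_right (ht w)⟩

/-- A lower bound for the weight of a total domination on a chain of blocks. -/
theorem le_sum (h : IsChainGraph K ι x) {n : ℕ} (hk : k = n + 1) {c : W → ℕ}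
    (hc : ∀ w, ∃ u, K.Adj w u ∧ 0 < c u) {first last : Fin k} (hf : (first : ℕ) = 0)
    (hl : (last : ℕ) = k - 1) :
    2 ≤ 2 * (c (ι (1, first)) + c (ι (3, first))) + (c (x 0) + c (x 2)) ∧
    2 ≤ 2 * (c (ι (0, last)) + c (ι (2, last))) + (c (x 1) + c (x 3)) ∧
    2 * k + (if 2 ≤ c (ι (1, last)) + c (ι (3, last)) then 1 else 0) +
      (if 2 ≤ c (ι (0, first)) + c (ι (2, first)) then 1 else 0) ≤ ∑ p, c (ι p) +
      (if c (ι (1, first)) + c (ι (3, first)) = 0 then 1 else 0) +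
      (if c (ι (0, last)) + c (ι (2, last)) = 0 then 1 else 0) := by
  subst hk
  obtain rfl : first = ⟨0, by lia⟩ := Fin.ext hf
  obtain rfl : last = ⟨n, by lia⟩ := Fin.ext hl
  have h1 := add_one_le_sum_of_two_le (fun i => if hi : i < n + 1 then
    c (ι (1, ⟨i, hi⟩)) + c (ι (3, ⟨i, hi⟩)) else 0) n (by
      intro i hi
      rw [dif_pos (by lia), dif_pos (by lia)]
      obtain ⟨u, hu, hcu⟩ := hc (ι (0, ⟨i + 1, by lia⟩))
      obtain ⟨v, hv, hcv⟩ := hc (ι (2, ⟨i + 1, by lia⟩))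
      have hu' := h.eq_zero hu
      have hv' := h.eq_two hv
      have key : 0 < c (ι (1, ⟨i + 1, by lia⟩)) + c (ι (3, ⟨i + 1, by lia⟩)) +
          c (ι (1, ⟨i, by lia⟩)) := by
        rcases hu' with rfl | rfl | ⟨h0, -⟩ | ⟨i', h0, rfl⟩
        · lia
        · lia
        · simp at h0
        · obtain rfl : i' = ⟨i, by lia⟩ := Fin.ext (by simpa using h0)
          lia
      have key' : 0 < c (ι (1, ⟨i + 1, by lia⟩)) + c (ι (3, ⟨i + 1, by lia⟩)) +
          c (ι (3, ⟨i, by lia⟩)) := by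
        rcases hv' with rfl | rfl | ⟨h0, -⟩ | ⟨i', h0, rfl⟩
        · lia
        · lia
        · simp at h0
        · obtain rfl : i' = ⟨i, by lia⟩ := Fin.ext (by simpa using h0)
          lia
      lia)
  have h2 := add_one_le_sum_of_two_le (fun i => if hi : n - i < n + 1 then
    c (ι (0, ⟨n - i, hi⟩)) + c (ι (2, ⟨n - i, hi⟩)) else 0) n (by
      intro i hi
      rw [dif_pos (by lia), dif_pos (by lia)]
      obtain ⟨u, hu, hcu⟩ := hc (ι (1, ⟨n - (i + 1), by lia⟩))
      obtain ⟨v, hv, hcv⟩ := hc (ι (3, ⟨n - (i + 1), by lia⟩))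
      have hu' := h.eq_one hu
      have hv' := h.eq_three hv
      have key : 0 < c (ι (0, ⟨n - (i + 1), by lia⟩)) + c (ι (2, ⟨n - (i + 1), by lia⟩)) +
          c (ι (0, ⟨n - i, by lia⟩)) := by
        rcases hu' with rfl | rfl | ⟨h0, -⟩ | ⟨i', h0, rfl⟩
        · lia
        · lia
        · simp only at h0; lia
        · obtain rfl : i' = ⟨n - i, by lia⟩ := Fin.ext (by simp only at h0 ⊢; lia)
          lia
      have key' : 0 < c (ι (0, ⟨n - (i + 1), by lia⟩)) + c (ι (2, ⟨n - (i + 1), by lia⟩)) +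
          c (ι (2, ⟨n - i, by lia⟩)) := by
        rcases hv' with rfl | rfl | ⟨h0, -⟩ | ⟨i', h0, rfl⟩
        · lia
        · lia
        · simp only at h0; lia
        · obtain rfl : i' = ⟨n - i, by lia⟩ := Fin.ext (by simp only at h0 ⊢; lia)
          lia
      lia)
  have hr := Finset.sum_range_reflect (fun i => if hi : i < n + 1 then
    c (ι (0, ⟨i, hi⟩)) + c (ι (2, ⟨i, hi⟩)) else 0) (n + 1)
  simp only [Nat.add_sub_cancel] at hr
  rw [hr, Finset.sum_range] at h2
  rw [Finset.sum_range] at h1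
  simp only [Fin.is_lt, dite_true, Fin.eta, lt_add_iff_pos_left, Nat.sub_zero, Nat.sub_self,
    Nat.lt_add_one, Nat.zero_lt_succ] at h1 h2
  have hs : ∑ p, c (ι p) = ∑ i, (c (ι (1, i)) + c (ι (3, i))) +
      ∑ i, (c (ι (0, i)) + c (ι (2, i))) := by
    rw [Fintype.sum_prod_type_right, ← Finset.sum_add_distrib]
    refine Finset.sum_congr rfl fun i _ => ?_
    rw [Fin.sum_univ_four]
    ring
  rw [hs]
  refine ⟨?_, ?_, by lia⟩
  · obtain ⟨u, hu, hcu⟩ := hc (ι (0, ⟨0, by lia⟩))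
    obtain ⟨v, hv, hcv⟩ := hc (ι (2, ⟨0, by lia⟩))
    rcases h.eq_zero hu with rfl | rfl | ⟨h0, rfl⟩ | ⟨i', h0, rfl⟩
    · lia
    · lia
    · rcases h.eq_two hv with rfl | rfl | ⟨h0, rfl⟩ | ⟨i', h0, rfl⟩
      · lia
      · lia
      · lia
      · simp at h0
    · simp at h0
  · obtain ⟨u, hu, hcu⟩ := hc (ι (1, ⟨n, by lia⟩))
    obtain ⟨v, hv, hcv⟩ := hc (ι (3, ⟨n, by lia⟩))
    rcases h.eq_one hu with rfl | rfl | ⟨h0, rfl⟩ | ⟨i', h0, rfl⟩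
    · lia
    · lia
    · rcases h.eq_three hv with rfl | rfl | ⟨h0, rfl⟩ | ⟨i', h0, rfl⟩
      · lia
      · lia
      · lia
      · have := i'.2; simp only at h0; lia
    · have := i'.2; simp only at h0; lia

end IsChainGraph

end ChainConverse

section CubicConverse

variable {V : Type*} [Fintype V] [DecidableEq V] {G : SimpleGraph V} [DecidableRel G.Adj]

theorem card_edgeFinset_eq_of_iso_gk {k : ℕ} (hk : 1 ≤ k) (e : G ≃g GkGraph k)
    (hconn : G.Connected) (hn : 3 ≤ Fintype.card V) {Δ : ℕ}
    (hΔ2 : G.maxDegree = 2 → Δ = 3) (hΔ3 : 3 ≤ G.maxDegree → Δ = G.maxDegree) :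
    G.edgeFinset.card = Δ * (Fintype.card V - totalDominationNumber G) := by
  have hk1 : k - 1 < k := by lia
  have hchain : IsChainGraph (GkGraph k) id
      ![(2, ⟨0, hk⟩), (3, ⟨k - 1, hk1⟩), (0, ⟨0, hk⟩), (1, ⟨k - 1, hk1⟩)] := by
    rintro ⟨j, i⟩ ⟨j', i'⟩ ⟨-, h⟩
    rcases h with (h | ⟨h1, h2, h3, h4⟩ | ⟨h1, h2, h3, h4⟩) |
      (h | ⟨h1, h2, h3, h4⟩ | ⟨h1, h2, h3, h4⟩)
    · exact Or.inl ⟨_, rfl, Or.inl h⟩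
    · right; simp only [id] at h1 h2 h3 h4; subst h1 h2; simp [gkEnd, Fin.ext_iff, h3, h4]
    · right; simp only [id] at h1 h2 h3 h4; subst h1 h2; simp [gkEnd, Fin.ext_iff, h3, h4]
    · exact Or.inl ⟨_, rfl, Or.inr h⟩
    · right; simp only [id] at h1 h2 h3 h4; subst h1 h2; simp [gkEnd, Fin.ext_iff, h3, h4]
    · right; simp only [id] at h1 h2 h3 h4; subst h1 h2; simp [gkEnd, Fin.ext_iff, h3, h4]
  refine card_edgeFinset_eq_of_iso e hconn hn hΔ2 hΔ3 (fun _ => 3) hchain.exists_three ?_ ?_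
  · refine exists_finset_of_gkBase hk id Function.injective_id
      (fun p q h => ⟨gkBase_ne h, Or.inl (Or.inl h)⟩)
      ![(2, ⟨0, hk⟩), (3, ⟨k - 1, hk1⟩), (0, ⟨0, hk⟩), (1, ⟨k - 1, hk1⟩)] ?_ ?_ ?_ ?_ ?_ ?_ ?_ ?_
    all_goals simp [GkGraph, gkRel]
  · intro c hc
    have h := hchain.le_sum (Nat.sub_add_cancel hk).symm hc (first := ⟨0, hk⟩)
      (last := ⟨k - 1, hk1⟩) rfl rfl
    simp only [id, Matrix.cons_val] at h
    simp only [Finset.sum_const, Finset.card_univ, Fintype.card_prod, Fintype.card_fin,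
      smul_eq_mul]
    obtain ⟨h1, h2, h3⟩ := h
    split_ifs at h3 <;> lia

theorem card_edgeFinset_eq_of_iso_hk {k : ℕ} (hk : 2 ≤ k) (e : G ≃g HkGraph k)
    (hconn : G.Connected) (hn : 3 ≤ Fintype.card V) {Δ : ℕ}
    (hΔ2 : G.maxDegree = 2 → Δ = 3) (hΔ3 : 3 ≤ G.maxDegree → Δ = G.maxDegree) :
    G.edgeFinset.card = Δ * (Fintype.card V - totalDominationNumber G) := by
  have hk0 : 0 < k := by lia
  have hk1 : k - 1 < k := by lia
  have hchain : IsChainGraph (HkGraph k) id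
      ![(1, ⟨k - 1, hk1⟩), (0, ⟨0, hk0⟩), (3, ⟨k - 1, hk1⟩), (2, ⟨0, hk0⟩)] := by
    rintro ⟨j, i⟩ ⟨j', i'⟩ ⟨-, h⟩
    rcases h with (h | ⟨h1, h2, h3, h4⟩ | ⟨h1, h2, h3, h4⟩) |
      (h | ⟨h1, h2, h3, h4⟩ | ⟨h1, h2, h3, h4⟩)
    · exact Or.inl ⟨_, rfl, Or.inl h⟩
    · right; simp only [id] at h1 h2 h3 h4; subst h1 h2; simp [gkEnd, Fin.ext_iff, h3, h4]
    · right; simp only [id] at h1 h2 h3 h4; subst h1 h2; simp [gkEnd, Fin.ext_iff, h3, h4]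
    · exact Or.inl ⟨_, rfl, Or.inr h⟩
    · right; simp only [id] at h1 h2 h3 h4; subst h1 h2; simp [gkEnd, Fin.ext_iff, h3, h4]
    · right; simp only [id] at h1 h2 h3 h4; subst h1 h2; simp [gkEnd, Fin.ext_iff, h3, h4]
  refine card_edgeFinset_eq_of_iso e hconn hn hΔ2 hΔ3 (fun _ => 3) hchain.exists_three ?_ ?_
  · refine exists_finset_of_gkBase hk0 id Function.injective_id
      (fun p q h => ⟨gkBase_ne h, Or.inl (Or.inl h)⟩)
      ![(1, ⟨k - 1, hk1⟩), (0, ⟨0, hk0⟩), (3, ⟨k - 1, hk1⟩), (2, ⟨0, hk0⟩)]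
      ?_ ?_ ?_ ?_ ?_ ?_ ?_ ?_
    all_goals first | (simp [HkGraph, hkRel]; done) | (simp; lia)
  · intro c hc
    have h := hchain.le_sum (Nat.sub_add_cancel hk0).symm hc (first := ⟨0, hk0⟩)
      (last := ⟨k - 1, hk1⟩) rfl rfl
    simp only [id, Matrix.cons_val] at h
    simp only [Finset.sum_const, Finset.card_univ, Fintype.card_prod, Fintype.card_fin,
      smul_eq_mul]
    obtain ⟨h1, h2, h3⟩ := h
    split_ifs at h3 <;> lia

theorem card_edgeFinset_eq_of_iso_fk {k : ℕ} (hk : 1 ≤ k) (e : G ≃g FkGraph k)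
    (hconn : G.Connected) (hn : 3 ≤ Fintype.card V) {Δ : ℕ}
    (hΔ2 : G.maxDegree = 2 → Δ = 3) (hΔ3 : 3 ≤ G.maxDegree → Δ = G.maxDegree) :
    G.edgeFinset.card = Δ * (Fintype.card V - totalDominationNumber G) := by
  have hk1 : k - 1 < k := by lia
  have hchain : IsChainGraph (FkGraph k) Sum.inl
      ![Sum.inr 0, Sum.inl (3, ⟨k - 1, hk1⟩), Sum.inr 2, Sum.inl (1, ⟨k - 1, hk1⟩)] := by
    rintro ⟨j, i⟩ (⟨j', i'⟩ | j') ⟨-, h⟩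
    · rcases h with (h | ⟨h1, h2, h3, h4⟩) | (h | ⟨h1, h2, h3, h4⟩)
      · exact Or.inl ⟨_, rfl, Or.inl h⟩
      · right; simp only at h1 h2 h3 h4; subst h1 h2; simp [gkEnd, Fin.ext_iff, h3, h4]
      · exact Or.inl ⟨_, rfl, Or.inr h⟩
      · right; simp only at h1 h2 h3 h4; subst h1 h2; simp [gkEnd, Fin.ext_iff, h3, h4]
    · rcases h with (⟨h1, h2, h3⟩ | ⟨h1, h2, h3⟩) | h
      · right; simp only at h1 h2 h3; subst h1 h3; simp [gkEnd, h2]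
      · right; simp only at h1 h2 h3; subst h1 h3; simp [gkEnd, h2]
      · exact h.elim
  have hn0 : ∀ w, (FkGraph k).Adj (Sum.inr 0) w →
      w = Sum.inl (0, ⟨0, hk⟩) ∨ w = Sum.inr 1 := by
    rintro (⟨j, i⟩ | i) ⟨-, h⟩
    · rcases h with h | ⟨h1, h2, -⟩ | ⟨-, -, h3⟩
      · exact h.elim
      · exact Or.inl (congrArg Sum.inl (Prod.ext h1 (Fin.ext h2)))
      · exact absurd h3 (by decide)
    · fin_cases i <;> simp [fkRel] at h ⊢
  have hn1 : ∀ w, (FkGraph k).Adj (Sum.inr 1) w → w = Sum.inr 0 ∨ w = Sum.inr 2 := by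
    rintro (⟨j, i⟩ | i) ⟨-, h⟩
    · simp [fkRel] at h
    · fin_cases i <;> simp [fkRel] at h ⊢
  have hn2 : ∀ w, (FkGraph k).Adj (Sum.inr 2) w →
      w = Sum.inl (2, ⟨0, hk⟩) ∨ w = Sum.inr 1 := by
    rintro (⟨j, i⟩ | i) ⟨-, h⟩
    · rcases h with h | ⟨-, -, h3⟩ | ⟨h1, h2, -⟩
      · exact h.elim
      · exact absurd h3 (by decide)
      · exact Or.inl (congrArg Sum.inl (Prod.ext h1 (Fin.ext h2)))
    · fin_cases i <;> simp [fkRel] at h ⊢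
  refine card_edgeFinset_eq_of_iso e hconn hn hΔ2 hΔ3 (Sum.elim (fun _ => 3) fun _ => 2)
    ?_ ?_ ?_
  · rintro (p | i)
    · exact hchain.exists_three p
    · fin_cases i
      · exact ⟨_, _, Sum.inr 0, fun w hw => (hn0 w hw).imp_right Or.inl⟩
      · exact ⟨_, _, Sum.inr 0, fun w hw => (hn1 w hw).imp_right Or.inl⟩
      · exact ⟨_, _, Sum.inr 0, fun w hw => (hn2 w hw).imp_right Or.inl⟩
  · rintro (p | i)
    · refine exists_finset_of_gkBase (K := FkGraph k) hk Sum.inl Sum.inl_injective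
        (fun p q h => ⟨fun he => gkBase_ne h (Sum.inl_injective he), Or.inl (Or.inl h)⟩)
        ![Sum.inr 0, Sum.inl (3, ⟨k - 1, hk1⟩), Sum.inr 2, Sum.inl (1, ⟨k - 1, hk1⟩)]
        ?_ ?_ ?_ ?_ ?_ ?_ ?_ ?_ p
      all_goals simp [FkGraph, fkRel]
    · fin_cases i
      · exact exists_finset_of_two (x := Sum.inl (0, ⟨0, hk⟩)) (y := Sum.inr 1)
          (by simp [FkGraph, fkRel]) (by simp [FkGraph, fkRel]) (by simp)
      · exact exists_finset_of_two (x := Sum.inr 0) (y := Sum.inr 2)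
          (by simp [FkGraph, fkRel]) (by simp [FkGraph, fkRel]) (by simp)
      · exact exists_finset_of_two (x := Sum.inl (2, ⟨0, hk⟩)) (y := Sum.inr 1)
          (by simp [FkGraph, fkRel]) (by simp [FkGraph, fkRel]) (by simp)
  · intro c hc
    have h := hchain.le_sum (Nat.sub_add_cancel hk).symm hc (first := ⟨0, hk⟩)
      (last := ⟨k - 1, hk1⟩) rfl rfl
    simp only [Matrix.cons_val] at h
    have h0 : 0 < c (Sum.inl (0, ⟨0, hk⟩)) + c (Sum.inr 1) := by
      obtain ⟨u, hu, hcu⟩ := hc (Sum.inr 0)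
      rcases hn0 u hu with rfl | rfl <;> lia
    have h1 : 0 < c (Sum.inr 0) + c (Sum.inr 2) := by
      obtain ⟨u, hu, hcu⟩ := hc (Sum.inr 1)
      rcases hn1 u hu with rfl | rfl <;> lia
    have h2 : 0 < c (Sum.inl (2, ⟨0, hk⟩)) + c (Sum.inr 1) := by
      obtain ⟨u, hu, hcu⟩ := hc (Sum.inr 2)
      rcases hn2 u hu with rfl | rfl <;> lia
    simp only [Fintype.sum_sum_type, Sum.elim_inl, Sum.elim_inr, Finset.sum_const,
      Finset.card_univ, Fintype.card_sum, Fintype.card_prod, Fintype.card_fin, smul_eq_mul,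
      Fin.sum_univ_three]
    obtain ⟨h3, h4, h5⟩ := h
    split_ifs at h5 <;> lia

theorem card_edgeFinset_eq_of_iso_lk {k : ℕ} (hk : 1 ≤ k) (e : G ≃g LkGraph k)
    (hconn : G.Connected) (hn : 3 ≤ Fintype.card V) {Δ : ℕ}
    (hΔ2 : G.maxDegree = 2 → Δ = 3) (hΔ3 : 3 ≤ G.maxDegree → Δ = G.maxDegree) :
    G.edgeFinset.card = Δ * (Fintype.card V - totalDominationNumber G) := by
  have hk1 : k - 1 < k := by lia
  have hchain : IsChainGraph (LkGraph k) Sum.inl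
      ![Sum.inr (0, 0), Sum.inr (1, 0), Sum.inr (0, 2), Sum.inr (1, 2)] := by
    rintro ⟨j, i⟩ (⟨j', i'⟩ | j') ⟨-, h⟩
    · exact Or.inl ⟨_, rfl, h⟩
    · rcases h with (⟨h1, h2, h3⟩ | ⟨h1, h2, h3⟩ | ⟨h1, h2, h3⟩ | ⟨h1, h2, h3⟩) | h
      · right; simp only at h1 h2 h3; subst h1 h3; simp [gkEnd, h2]
      · right; simp only at h1 h2 h3; subst h1 h3; simp [gkEnd, h2]
      · right; simp only at h1 h2 h3; subst h1 h3; simp [gkEnd, h2]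
      · right; simp only at h1 h2 h3; subst h1 h3; simp [gkEnd, h2]
      · exact h.elim
  have hn0 : ∀ (j : Fin 2) w, (LkGraph k).Adj (Sum.inr (j, 0)) w →
      w = Sum.inl (![(0, ⟨0, hk⟩), (1, ⟨k - 1, hk1⟩)] j) ∨ w = Sum.inr (j, 1) := by
    rintro j (⟨j', i⟩ | ⟨j', i⟩) ⟨-, h⟩
    · rcases h with h | ⟨h1, h2, h3⟩ | ⟨h1, h2, h3⟩ | ⟨h1, h2, h3⟩ | ⟨h1, h2, h3⟩
      · exact h.elim
      · obtain rfl : j = 0 := congrArg Prod.fst h3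
        exact Or.inl (congrArg Sum.inl (Prod.ext h1 (Fin.ext h2)))
      · exact absurd (congrArg Prod.snd h3) (by simp)
      · obtain rfl : j = 1 := congrArg Prod.fst h3
        exact Or.inl (congrArg Sum.inl (Prod.ext h1 (Fin.ext h2)))
      · exact absurd (congrArg Prod.snd h3) (by simp)
    · fin_cases i <;> simp [lkRel, eq_comm] at h ⊢; exact h
  have hn1 : ∀ (j : Fin 2) w, (LkGraph k).Adj (Sum.inr (j, 1)) w →
      w = Sum.inr (j, 0) ∨ w = Sum.inr (j, 2) := by
    rintro j (⟨j', i⟩ | ⟨j', i⟩) ⟨-, h⟩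
    · simp [lkRel] at h
    · fin_cases i <;> simp [lkRel, eq_comm] at h ⊢ <;> exact h
  have hn2 : ∀ (j : Fin 2) w, (LkGraph k).Adj (Sum.inr (j, 2)) w →
      w = Sum.inl (![(2, ⟨0, hk⟩), (3, ⟨k - 1, hk1⟩)] j) ∨ w = Sum.inr (j, 1) := by
    rintro j (⟨j', i⟩ | ⟨j', i⟩) ⟨-, h⟩
    · rcases h with h | ⟨h1, h2, h3⟩ | ⟨h1, h2, h3⟩ | ⟨h1, h2, h3⟩ | ⟨h1, h2, h3⟩
      · exact h.elim
      · exact absurd (congrArg Prod.snd h3) (by simp)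
      · obtain rfl : j = 0 := congrArg Prod.fst h3
        exact Or.inl (congrArg Sum.inl (Prod.ext h1 (Fin.ext h2)))
      · exact absurd (congrArg Prod.snd h3) (by simp)
      · obtain rfl : j = 1 := congrArg Prod.fst h3
        exact Or.inl (congrArg Sum.inl (Prod.ext h1 (Fin.ext h2)))
    · fin_cases i <;> simp [lkRel, eq_comm] at h ⊢; exact h
  refine card_edgeFinset_eq_of_iso e hconn hn hΔ2 hΔ3 (Sum.elim (fun _ => 3) fun _ => 2)
    ?_ ?_ ?_
  · rintro (p | ⟨j, i⟩)
    · exact hchain.exists_three p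
    · fin_cases i
      · exact ⟨_, _, Sum.inr (0, 0), fun w hw => (hn0 j w hw).imp_right Or.inl⟩
      · exact ⟨_, _, Sum.inr (0, 0), fun w hw => (hn1 j w hw).imp_right Or.inl⟩
      · exact ⟨_, _, Sum.inr (0, 0), fun w hw => (hn2 j w hw).imp_right Or.inl⟩
  · rintro (p | ⟨j, i⟩)
    · refine exists_finset_of_gkBase (K := LkGraph k) hk Sum.inl Sum.inl_injective
        (fun p q h => ⟨fun he => gkBase_ne h (Sum.inl_injective he), Or.inl h⟩)
        ![Sum.inr (0, 0), Sum.inr (1, 0), Sum.inr (0, 2), Sum.inr (1, 2)]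
        ?_ ?_ ?_ ?_ ?_ ?_ ?_ ?_ p
      all_goals simp [LkGraph, lkRel]
    · fin_cases i
      · refine exists_finset_of_two (x := Sum.inl (![(0, ⟨0, hk⟩), (1, ⟨k - 1, hk1⟩)] j))
          (y := Sum.inr (j, 1)) ?_ (by simp [LkGraph, lkRel]) (by simp)
        fin_cases j <;> simp [LkGraph, lkRel]
      · exact exists_finset_of_two (x := Sum.inr (j, 0)) (y := Sum.inr (j, 2))
          (by simp [LkGraph, lkRel]) (by simp [LkGraph, lkRel]) (by simp)
      · refine exists_finset_of_two (x := Sum.inl (![(2, ⟨0, hk⟩), (3, ⟨k - 1, hk1⟩)] j))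
          (y := Sum.inr (j, 1)) ?_ (by simp [LkGraph, lkRel]) (by simp)
        fin_cases j <;> simp [LkGraph, lkRel]
  · intro c hc
    have h := hchain.le_sum (Nat.sub_add_cancel hk).symm hc (first := ⟨0, hk⟩)
      (last := ⟨k - 1, hk1⟩) rfl rfl
    simp only [Matrix.cons_val] at h
    have h0 : ∀ j : Fin 2, 0 < c (Sum.inl (![(0, ⟨0, hk⟩), (1, ⟨k - 1, hk1⟩)] j)) +
        c (Sum.inr (j, 1)) := fun j => by
      obtain ⟨u, hu, hcu⟩ := hc (Sum.inr (j, 0))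
      rcases hn0 j u hu with rfl | rfl <;> lia
    have h1 : ∀ j : Fin 2, 0 < c (Sum.inr (j, 0)) + c (Sum.inr (j, 2)) := fun j => by
      obtain ⟨u, hu, hcu⟩ := hc (Sum.inr (j, 1))
      rcases hn1 j u hu with rfl | rfl <;> lia
    have h2 : ∀ j : Fin 2, 0 < c (Sum.inl (![(2, ⟨0, hk⟩), (3, ⟨k - 1, hk1⟩)] j)) +
        c (Sum.inr (j, 1)) := fun j => by
      obtain ⟨u, hu, hcu⟩ := hc (Sum.inr (j, 2))
      rcases hn2 j u hu with rfl | rfl <;> lia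
    have h00 := h0 0
    have h01 := h0 1
    have h10 := h1 0
    have h11 := h1 1
    have h20 := h2 0
    have h21 := h2 1
    simp only [Matrix.cons_val] at h00 h01 h20 h21
    simp only [Fintype.sum_sum_type, Sum.elim_inl, Sum.elim_inr,
      Finset.sum_const, Finset.card_univ, Fintype.card_sum, Fintype.card_prod, Fintype.card_fin,
      smul_eq_mul]
    have hs : ∑ q : Fin 2 × Fin 3, c (Sum.inr q) =
        c (Sum.inr (0, 0)) + c (Sum.inr (0, 1)) + c (Sum.inr (0, 2)) +
        (c (Sum.inr (1, 0)) + c (Sum.inr (1, 1)) + c (Sum.inr (1, 2))) := by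
      simp only [Fintype.sum_prod_type, Fin.sum_univ_two, Fin.sum_univ_three]
    rw [hs]
    obtain ⟨h3, h4, h5⟩ := h
    split_ifs at h5 <;> lia

end CubicConverse

section SmallConverse

variable {V : Type*} [Fintype V] [DecidableEq V] {G : SimpleGraph V} [DecidableRel G.Adj]

theorem card_edgeFinset_eq_of_iso_cycle_three (e : G ≃g cycleG 3)
    (hconn : G.Connected) (hn : 3 ≤ Fintype.card V) {Δ : ℕ}
    (hΔ2 : G.maxDegree = 2 → Δ = 3) (hΔ3 : 3 ≤ G.maxDegree → Δ = G.maxDegree) :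
    G.edgeFinset.card = Δ * (Fintype.card V - totalDominationNumber G) := by
  have hadj : ∀ i j, (cycleG 3).Adj i j ↔ j = i + 1 ∨ j = i + 2 := by
    simp only [cycleG, SimpleGraph.fromRel_adj]
    decide
  refine card_edgeFinset_eq_of_iso e hconn hn hΔ2 hΔ3 (fun _ => 2) ?_ ?_ ?_
  · exact fun w => ⟨w + 1, w + 2, w, fun v hv => ((hadj w v).1 hv).imp_right Or.inl⟩
  · exact fun w => exists_finset_of_two ((hadj _ _).2 (Or.inl rfl)) ((hadj _ _).2 (Or.inr rfl))
      (by simp)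
  · intro c hc
    have h : ∀ i, 0 < c (i + 1) + c (i + 2) := fun i => by
      obtain ⟨u, hu, hcu⟩ := hc i
      rcases (hadj _ _).1 hu with rfl | rfl <;> lia
    have h0 := h 0
    have h1 := h 1
    have h2 := h 2
    simp only [Fin.sum_univ_three, Fintype.card_fin]
    simp only [Fin.reduceAdd] at h0 h1 h2
    lia

theorem card_edgeFinset_eq_of_iso_cycle_six (e : G ≃g cycleG 6)
    (hconn : G.Connected) (hn : 3 ≤ Fintype.card V) {Δ : ℕ}
    (hΔ2 : G.maxDegree = 2 → Δ = 3) (hΔ3 : 3 ≤ G.maxDegree → Δ = G.maxDegree) :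
    G.edgeFinset.card = Δ * (Fintype.card V - totalDominationNumber G) := by
  have hadj : ∀ i j, (cycleG 6).Adj i j ↔ j = i + 1 ∨ j = i + 5 := by
    simp only [cycleG, SimpleGraph.fromRel_adj]
    decide
  refine card_edgeFinset_eq_of_iso e hconn hn hΔ2 hΔ3 (fun _ => 2) ?_ ?_ ?_
  · exact fun w => ⟨w + 1, w + 5, w, fun v hv => ((hadj w v).1 hv).imp_right Or.inl⟩
  · exact fun w => exists_finset_of_two ((hadj _ _).2 (Or.inl rfl)) ((hadj _ _).2 (Or.inr rfl))
      (by simp)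
  · intro c hc
    have h : ∀ i, 0 < c (i + 1) + c (i + 5) := fun i => by
      obtain ⟨u, hu, hcu⟩ := hc i
      rcases (hadj _ _).1 hu with rfl | rfl <;> lia
    have h0 := h 0
    have h1 := h 1
    have h2 := h 2
    have h3 := h 3
    have h4 := h 4
    have h5 := h 5
    simp only [Fin.sum_univ_six, Fintype.card_fin]
    simp only [Fin.reduceAdd] at h0 h1 h2 h3 h4 h5
    simp
    lia

theorem card_edgeFinset_eq_of_iso_gp (e : G ≃g GP16)
    (hconn : G.Connected) (hn : 3 ≤ Fintype.card V) {Δ : ℕ}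
    (hΔ2 : G.maxDegree = 2 → Δ = 3) (hΔ3 : 3 ≤ G.maxDegree → Δ = G.maxDegree) :
    G.edgeFinset.card = Δ * (Fintype.card V - totalDominationNumber G) := by
  have hadj0 : ∀ i q, GP16.Adj (0, i) q ↔ q = (0, i + 1) ∨ q = (0, i + 7) ∨ q = (1, i) := by
    simp only [GP16, SimpleGraph.fromRel_adj, gpRel]
    decide
  have hadj1 : ∀ i q, GP16.Adj (1, i) q ↔ q = (1, i + 3) ∨ q = (1, i + 5) ∨ q = (0, i) := by
    simp only [GP16, SimpleGraph.fromRel_adj, gpRel]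
    decide
  refine card_edgeFinset_eq_of_iso e hconn hn hΔ2 hΔ3 (fun _ => 3) ?_ ?_ ?_
  · rintro ⟨j, i⟩
    fin_cases j
    · exact ⟨_, _, _, fun v hv => (hadj0 i v).1 hv⟩
    · exact ⟨_, _, _, fun v hv => (hadj1 i v).1 hv⟩
  · rintro ⟨j, i⟩
    fin_cases j
    · exact exists_finset_of_three ((hadj0 i _).2 (Or.inl rfl))
        ((hadj0 i _).2 (Or.inr (Or.inl rfl))) ((hadj0 i _).2 (Or.inr (Or.inr rfl)))
        (by simp) (by simp) (by simp)
    · exact exists_finset_of_three ((hadj1 i _).2 (Or.inl rfl))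
        ((hadj1 i _).2 (Or.inr (Or.inl rfl))) ((hadj1 i _).2 (Or.inr (Or.inr rfl)))
        (by simp) (by simp) (by simp)
  · intro c hc
    have h : ∀ i, 0 < c (0, i + 1) + c (0, i + 7) + c (1, i) := fun i => by
      obtain ⟨u, hu, hcu⟩ := hc (0, i)
      rcases (hadj0 _ _).1 hu with rfl | rfl | rfl <;> lia
    have h' : ∀ i, 0 < c (1, i + 3) + c (1, i + 5) + c (0, i) := fun i => by
      obtain ⟨u, hu, hcu⟩ := hc (1, i)
      rcases (hadj1 _ _).1 hu with rfl | rfl | rfl <;> lia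
    have h0 := h 0
    have h1 := h 1
    have h2 := h 2
    have h3 := h 3
    have h4 := h 4
    have h5 := h 5
    have h6 := h 6
    have h7 := h 7
    have k0 := h' 0
    have k1 := h' 1
    have k2 := h' 2
    have k3 := h' 3
    have k4 := h' 4
    have k5 := h' 5
    have k6 := h' 6
    have k7 := h' 7
    simp only [Fin.reduceAdd] at h0 h1 h2 h3 h4 h5 h6 h7 k0 k1 k2 k3 k4 k5 k6 k7
    simp only [Fintype.sum_prod_type, Fin.sum_univ_two, Fin.sum_univ_eight, Fintype.card_prod,
      Fintype.card_fin]
    have e0 : 4 ≤ c (0, 0) + c (0, 2) + c (0, 4) + c (0, 6) + c (1, 1) + c (1, 3) + c (1, 5) +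
      c (1, 7) := by
      clear k1 k3 k5 k7 h0 h2 h4 h6
      lia
    have e1 : 4 ≤ c (0, 1) + c (0, 3) + c (0, 5) + c (0, 7) + c (1, 0) + c (1, 2) + c (1, 4) +
      c (1, 6) := by
      clear k0 k2 k4 k6 h1 h3 h5 h7
      lia
    lia

end SmallConverse

/-- For a connected graph `G` of order `n ≥ 3`, `m ≤ Δ(n − γt)`, with equality if and only if
`G` is isomorphic to `C_k ∘ P_2` (`k ≥ 3`), `F_k` (`k ≥ 0`, where `F_0 = C_3`),
`L_k` (`k ≥ 0`, where `L_0 = C_6`), `G_k` (`k ≥ 1`), `H_k` (`k ≥ 2`), or `GP_16`. -/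
theorem size_eq_Delta_mul_order_sub_totalDominationNumber_iff
    {V : Type*} [Fintype V] [DecidableEq V] (G : SimpleGraph V) [DecidableRel G.Adj]
    (hconn : G.Connected) (hn : 3 ≤ Fintype.card V)
    (Δ : ℕ) (hΔ2 : G.maxDegree = 2 → Δ = 3) (hΔ3 : 3 ≤ G.maxDegree → Δ = G.maxDegree) :
    G.edgeFinset.card ≤ Δ * (Fintype.card V - totalDominationNumber G) ∧
    (G.edgeFinset.card = Δ * (Fintype.card V - totalDominationNumber G) ↔
      ((∃ k, 3 ≤ k ∧ Nonempty (G ≃g coronaGraph k)) ∨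
       Nonempty (G ≃g cycleG 3) ∨
       (∃ k, 1 ≤ k ∧ Nonempty (G ≃g FkGraph k)) ∨
       Nonempty (G ≃g cycleG 6) ∨
       (∃ k, 1 ≤ k ∧ Nonempty (G ≃g LkGraph k)) ∨
       (∃ k, 1 ≤ k ∧ Nonempty (G ≃g GkGraph k)) ∨
       (∃ k, 2 ≤ k ∧ Nonempty (G ≃g HkGraph k)) ∨
       Nonempty (G ≃g GP16))) := by
  have hmin := two_le_maxDegree hconn hn
  have hΔ : 3 ≤ Δ := by
    rcases Nat.lt_or_ge G.maxDegree 3 with h | h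
    · exact (hΔ2 (by lia)).ge
    · exact (hΔ3 h).symm ▸ h
  have hmax : G.maxDegree ≤ Δ := by
    rcases Nat.lt_or_ge G.maxDegree 3 with h | h
    · lia
    · exact (hΔ3 h).ge
  refine ⟨card_edgeFinset_le hconn hn hΔ hmax, fun heq => ?_, ?_⟩
  · rcases corona_or_tight hconn hn hΔ hmax heq with h | hT
    · exact Or.inl h
    refine Or.inr ?_
    by_cases h2 : ∀ v, G.degree v = 2
    · rcases TightGraph.exists_iso_of_two hT hconn h2 with h | h
      · exact Or.inl h
      · exact Or.inr (Or.inr (Or.inl h))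
    push Not at h2
    obtain ⟨v₃, h₃⟩ := h2
    replace h₃ := (TightGraph.degree_eq hT v₃).resolve_left h₃
    by_cases h3 : ∀ v, G.degree v = 3
    · by_cases hC : ∀ x y e f, x ≠ y → G.Adj x e → G.Adj x f → G.Adj y e → G.Adj y f → e = f
      · exact Or.inr (Or.inr (Or.inr (Or.inr (Or.inr (Or.inr
          (TightGraph.exists_iso_of_not_square hT hconn h3 hC))))))
      · push Not at hC
        obtain ⟨x, y, e, f, hxy, hxe, hxf, hye, hyf, hef⟩ := hC
        rcases TightGraph.exists_iso_of_square hT hconn h3 hxy hef hxe hxf hye hyf with h | h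
        · exact Or.inr (Or.inr (Or.inr (Or.inr (Or.inl h))))
        · exact Or.inr (Or.inr (Or.inr (Or.inr (Or.inr (Or.inl h)))))
    · push Not at h3
      obtain ⟨v₂, h₂⟩ := h3
      replace h₂ := (TightGraph.degree_eq hT v₂).resolve_right h₂
      rcases TightGraph.exists_iso_of_mixed hT hconn h₂ h₃ with h | h
      · exact Or.inr (Or.inl h)
      · exact Or.inr (Or.inr (Or.inr (Or.inl h)))
  · rintro (⟨k, hk, ⟨e⟩⟩ | ⟨⟨e⟩⟩ | ⟨k, hk, ⟨e⟩⟩ | ⟨⟨e⟩⟩ | ⟨k, hk, ⟨e⟩⟩ | ⟨k, hk, ⟨e⟩⟩ |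
      ⟨k, hk, ⟨e⟩⟩ | ⟨⟨e⟩⟩)
    · exact card_edgeFinset_eq_of_iso_corona hk e hconn hn hΔ2 hΔ3
    · exact card_edgeFinset_eq_of_iso_cycle_three e hconn hn hΔ2 hΔ3
    · exact card_edgeFinset_eq_of_iso_fk hk e hconn hn hΔ2 hΔ3
    · exact card_edgeFinset_eq_of_iso_cycle_six e hconn hn hΔ2 hΔ3
    · exact card_edgeFinset_eq_of_iso_lk hk e hconn hn hΔ2 hΔ3
    · exact card_edgeFinset_eq_of_iso_gk hk e hconn hn hΔ2 hΔ3
    · exact card_edgeFinset_eq_of_iso_hk hk e hconn hn hΔ2 hΔ3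
    · exact card_edgeFinset_eq_of_iso_gp e hconn hn hΔ2 hΔ3
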